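/- arXiv:0911.3682 — 10 statements merged into one kernel-verified Lean document; each statement's English description precedes it below -/
import Mathlib

section
/- The automorphism group of the direct product Q₈ × C₂ × C₂ (the Hamiltonian group of order 32, where Q₈ is the quaternion group of order 8) is a complete group of order 9216; that is, it has order 9216, trivial center, and every automorphism of it is inner. -/
/-- The Hamiltonian group of order 32: `Q₈ × C₂ × C₂`. -/
abbrev HamiltonianGroup32 : Type :=
  QuaternionGroup 2 × Multiplicative (ZMod 2) × Multiplicative (ZMod 2)

namespace HamiltonianAut

local notation "G" => HamiltonianGroup32

/-- The first standard generator of `Q₈`, in `Q₈ × C₂ × C₂`. -/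
def qi : G := (QuaternionGroup.a 1, 1, 1)

/-- The second standard generator of `Q₈`, in `Q₈ × C₂ × C₂`. -/
def qj : G := (QuaternionGroup.xa 0, 1, 1)

/-- The generator of the first factor `C₂`. -/
def c₁ : G := (1, Multiplicative.ofAdd 1, 1)

/-- The generator of the second factor `C₂`. -/
def c₂ : G := (1, 1, Multiplicative.ofAdd 1)

/-- The involution of `Q₈`, which generates the commutator subgroup. -/
def z : G := (QuaternionGroup.a 2, 1, 1)

/-- The image of an element of `Q₈ × C₂ × C₂` under the substitution of `x, y, u, v` for the
standard generators. -/
def word {K : Type*} [Group K] (x y u v : K) : G → K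
  | (QuaternionGroup.a n, e, f) => x ^ ZMod.val n * u ^ e.toAdd.val * v ^ f.toAdd.val
  | (QuaternionGroup.xa n, e, f) => y * x ^ ZMod.val n * u ^ e.toAdd.val * v ^ f.toAdd.val

theorem word_generators (g : G) : word qi qj c₁ c₂ g = g := by
  revert g; decide +kernel

theorem map_eq_word {K : Type*} [Group K] (f : G →* K) (g : G) :
    f g = word (f qi) (f qj) (f c₁) (f c₂) g := by
  conv_lhs => rw [← word_generators g]
  rcases g with ⟨n | n, e, f⟩ <;> simp [word]

theorem aut_ext {α β : MulAut G} (hi : α qi = β qi) (hj : α qj = β qj) (hc : α c₁ = β c₁)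
    (hd : α c₂ = β c₂) : α = β := by
  ext1 g
  have h1 := map_eq_word α.toMonoidHom g
  have h2 := map_eq_word β.toMonoidHom g
  simp only [MulEquiv.toMonoidHom_eq_coe, MonoidHom.coe_coe] at h1 h2
  rw [h1, h2, hi, hj, hc, hd]

theorem mul_self_eq (g : G) : g * g = 1 ∨ g * g = z := by
  revert g; decide +kernel

theorem mul_comm_of_mul_self {g : G} (h : G) : g * g = 1 → g * h = h * g := by
  revert g h; decide +kernel

@[simp]
theorem aut_z (α : MulAut G) : α z = z := by
  have h : α z = α qi * α qi := by rw [← map_mul]; rfl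
  rcases mul_self_eq (α qi) with h1 | h1
  · rw [h1, map_eq_one_iff α α.injective] at h
    exact absurd h (by decide +kernel)
  · rw [h, h1]

/-- The possible images of `(qi, qj)` under an automorphism. -/
abbrev QuatPair : Type :=
  {p : G × G // p.1 * p.1 = z ∧ p.2 * p.2 = z ∧ p.1 * p.2 = z * (p.2 * p.1)}

/-- The possible images of `(c₁, c₂)` under an automorphism. -/
abbrev CentralPair : Type :=
  {p : G × G // p.1 * p.1 = 1 ∧ p.2 * p.2 = 1 ∧ p.1.2 ≠ 1 ∧ p.2.2 ≠ 1 ∧ p.1.2 ≠ p.2.2}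

theorem card_quatPair : Nat.card QuatPair = 384 := by
  rw [Nat.card_eq_fintype_card]; decide +kernel

theorem card_centralPair : Nat.card CentralPair = 24 := by
  rw [Nat.card_eq_fintype_card]; decide +kernel

theorem pow_val_add {K : Type*} [Monoid K] {n : ℕ} [NeZero n] {x : K} (hx : x ^ n = 1)
    (a b : ZMod n) : x ^ (a + b).val = x ^ a.val * x ^ b.val := by
  rw [ZMod.val_add, ← pow_add, ← pow_eq_pow_mod _ hx]

theorem pow_val_sub {K : Type*} [Group K] {n : ℕ} [NeZero n] {x : K} (hx : x ^ n = 1)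
    (a b : ZMod n) : x ^ (a - b).val = (x ^ b.val)⁻¹ * x ^ a.val := by
  rw [eq_inv_mul_iff_mul_eq, ← pow_val_add hx, add_sub_cancel]

theorem word_mul {K : Type*} [Group K] {x y u v : K} (hx : x ^ 4 = 1)
    (hy : y * y = x ^ 2) (hxy : x * y = y * x⁻¹) (hu : u ^ 2 = 1) (hv : v ^ 2 = 1)
    (hux : Commute u x) (huy : Commute u y) (hvx : Commute v x) (hvy : Commute v y)
    (huv : Commute u v) (g h : G) : word x y u v (g * h) = word x y u v g * word x y u v h := by
  have hsemi (m : ℕ) : x ^ m * y = y * (x ^ m)⁻¹ := by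
    have h : SemiconjBy y (x⁻¹ ^ m) (x ^ m) := SemiconjBy.pow_right hxy.symm m
    rw [← h.eq, inv_pow]
  have key (p q : K) (m n m' n' : ℕ) (huq : Commute u q) (hvq : Commute v q) :
      p * u ^ m * v ^ n * (q * u ^ m' * v ^ n') = p * q * (u ^ m * u ^ m') * (v ^ n * v ^ n') := by
    have h1 : v ^ n * (q * u ^ m') = q * u ^ m' * v ^ n :=
      ((hvq.mul_right (huv.symm.pow_right m')).pow_left n).eq
    have h2 : u ^ m * q = q * u ^ m := (huq.pow_left m).eq
    rw [← mul_assoc, mul_assoc _ (v ^ n), h1, ← mul_assoc, ← mul_assoc, mul_assoc p, h2]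
    simp only [mul_assoc]
  have hval2 : x ^ ZMod.val ((2 : ℕ) : ZMod (2 * 2)) = x ^ 2 := rfl
  rcases g with ⟨m | m, e, f⟩ <;> rcases h with ⟨n | n, e', f'⟩ <;>
    simp only [word, Prod.mk_mul_mk, QuaternionGroup.a_mul_a, QuaternionGroup.a_mul_xa,
      QuaternionGroup.xa_mul_a, QuaternionGroup.xa_mul_xa, toAdd_mul, pow_val_add hu,
      pow_val_add hv]
  · rw [key _ _ _ _ _ _ (hux.pow_right _) (hvx.pow_right _), pow_val_add (n := 2 * 2) hx]
  · rw [key _ _ _ _ _ _ (huy.mul_right (hux.pow_right _)) (hvy.mul_right (hvx.pow_right _)),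
      pow_val_sub (n := 2 * 2) hx]
    congr 2
    rw [← mul_assoc, ← mul_assoc, hsemi]
  · rw [key _ _ _ _ _ _ (hux.pow_right _) (hvx.pow_right _), pow_val_add (n := 2 * 2) hx]
    congr 2
    rw [mul_assoc]
  · rw [key _ _ _ _ _ _ (huy.mul_right (hux.pow_right _)) (hvy.mul_right (hvx.pow_right _)),
      pow_val_sub (n := 2 * 2) hx, pow_val_add (n := 2 * 2) hx, hval2, ← mul_assoc (y * x ^ m.val)]
    simp only [← mul_assoc]
    congr 4
    rw [mul_assoc y, hsemi, ← mul_assoc, hy, ← inv_pow]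
    rw [((Commute.refl x).inv_left.pow_pow _ _).eq]

/-- The endomorphism of `Q₈ × C₂ × C₂` with prescribed values on the generators. -/
def endOf (x y u v : G) (hx : x * x = z) (hy : y * y = z) (hxy : x * y = z * (y * x))
    (hu : u * u = 1) (hv : v * v = 1) : G →* G :=
  MonoidHom.mk' (word x y u v) <| by
    have hz : z * z = 1 := by decide +kernel
    have hx4 : x ^ 4 = 1 := by rw [show 4 = 2 * 2 from rfl, pow_mul, sq x, hx, sq, hz]
    refine word_mul hx4 (by rw [hy, sq, hx]) ?_ (by rw [sq, hu]) (by rw [sq, hv])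
      (mul_comm_of_mul_self _ hu) (mul_comm_of_mul_self _ hu) (mul_comm_of_mul_self _ hv)
      (mul_comm_of_mul_self _ hv) (mul_comm_of_mul_self _ hu)
    rw [eq_mul_inv_iff_mul_eq, hxy, mul_comm_of_mul_self _ hz, mul_assoc, mul_assoc,
      mul_comm_of_mul_self _ hz, ← mul_assoc x x, hx, hz, mul_one]

@[simp]
theorem endOf_apply (x y u v : G) (hx : x * x = z) (hy : y * y = z) (hxy : x * y = z * (y * x))
    (hu : u * u = 1) (hv : v * v = 1) (g : G) :
    endOf x y u v hx hy hxy hu hv g = word x y u v g := rfl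

theorem word_qi {K : Type*} [Group K] (x y u v : K) : word x y u v qi = x := by
  change x ^ 1 * u ^ 0 * v ^ 0 = x
  simp

theorem word_qj {K : Type*} [Group K] (x y u v : K) : word x y u v qj = y := by
  change y * x ^ 0 * u ^ 0 * v ^ 0 = y
  simp

theorem word_c₁ {K : Type*} [Group K] (x y u v : K) : word x y u v c₁ = u := by
  change x ^ 0 * u ^ 1 * v ^ 0 = u
  simp

theorem word_c₂ {K : Type*} [Group K] (x y u v : K) : word x y u v c₂ = v := by
  change x ^ 0 * u ^ 0 * v ^ 1 = v
  simp

theorem eq_of_mul_self {g : G} (h : g * g = 1) :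
    ∃ a b c : Fin 2, g = z ^ (a : ℕ) * c₁ ^ (b : ℕ) * c₂ ^ (c : ℕ) := by
  revert g; decide +kernel

theorem map_eq_self_of_mul_self {f : G →* G} (hz : f z = z) (h₁ : f c₁ = c₁) (h₂ : f c₂ = c₂)
    {g : G} (hg : g * g = 1) : f g = g := by
  obtain ⟨a, b, c, rfl⟩ := eq_of_mul_self hg
  simp only [map_mul, map_pow, hz, h₁, h₂]

/-- The automorphism fixing `c₁` and `c₂` with prescribed values on `qi` and `qj`. -/
noncomputable def quatAut (p : QuatPair) : MulAut G :=
  MulEquiv.ofBijective (endOf p.1.1 p.1.2 c₁ c₂ p.2.1 p.2.2.1 p.2.2.2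
    (by decide +kernel) (by decide +kernel)) <| by
    rw [← Finite.injective_iff_bijective, injective_iff_map_eq_one]
    intro g hg
    set f := endOf p.1.1 p.1.2 c₁ c₂ p.2.1 p.2.2.1 p.2.2.2 (by decide +kernel) (by decide +kernel)
    have hz : f z = z := by
      rw [show z = qi * qi from rfl, map_mul]
      simp only [f, endOf_apply, word_qi, p.2.1]
      rfl
    rcases mul_self_eq g with h | h
    · rwa [map_eq_self_of_mul_self hz (word_c₁ _ p.1.2 _ _) (word_c₂ _ p.1.2 _ _) h] at hg
    · have h1 : f (g * g) = 1 := by rw [map_mul, hg, one_mul]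
      rw [h, hz] at h1
      exact absurd h1 (by decide +kernel)

set_option synthInstance.maxSize 1000 in
/-- The automorphism fixing `qi` and `qj` with prescribed values on `c₁` and `c₂`. -/
noncomputable def centralAut (p : CentralPair) : MulAut G :=
  MulEquiv.ofBijective (endOf qi qj p.1.1 p.1.2 (by decide +kernel) (by decide +kernel)
    (by decide +kernel) p.2.1 p.2.2.1) <| by
    rw [← Finite.injective_iff_bijective, injective_iff_map_eq_one]
    have h : ∀ u v : G, u * u = 1 → v * v = 1 → u.2 ≠ 1 → v.2 ≠ 1 → u.2 ≠ v.2 →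
        ∀ g, word qi qj u v g = 1 → g = 1 := by decide +kernel
    exact h _ _ p.2.1 p.2.2.1 p.2.2.2.1 p.2.2.2.2.1 p.2.2.2.2.2

@[simp] theorem quatAut_qi (p : QuatPair) : quatAut p qi = p.1.1 := word_qi _ p.1.2 _ _
@[simp] theorem quatAut_qj (p : QuatPair) : quatAut p qj = p.1.2 := word_qj ..
@[simp] theorem quatAut_c₁ (p : QuatPair) : quatAut p c₁ = c₁ := word_c₁ _ p.1.2 _ _
@[simp] theorem quatAut_c₂ (p : QuatPair) : quatAut p c₂ = c₂ := word_c₂ _ p.1.2 _ _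
@[simp] theorem centralAut_qi (p : CentralPair) : centralAut p qi = qi := word_qi _ qj _ _
@[simp] theorem centralAut_qj (p : CentralPair) : centralAut p qj = qj := word_qj ..
@[simp] theorem centralAut_c₁ (p : CentralPair) : centralAut p c₁ = p.1.1 := word_c₁ _ qj _ _
@[simp] theorem centralAut_c₂ (p : CentralPair) : centralAut p c₂ = p.1.2 := word_c₂ _ qj _ _

theorem aut_eq_self_of_mul_self {α : MulAut G} (h₁ : α c₁ = c₁) (h₂ : α c₂ = c₂)
    {g : G} (hg : g * g = 1) : α g = g :=
  map_eq_self_of_mul_self (f := α.toMonoidHom) (aut_z α) h₁ h₂ hg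

theorem quatAut_of_mul_self (p : QuatPair) {g : G} (hg : g * g = 1) : quatAut p g = g :=
  aut_eq_self_of_mul_self (quatAut_c₁ p) (quatAut_c₂ p) hg

theorem aut_mul_self (α : MulAut G) {g h : G} (hg : g * g = h) : α g * α g = α h := by
  rw [← map_mul, hg]

/-- The images of `qi` and `qj` under an automorphism. -/
def quatPairOf (α : MulAut G) : QuatPair :=
  ⟨(α qi, α qj), by rw [aut_mul_self α (h := z) rfl, aut_z],
    by rw [aut_mul_self α (h := z) rfl, aut_z], by
      rw [← map_mul, ← map_mul, show qi * qj = z * (qj * qi) by decide +kernel, map_mul, aut_z]⟩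

theorem aut_snd_ne_one (α : MulAut G) {g : G} (h1 : g ≠ 1) (hz : g ≠ z) (hg : g * g = 1) :
    (α g).2 ≠ 1 := by
  have key : ∀ h : G, h * h = 1 → h.2 = 1 → h = 1 ∨ h = z := by decide +kernel
  intro h
  rcases key (α g) (by rw [aut_mul_self α hg, map_one]) h with h | h
  · exact h1 (by simpa using h)
  · exact hz (α.injective (by rw [h, aut_z]))

/-- The images of `c₁` and `c₂` under an automorphism. -/
def centralPairOf (α : MulAut G) : CentralPair :=
  ⟨(α c₁, α c₂), by rw [aut_mul_self α (h := 1) rfl, map_one],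
    by rw [aut_mul_self α (h := 1) rfl, map_one],
    aut_snd_ne_one α (by decide +kernel) (by decide +kernel) (by decide +kernel),
    aut_snd_ne_one α (by decide +kernel) (by decide +kernel) (by decide +kernel), fun h => by
      refine aut_snd_ne_one α (g := c₁ * c₂) (by decide +kernel) (by decide +kernel)
        (by decide +kernel) ?_
      have key : ∀ w : Multiplicative (ZMod 2) × Multiplicative (ZMod 2), w * w = 1 := by
        decide +kernel
      rw [map_mul, Prod.snd_mul]
      exact h ▸ key _⟩

theorem quatAut_mul_centralAut (α : MulAut G) :
    quatAut (quatPairOf α) * centralAut (centralPairOf α) = α := by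
  apply aut_ext
  · simp [quatPairOf]
  · simp [quatPairOf]
  · rw [MulAut.mul_apply, centralAut_c₁, quatAut_of_mul_self _ (centralPairOf α).2.1]
    rfl
  · rw [MulAut.mul_apply, centralAut_c₂, quatAut_of_mul_self _ (centralPairOf α).2.2.1]
    rfl

/-- An automorphism amounts to a choice of images of `qi, qj` and of `c₁, c₂`. -/
noncomputable def autEquiv : MulAut G ≃ QuatPair × CentralPair where
  toFun α := (quatPairOf α, centralPairOf α)
  invFun p := quatAut p.1 * centralAut p.2
  left_inv := quatAut_mul_centralAut
  right_inv := by
    rintro ⟨p, q⟩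
    ext1 <;> apply Subtype.ext <;>
      simp [quatPairOf, centralPairOf, quatAut_of_mul_self _ q.2.1, quatAut_of_mul_self _ q.2.2.1]

theorem card_aut : Nat.card (MulAut G) = 9216 := by
  rw [Nat.card_congr autEquiv, Nat.card_prod, card_quatPair, card_centralPair]

instance : Finite (MulAut G) := Nat.finite_of_card_ne_zero (by rw [card_aut]; decide)

theorem aut_ext' {α β : MulAut G}
    (h : α qi = β qi ∧ α qj = β qj ∧ α c₁ = β c₁ ∧ α c₂ = β c₂) : α = β :=
  aut_ext h.1 h.2.1 h.2.2.1 h.2.2.2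

/-- The class of an element modulo the center. -/
def cl : G → Bool × Bool
  | (QuaternionGroup.a n, _) => (ZMod.val n % 2 == 1, false)
  | (QuaternionGroup.xa n, _) => (ZMod.val n % 2 == 1, true)

/-- A representative of a class modulo the center. -/
def rep (r : Bool × Bool) : G := qi ^ r.1.toNat * qj ^ r.2.toNat

theorem cl_rep (r : Bool × Bool) : cl (rep r) = r := by
  revert r; decide +kernel

theorem cl_eq_iff (g h : G) : cl g = cl h ↔ g⁻¹ * h * (g⁻¹ * h) = 1 := by
  revert g h; decide +kernel

theorem cl_aut (α : MulAut G) {g h : G} (hgh : cl g = cl h) : cl (α g) = cl (α h) := by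
  rw [cl_eq_iff] at hgh ⊢
  rw [← map_inv, ← map_mul, aut_mul_self α hgh, map_one]

/-- The action of the automorphism group on the quotient by the center. -/
def quotAct : MulAut G →* Function.End (Bool × Bool) where
  toFun α r := cl (α (rep r))
  map_one' := funext cl_rep
  map_mul' α _ := funext fun _ => cl_aut α (cl_rep _).symm

theorem cl_aut_eq (α : MulAut G) (g : G) : cl (α g) = quotAct α (cl g) :=
  cl_aut α (cl_rep _).symm

theorem quotAct_zero (α : MulAut G) : quotAct α (false, false) = (false, false) := by
  rw [show (false, false) = cl 1 from rfl, ← cl_aut_eq, map_one]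

theorem snd_aut (α : MulAut G) {g : G} (hg : g * g = 1) : (α g).2 = (α (1, g.2)).2 := by
  have key : ∀ g : G, g * g = 1 → g = (1, g.2) ∨ g = z * (1, g.2) := by decide +kernel
  rcases key g hg with h | h
  · rw [← h]
  · rw [h, map_mul, aut_z, Prod.snd_mul, show z.2 = 1 from rfl, one_mul, Prod.snd_mul,
      show z.2 = 1 from rfl, one_mul]

/-- The action of the automorphism group on the quotient of the center by the commutator
subgroup. -/
def centAct :
    MulAut G →* Function.End (Multiplicative (ZMod 2) × Multiplicative (ZMod 2)) where
  toFun α w := (α (1, w)).2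
  map_one' := rfl
  map_mul' α β := funext fun w => by
    refine snd_aut α ?_
    have key : ∀ w : Multiplicative (ZMod 2) × Multiplicative (ZMod 2),
      ((1, w) : G) * (1, w) = 1 := by decide +kernel
    exact (aut_mul_self β (key w)).trans (map_one β)

theorem snd_aut_eq (α : MulAut G) {g : G} (hg : g * g = 1) : (α g).2 = centAct α g.2 :=
  snd_aut α hg

/-- The automorphism of order three permuting `qi`, `qj` and `qi * qj` cyclically. -/
noncomputable def rotQ : MulAut G := quatAut ⟨(qj, qi * qj), by decide +kernel⟩

/-- The automorphism of order three permuting `c₁`, `c₂` and `c₁ * c₂` cyclically. -/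
noncomputable def rotC : MulAut G := centralAut ⟨(c₂, c₁ * c₂), by decide +kernel⟩

/-- An involution inverting `rotQ` and centralizing `rotC`. -/
noncomputable def swapQ : MulAut G := quatAut ⟨(z * qj, z * qi), by decide +kernel⟩

/-- An involution inverting `rotC` and centralizing `rotQ`. -/
noncomputable def swapC : MulAut G := centralAut ⟨(c₂, c₁), by decide +kernel⟩

/-- An involution centralizing `rotQ` that acts trivially modulo the commutator subgroup. -/
noncomputable def shear : MulAut G := centralAut ⟨(z * c₁, c₂), by decide +kernel⟩

/-- Conjugation by `qj`. -/
noncomputable def innQ : MulAut G := quatAut ⟨(qi * z, qj), by decide +kernel⟩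

/-- An involution centralizing `rotQ * rotC` that acts trivially modulo the center. -/
noncomputable def mixA : MulAut G := quatAut ⟨(qi * c₁, qj * c₂), by decide +kernel⟩

/-- An involution centralizing `rotQ * rotC ^ 2` that acts trivially modulo the center. -/
noncomputable def mixB : MulAut G := quatAut ⟨(qi * c₁, qj * (c₁ * c₂)), by decide +kernel⟩

theorem rotQ_pow : rotQ ^ 3 = 1 := aut_ext' (by decide +kernel)
theorem rotC_pow : rotC ^ 3 = 1 := aut_ext' (by decide +kernel)

theorem rotQ_inv : rotQ⁻¹ = rotQ ^ 2 := inv_eq_of_mul_eq_one_right rotQ_pow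
theorem rotC_inv : rotC⁻¹ = rotC ^ 2 := inv_eq_of_mul_eq_one_right rotC_pow

theorem commute_rot : Commute rotQ rotC := aut_ext' (by decide +kernel)

/-- The Sylow `3`-subgroup generated by `rotQ` and `rotC`. -/
def rotGroup : Subgroup (MulAut G) where
  carrier := {x | ∃ a b : ℕ, x = rotQ ^ a * rotC ^ b}
  one_mem' := ⟨0, 0, by simp⟩
  mul_mem' := by
    rintro _ _ ⟨a, b, rfl⟩ ⟨a', b', rfl⟩
    refine ⟨a + a', b + b', ?_⟩
    rw [pow_add, pow_add]
    exact (commute_rot.symm.pow_pow b a').mul_mul_mul_comm _ _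
  inv_mem' := by
    rintro _ ⟨a, b, rfl⟩
    refine ⟨2 * a, 2 * b, ?_⟩
    rw [mul_inv_rev, ← inv_pow, ← inv_pow, rotQ_inv, rotC_inv, pow_mul, pow_mul]
    exact ((commute_rot.symm.pow_pow 2 2).pow_pow b a).eq

theorem mem_rotGroup {x : MulAut G} (hx : x ∈ rotGroup) :
    ∃ a b : Fin 3, x = rotQ ^ (a : ℕ) * rotC ^ (b : ℕ) := by
  obtain ⟨a, b, rfl⟩ := hx
  refine ⟨⟨a % 3, Nat.mod_lt _ (by decide)⟩, ⟨b % 3, Nat.mod_lt _ (by decide)⟩, ?_⟩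
  rw [← pow_eq_pow_mod _ rotQ_pow, ← pow_eq_pow_mod _ rotC_pow]

theorem rotQ_mem : rotQ ∈ rotGroup := ⟨1, 0, by simp⟩
theorem rotC_mem : rotC ∈ rotGroup := ⟨0, 1, by simp⟩

theorem card_rotGroup : Nat.card rotGroup = 9 := by
  let f : Fin 3 × Fin 3 → rotGroup := fun p => ⟨rotQ ^ (p.1 : ℕ) * rotC ^ (p.2 : ℕ), _, _, rfl⟩
  have hf : Function.Bijective f := by
    constructor
    · intro p q hpq
      have h1 : (f p).1 qi = (f q).1 qi := by rw [hpq]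
      have h2 : (f p).1 c₁ = (f q).1 c₁ := by rw [hpq]
      have key : ∀ p q : Fin 3 × Fin 3,
        (rotQ ^ (p.1 : ℕ) * rotC ^ (p.2 : ℕ)) qi = (rotQ ^ (q.1 : ℕ) * rotC ^ (q.2 : ℕ)) qi →
        (rotQ ^ (p.1 : ℕ) * rotC ^ (p.2 : ℕ)) c₁ = (rotQ ^ (q.1 : ℕ) * rotC ^ (q.2 : ℕ)) c₁ →
        p = q := by decide +kernel
      exact key p q h1 h2
    · rintro ⟨x, hx⟩
      obtain ⟨a, b, rfl⟩ := mem_rotGroup hx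
      exact ⟨(a, b), rfl⟩
  rw [← Nat.card_congr (Equiv.ofBijective f hf)]
  simp

theorem pow_three_of_mem {k : MulAut G} (hk : k ∈ rotGroup) : k⁻¹ = k ^ 2 := by
  obtain ⟨a, b, rfl⟩ := hk
  apply inv_eq_of_mul_eq_one_right
  rw [← pow_succ', (commute_rot.pow_pow a b).mul_pow, ← pow_mul, ← pow_mul, mul_comm a,
    mul_comm b, pow_mul, pow_mul, rotQ_pow, rotC_pow, one_pow, one_pow, one_mul]

/-- The involutions `x` centralizing `h` that commute with their conjugates by `rotGroup`. -/
structure IsInvol (h x : MulAut G) : Prop where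
  mul_self : x * x = 1
  comm : Commute x h
  conj : ∀ k ∈ rotGroup, Commute x (k * x * k⁻¹)

theorem IsInvol.of_fin {h x : MulAut G} (h1 : x * x = 1) (h2 : x * h = h * x)
    (h3 : ∀ a b : Fin 3, x * (rotQ ^ (a : ℕ) * rotC ^ (b : ℕ) * x *
      (rotQ ^ (a : ℕ) * rotC ^ (b : ℕ)) ^ 2) = rotQ ^ (a : ℕ) * rotC ^ (b : ℕ) * x *
      (rotQ ^ (a : ℕ) * rotC ^ (b : ℕ)) ^ 2 * x) : IsInvol h x := by
  refine ⟨h1, h2, fun k hk => ?_⟩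
  rw [pow_three_of_mem hk]
  obtain ⟨a, b, rfl⟩ := mem_rotGroup hk
  exact h3 a b

theorem IsInvol.map {h x : MulAut G} (hx : IsInvol h x) (φ : MulAut (MulAut G))
    (hφ : ∀ k ∈ rotGroup, φ⁻¹ k ∈ rotGroup) : IsInvol (φ h) (φ x) := by
  refine ⟨by rw [← map_mul, hx.mul_self, map_one], hx.comm.map φ, fun k hk => ?_⟩
  have := (hx.conj _ (hφ k hk)).map φ
  simpa using this

theorem IsInvol.pow {h x : MulAut G} (hx : IsInvol h x) (n : ℕ) : IsInvol (h ^ n) x :=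
  ⟨hx.mul_self, hx.comm.pow_right n, hx.conj⟩

theorem isInvol_shear : IsInvol rotQ shear := by
  refine .of_fin (aut_ext' (by decide +kernel)) (aut_ext' (by decide +kernel)) fun a b =>
    aut_ext' ?_
  revert a b; decide +kernel

theorem isInvol_innQ : IsInvol rotC innQ := by
  refine .of_fin (aut_ext' (by decide +kernel)) (aut_ext' (by decide +kernel)) fun a b =>
    aut_ext' ?_
  revert a b; decide +kernel

theorem isInvol_mixA : IsInvol (rotQ * rotC) mixA := by
  refine .of_fin (aut_ext' (by decide +kernel)) (aut_ext' (by decide +kernel)) fun a b =>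
    aut_ext' ?_
  revert a b; decide +kernel

theorem isInvol_mixB : IsInvol (rotQ * rotC ^ 2) mixB := by
  refine .of_fin (aut_ext' (by decide +kernel)) (aut_ext' (by decide +kernel)) fun a b =>
    aut_ext' ?_
  revert a b; decide +kernel

theorem IsInvol.quotAct_eq_one {h x : MulAut G} (hx : IsInvol h x) : quotAct x = 1 := by
  have key : ∀ m : Bool × Bool → Bool × Bool, m (false, false) = (false, false) →
      (∀ r, m (m r) = r) →
      (∀ r, m (quotAct rotQ (m (quotAct rotQ (quotAct rotQ r)))) =
        quotAct rotQ (m (quotAct rotQ (quotAct rotQ (m r))))) → ∀ r, m r = r := by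
    decide +kernel
  have h1 := congrArg quotAct hx.mul_self
  have h2 := congrArg quotAct (hx.conj rotQ rotQ_mem).eq
  rw [rotQ_inv] at h2
  simp only [map_mul, map_one, sq] at h1 h2
  exact funext (key _ (quotAct_zero x) (congrFun h1) (congrFun h2))

set_option synthInstance.maxSize 1000 in
theorem IsInvol.centAct_eq_one {h x : MulAut G} (hx : IsInvol h x) : centAct x = 1 := by
  have key : ∀ m : Multiplicative (ZMod 2) × Multiplicative (ZMod 2) →
        Multiplicative (ZMod 2) × Multiplicative (ZMod 2), m 1 = 1 →
      (∀ r, m (m r) = r) →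
      (∀ r, m (centAct rotC (m (centAct rotC (centAct rotC r)))) =
        centAct rotC (m (centAct rotC (centAct rotC (m r))))) → ∀ r, m r = r := by
    decide +kernel
  have h1 := congrArg centAct hx.mul_self
  have h2 := congrArg centAct (hx.conj rotC rotC_mem).eq
  rw [rotC_inv] at h2
  simp only [map_mul, map_one, sq] at h1 h2
  refine funext (key _ ?_ (congrFun h1) (congrFun h2))
  exact congrArg Prod.snd (map_one x)

theorem aut_apply_of_commute {x h : MulAut G} (hc : Commute x h) (g : G) : x (h g) = h (x g) :=
  DFunLike.congr_fun hc.eq g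

theorem cl_aut_of_quotAct {x : MulAut G} (hx : quotAct x = 1) (g : G) : cl (x g) = cl g := by
  rw [cl_aut_eq, hx]
  rfl

/-- A cyclic permutation of `qi`, `qj`, `qi * qj` restricts the image of `qi` under the
automorphisms commuting with it. -/
theorem image_qi {x h : MulAut G} (hx : quotAct x = 1) (hc : Commute x h) (hi : h qi = qj)
    (hj : h qj = qi * qj) :
    cl (x qi) = cl qi ∧ x qj = h (x qi) ∧ x qi * h (x qi) = h (h (x qi)) := by
  have h1 : x qj = h (x qi) := by rw [← hi, aut_apply_of_commute hc]
  refine ⟨cl_aut_of_quotAct hx qi, h1, ?_⟩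
  rw [← h1, ← map_mul, ← hj, aut_apply_of_commute hc]

theorem fixes_quat_of_commute_rotQ {x : MulAut G} (hx : quotAct x = 1) (hc : Commute x rotQ) :
    x qi = qi ∧ x qj = qj := by
  obtain ⟨h1, h2, h3⟩ := image_qi hx hc (by decide +kernel) (by decide +kernel)
  have key : ∀ X : G, cl X = cl qi → X * rotQ X = rotQ (rotQ X) → X = qi := by decide +kernel
  have h4 := key _ h1 h3
  refine ⟨h4, ?_⟩
  rw [h2, h4]
  decide +kernel

theorem fixes_central {x h : MulAut G} (hx : centAct x = 1) (hc : Commute x h)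
    (hh : (h c₁ = c₂ ∧ h c₂ = c₁ * c₂) ∨ (h c₁ = c₁ * c₂ ∧ h c₂ = c₁)) : x c₁ = c₁ ∧ x c₂ = c₂ := by
  have key : ∀ X : G, X * X = 1 → X.2 = c₁.2 → X = c₁ ∨ X = z * c₁ := by decide +kernel
  have h1 : x c₁ * x c₁ = 1 := by rw [aut_mul_self x (h := 1) rfl, map_one]
  have h2 : (x c₁).2 = c₁.2 := by rw [snd_aut_eq x rfl, hx]; rfl
  rcases hh with ⟨ha, hb⟩ | ⟨ha, hb⟩
  · have h3 : x c₂ = h (x c₁) := by rw [← ha, aut_apply_of_commute hc]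
    have h4 : x c₁ * h (x c₁) = h (h (x c₁)) := by
      rw [← h3, ← map_mul, ← hb, aut_apply_of_commute hc]
    rcases key _ h1 h2 with h5 | h5
    · exact ⟨h5, by rw [h3, h5, ha]⟩
    · rw [h5, map_mul, aut_z, ha, map_mul, aut_z, hb] at h4
      exact absurd h4 (by decide +kernel)
  · have h3 : h (x c₂) = x c₁ := by rw [← hb, aut_apply_of_commute hc]
    have h4 : h (x c₁) = x c₁ * x c₂ := by
      rw [← map_mul, ← ha, aut_apply_of_commute hc]
    have h6 : h (h (x c₁)) = h (x c₁) * x c₁ := by rw [h4, map_mul, h3, h4]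
    rcases key _ h1 h2 with h5 | h5
    · refine ⟨h5, h.injective ?_⟩
      rw [h3, h5, hb]
    · rw [h5, map_mul, aut_z, ha, map_mul, map_mul, aut_z, ha, hb] at h6
      exact absurd h6 (by decide +kernel)

theorem IsInvol.eq_of_rotQ {x : MulAut G} (hx : IsInvol rotQ x) :
    x = 1 ∨ x = shear ∨ x = rotC * shear * rotC ^ 2 ∨ x = rotC ^ 2 * shear * rotC := by
  obtain ⟨h1, h2⟩ := fixes_quat_of_commute_rotQ hx.quotAct_eq_one hx.comm
  have key : ∀ X : G, X * X = 1 → ∀ w, X.2 = w → X = (1, w) ∨ X = z * (1, w) := by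
    decide +kernel
  have h3 : ∀ g : G, g * g = 1 → x g = (1, g.2) ∨ x g = z * (1, g.2) := fun g hg => by
    refine key _ (by rw [aut_mul_self x hg, map_one]) _ ?_
    rw [snd_aut_eq x hg, hx.centAct_eq_one]
    rfl
  rcases h3 c₁ (by decide +kernel) with h4 | h4 <;> rcases h3 c₂ (by decide +kernel) with h5 | h5
  · exact .inl (aut_ext h1 h2 h4 h5)
  · refine .inr (.inr (.inr (aut_ext' ?_)))
    rw [h1, h2, h4, h5]
    decide +kernel
  · refine .inr (.inl (aut_ext' ?_))
    rw [h1, h2, h4, h5]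
    decide +kernel
  · refine .inr (.inr (.inl (aut_ext' ?_)))
    rw [h1, h2, h4, h5]
    decide +kernel

set_option synthInstance.maxSize 1000 in
theorem IsInvol.eq_of_rotC {x : MulAut G} (hx : IsInvol rotC x) :
    x = 1 ∨ x = innQ ∨ x = rotQ * innQ * rotQ ^ 2 ∨ x = rotQ ^ 2 * innQ * rotQ := by
  obtain ⟨h1, h2⟩ := fixes_central hx.centAct_eq_one hx.comm
    (.inl ⟨by decide +kernel, by decide +kernel⟩)
  have key : ∀ X : G, rotC X = X → (cl X = cl qi → X = qi ∨ X = qi * z) ∧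
    (cl X = cl qj → X = qj ∨ X = qj * z) := by decide +kernel
  have h3 := (key (x qi) (by rw [← aut_apply_of_commute hx.comm]; rfl)).1
    (cl_aut_of_quotAct hx.quotAct_eq_one qi)
  have h4 := (key (x qj) (by rw [← aut_apply_of_commute hx.comm]; rfl)).2
    (cl_aut_of_quotAct hx.quotAct_eq_one qj)
  rcases h3 with h3 | h3 <;> rcases h4 with h4 | h4
  · exact .inl (aut_ext h3 h4 h1 h2)
  · refine .inr (.inr (.inr (aut_ext' ?_)))
    rw [h1, h2, h3, h4]
    decide +kernel
  · refine .inr (.inl (aut_ext' ?_))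
    rw [h1, h2, h3, h4]
    decide +kernel
  · refine .inr (.inr (.inl (aut_ext' ?_)))
    rw [h1, h2, h3, h4]
    decide +kernel

set_option synthInstance.maxSize 1000 in
theorem IsInvol.eq_of_rotQ_mul_rotC {x : MulAut G} (hx : IsInvol (rotQ * rotC) x) :
    x = 1 ∨ x = mixA ∨ x = rotC * mixA * rotC ^ 2 ∨ x = rotC ^ 2 * mixA * rotC := by
  obtain ⟨h1, h2⟩ := fixes_central hx.centAct_eq_one hx.comm
    (.inl ⟨by decide +kernel, by decide +kernel⟩)
  obtain ⟨h3, h4, h5⟩ := image_qi hx.quotAct_eq_one hx.comm (by decide +kernel) (by decide +kernel)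
  have key : ∀ X : G, cl X = cl qi →
    X * (rotQ * rotC) X = (rotQ * rotC) ((rotQ * rotC) X) →
    X = qi ∨ X = qi * c₁ ∨ X = qi * c₂ ∨ X = qi * (c₁ * c₂) := by decide +kernel
  rcases key _ h3 h5 with h6 | h6 | h6 | h6
  · refine .inl (aut_ext' ?_)
    rw [h1, h2, h4, h6]
    decide +kernel
  · refine .inr (.inl (aut_ext' ?_))
    rw [h1, h2, h4, h6]
    decide +kernel
  · refine .inr (.inr (.inl (aut_ext' ?_)))
    rw [h1, h2, h4, h6]
    decide +kernel
  · refine .inr (.inr (.inr (aut_ext' ?_)))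
    rw [h1, h2, h4, h6]
    decide +kernel

set_option synthInstance.maxSize 1000 in
theorem IsInvol.eq_of_rotQ_mul_rotC_sq {x : MulAut G} (hx : IsInvol (rotQ * rotC ^ 2) x) :
    x = 1 ∨ x = mixB ∨ x = rotC * mixB * rotC ^ 2 ∨ x = rotC ^ 2 * mixB * rotC := by
  obtain ⟨h1, h2⟩ := fixes_central hx.centAct_eq_one hx.comm
    (.inr ⟨by decide +kernel, by decide +kernel⟩)
  obtain ⟨h3, h4, h5⟩ := image_qi hx.quotAct_eq_one hx.comm (by decide +kernel) (by decide +kernel)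
  have key : ∀ X : G, cl X = cl qi →
    X * (rotQ * rotC ^ 2) X = (rotQ * rotC ^ 2) ((rotQ * rotC ^ 2) X) →
    X = qi ∨ X = qi * c₁ ∨ X = qi * c₂ ∨ X = qi * (c₁ * c₂) := by decide +kernel
  rcases key _ h3 h5 with h6 | h6 | h6 | h6
  · refine .inl (aut_ext' ?_)
    rw [h1, h2, h4, h6]
    decide +kernel
  · refine .inr (.inl (aut_ext' ?_))
    rw [h1, h2, h4, h6]
    decide +kernel
  · refine .inr (.inr (.inl (aut_ext' ?_)))
    rw [h1, h2, h4, h6]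
    decide +kernel
  · refine .inr (.inr (.inr (aut_ext' ?_)))
    rw [h1, h2, h4, h6]
    decide +kernel

/-- The automorphisms fixing the center pointwise and acting trivially modulo the center are
generated by conjugates of `innQ`, `mixA` and `mixB`. -/
theorem mem_of_fixes_center {K : Subgroup (MulAut G)} (hs : rotQ ∈ K) (ht : rotC ∈ K)
    (hv : innQ ∈ K) (hA : mixA ∈ K) (hB : mixB ∈ K) {x : MulAut G} (hx : quotAct x = 1)
    (h₁ : x c₁ = c₁) (h₂ : x c₂ = c₂) : x ∈ K := by
  have hA' : rotC * mixA * rotC ^ 2 ∈ K := K.mul_mem (K.mul_mem ht hA) (K.pow_mem ht 2)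
  have hB' : rotC * mixB * rotC ^ 2 ∈ K := K.mul_mem (K.mul_mem ht hB) (K.pow_mem ht 2)
  have hv' : rotQ * innQ * rotQ ^ 2 ∈ K := K.mul_mem (K.mul_mem hs hv) (K.pow_mem hs 2)
  have key : ∀ X : G, (cl X = cl qi → ∃ p : Fin 2 × Fin 2 × Fin 2,
        X = qi * (z ^ (p.1 : ℕ) * c₁ ^ (p.2.1 : ℕ) * c₂ ^ (p.2.2 : ℕ))) ∧
      (cl X = cl qj → ∃ p : Fin 2 × Fin 2 × Fin 2,
        X = qj * (z ^ (p.1 : ℕ) * c₁ ^ (p.2.1 : ℕ) * c₂ ^ (p.2.2 : ℕ))) := by decide +kernel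
  obtain ⟨p, hp⟩ := (key _).1 (cl_aut_of_quotAct hx qi)
  obtain ⟨q, hq⟩ := (key _).2 (cl_aut_of_quotAct hx qj)
  have hcomb : x = innQ ^ (p.1 : ℕ) *
      (mixA * (rotC * mixA * rotC ^ 2) * (rotC * mixB * rotC ^ 2)) ^ (p.2.1 : ℕ) *
      ((rotC * mixB * rotC ^ 2) * mixA * mixB) ^ (p.2.2 : ℕ) *
      (innQ * (rotQ * innQ * rotQ ^ 2)) ^ (q.1 : ℕ) * (mixA * mixB) ^ (q.2.1 : ℕ) *
      ((rotC * mixA * rotC ^ 2) * (rotC * mixB * rotC ^ 2)) ^ (q.2.2 : ℕ) := by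
    apply aut_ext'
    rw [h₁, h₂, hp, hq]
    clear hp hq
    revert p q
    decide +kernel
  rw [hcomb]
  exact K.mul_mem (K.mul_mem (K.mul_mem (K.mul_mem (K.mul_mem (K.pow_mem hv _)
    (K.pow_mem (K.mul_mem (K.mul_mem hA hA') hB') _))
    (K.pow_mem (K.mul_mem (K.mul_mem hB' hA) hB) _)) (K.pow_mem (K.mul_mem hv hv') _))
    (K.pow_mem (K.mul_mem hA hB) _)) (K.pow_mem (K.mul_mem hA' hB') _)

theorem eq_one_of_commute {w : MulAut G} (hs : Commute w rotQ) (hv : Commute w innQ)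
    (hA : Commute w mixA) : w = 1 := by
  have key : ∀ X : G, X * X = z → innQ X = X → cl X = cl qj := by decide +kernel
  have hj : cl (w qj) = cl qj := by
    refine key _ (by rw [aut_mul_self w (h := z) rfl, aut_z]) ?_
    rw [← aut_apply_of_commute hv]
    exact congrArg w (by decide +kernel)
  have hi : cl (w qi) = cl qi := by
    have h1 : rotQ (w qi) = w qj := by
      rw [← aut_apply_of_commute hs]
      exact congrArg w (by decide +kernel)
    have h2 : ∀ X : G, cl (rotQ X) = cl qj → cl X = cl qi := by decide +kernel
    exact h2 _ (by rw [h1, hj])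
  have hw : quotAct w = 1 := by
    have key : ∀ r : Bool × Bool, r = cl 1 ∨ r = cl qi ∨ r = cl qj ∨ r = cl (qi * qj) := by
      decide +kernel
    have hmul : ∀ X Y : G, cl X = cl qi → cl Y = cl qj → cl (X * Y) = cl (qi * qj) := by
      decide +kernel
    funext r
    rcases key r with rfl | rfl | rfl | rfl
    · rw [← cl_aut_eq, map_one]; rfl
    · rw [← cl_aut_eq, hi]; rfl
    · rw [← cl_aut_eq, hj]; rfl
    · rw [← cl_aut_eq, map_mul]; exact hmul _ _ hi hj
  obtain ⟨h1, h2⟩ := fixes_quat_of_commute_rotQ hw hs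
  have h3 := aut_apply_of_commute hA qi
  have h4 := aut_apply_of_commute hA qj
  rw [h1, show mixA qi = qi * c₁ from quatAut_qi _, map_mul, h1] at h3
  rw [h2, show mixA qj = qj * c₂ from quatAut_qj _, map_mul, h2] at h4
  exact aut_ext h1 h2 (mul_left_cancel h3) (mul_left_cancel h4)

theorem IsInvol.eq_mixA {y : MulAut G} (hy : IsInvol (rotQ * rotC) y)
    (h₁ : shear * y * shear * y = innQ)
    (h₂ : rotC * shear * rotC ^ 2 * y * (rotC * shear * rotC ^ 2) * y =
      rotQ * innQ * rotQ ^ 2) : y = mixA := by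
  rcases hy.eq_of_rotQ_mul_rotC with rfl | h | rfl | rfl
  · exact absurd (DFunLike.congr_fun h₁ qi) (by decide +kernel)
  · exact h
  · exact absurd (DFunLike.congr_fun h₁ qi) (by decide +kernel)
  · exact absurd (DFunLike.congr_fun h₂ qi) (by decide +kernel)

theorem IsInvol.eq_mixB {y : MulAut G} (hy : IsInvol (rotQ * rotC ^ 2) y)
    (h₁ : shear * y * shear * y = rotQ * innQ * rotQ ^ 2)
    (h₂ : rotC * shear * rotC ^ 2 * y * (rotC * shear * rotC ^ 2) * y = innQ) :
    y = mixB := by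
  rcases hy.eq_of_rotQ_mul_rotC_sq with rfl | h | rfl | rfl
  · exact absurd (DFunLike.congr_fun h₂ qi) (by decide +kernel)
  · exact h
  · exact absurd (DFunLike.congr_fun h₁ qi) (by decide +kernel)
  · exact absurd (DFunLike.congr_fun h₂ qi) (by decide +kernel)

theorem map_mem_rotGroup {φ : MulAut (MulAut G)} (hs : φ rotQ ∈ rotGroup)
    (ht : φ rotC ∈ rotGroup) : ∀ k ∈ rotGroup, φ k ∈ rotGroup := by
  rintro _ ⟨a, b, rfl⟩
  rw [map_mul, map_pow, map_pow]
  exact rotGroup.mul_mem (rotGroup.pow_mem hs a) (rotGroup.pow_mem ht b)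

theorem inv_apply_eq {φ : MulAut (MulAut G)} {x : MulAut G} (h : φ x = x) : φ⁻¹ x = x := by
  rw [MulAut.inv_apply, MulEquiv.symm_apply_eq, h]

theorem quotAct_conj (a : MulAut G) {x : MulAut G} (hx : quotAct x = 1) :
    quotAct (a * x * a⁻¹) = 1 := by
  rw [map_mul, map_mul, hx, mul_one, ← map_mul, mul_inv_cancel, map_one]

theorem conj_apply_of_mul_self (a : MulAut G) {x : MulAut G} (h₁ : x c₁ = c₁) (h₂ : x c₂ = c₂)
    {g : G} (hg : g * g = 1) : (a * x * a⁻¹) g = g := by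
  have h : x (a⁻¹ g) = a⁻¹ g :=
    aut_eq_self_of_mul_self h₁ h₂ (by rw [aut_mul_self _ hg, map_one])
  rw [MulAut.mul_apply, MulAut.mul_apply, h, MulAut.apply_inv_self]

/-- Modulo the automorphisms acting trivially modulo the center, every automorphism normalizes
the subgroup generated by `rotQ`. -/
theorem exists_quotAct_mul_rotQ (a : MulAut G) :
    ∃ k : ℕ, quotAct (a * rotQ) = quotAct (rotQ ^ k * a) := by
  have key : ∀ m : Bool × Bool → Bool × Bool, m (false, false) = (false, false) →
      (∀ r s, m r = m s → r = s) →
      (∀ r, m (quotAct rotQ r) = quotAct rotQ (m r)) ∨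
      (∀ r, m (quotAct rotQ r) = quotAct rotQ (quotAct rotQ (m r))) := by
    decide +kernel
  have hinj : Function.Injective (quotAct a) := by
    refine Function.LeftInverse.injective (g := quotAct a⁻¹) fun r => ?_
    exact congrFun (show quotAct a⁻¹ * quotAct a = 1 by rw [← map_mul, inv_mul_cancel, map_one]) r
  rcases key _ (quotAct_zero a) (fun _ _ h => hinj h) with h | h
  · refine ⟨1, ?_⟩
    rw [pow_one, map_mul, map_mul]
    exact funext h
  · refine ⟨2, ?_⟩
    rw [sq, map_mul, map_mul, map_mul]
    exact funext h

theorem eq_one_of_fixes {φ : MulAut (MulAut G)} (hs : φ rotQ = rotQ) (ht : φ rotC = rotC)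
    (hn : φ shear = shear) (hv : φ innQ = innQ) : φ = 1 := by
  have hφ : ∀ k ∈ rotGroup, φ⁻¹ k ∈ rotGroup :=
    map_mem_rotGroup (by rw [inv_apply_eq hs]; exact rotQ_mem)
      (by rw [inv_apply_eq ht]; exact rotC_mem)
  have hA : φ mixA = mixA := by
    have h := isInvol_mixA.map φ hφ
    rw [map_mul, hs, ht] at h
    have r₁ := congrArg φ (show shear * mixA * shear * mixA = innQ from
      aut_ext' (by decide +kernel))
    have r₂ := congrArg φ (show rotC * shear * rotC ^ 2 * mixA * (rotC * shear * rotC ^ 2) * mixA =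
      rotQ * innQ * rotQ ^ 2 from aut_ext' (by decide +kernel))
    simp only [map_mul, map_pow, hs, ht, hn, hv] at r₁ r₂
    exact h.eq_mixA r₁ r₂
  have hB : φ mixB = mixB := by
    have h := isInvol_mixB.map φ hφ
    rw [map_mul, map_pow, hs, ht] at h
    have r₁ := congrArg φ (show shear * mixB * shear * mixB = rotQ * innQ * rotQ ^ 2 from
      aut_ext' (by decide +kernel))
    have r₂ := congrArg φ (show rotC * shear * rotC ^ 2 * mixB * (rotC * shear * rotC ^ 2) * mixB =
      innQ from aut_ext' (by decide +kernel))
    simp only [map_mul, map_pow, hs, ht, hn, hv] at r₁ r₂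
    exact h.eq_mixB r₁ r₂
  have hK : ∀ x : MulAut G, quotAct x = 1 → x c₁ = c₁ → x c₂ = c₂ → φ x = x := fun x =>
    mem_of_fixes_center (K := φ.toMonoidHom.eqLocus (MonoidHom.id _)) hs ht hv hA hB
  have hcomm : ∀ a x : MulAut G, φ x = x → φ (a * x * a⁻¹) = a * x * a⁻¹ →
      Commute (a⁻¹ * φ a) x := by
    intro a x hx h
    rw [map_mul, map_mul, map_inv, hx, mul_inv_eq_iff_eq_mul] at h
    rw [Commute, SemiconjBy, mul_assoc, h]
    group
  ext1 a
  refine (inv_mul_eq_one.1 (eq_one_of_commute (hcomm a rotQ hs ?_) (hcomm a innQ hv ?_)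
    (hcomm a mixA hA ?_))).symm
  · obtain ⟨k, hk⟩ := exists_quotAct_mul_rotQ a
    have h₁ : rotQ c₁ = c₁ := by decide +kernel
    have h₂ : rotQ c₂ = c₂ := by decide +kernel
    have hfix : ∀ g : G, g * g = 1 → (a * rotQ * a⁻¹ * (rotQ ^ k)⁻¹) g = g := by
      intro g hg
      have hp : ∀ n : ℕ, (rotQ ^ n) g = g := fun n => by
        induction n with
        | zero => rfl
        | succ n ih => rw [pow_succ, MulAut.mul_apply, aut_eq_self_of_mul_self h₁ h₂ hg, ih]
      have hq : (rotQ ^ k)⁻¹ g = g := by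
        rw [MulAut.inv_apply, MulEquiv.symm_apply_eq, hp]
      rw [MulAut.mul_apply, hq, conj_apply_of_mul_self a h₁ h₂ hg]
    have h := hK (a * rotQ * a⁻¹ * (rotQ ^ k)⁻¹) ?_ (hfix _ (by decide +kernel))
      (hfix _ (by decide +kernel))
    · rw [map_mul, map_inv, map_pow, hs] at h
      exact mul_right_cancel h
    · rw [mul_assoc, map_mul, hk, ← map_mul]
      simp
  · exact hK _ (quotAct_conj a isInvol_innQ.quotAct_eq_one)
      (conj_apply_of_mul_self a (by decide +kernel) (by decide +kernel) (by decide +kernel))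
      (conj_apply_of_mul_self a (by decide +kernel) (by decide +kernel) (by decide +kernel))
  · exact hK _ (quotAct_conj a isInvol_mixA.quotAct_eq_one)
      (conj_apply_of_mul_self a (by decide +kernel) (by decide +kernel) (by decide +kernel))
      (conj_apply_of_mul_self a (by decide +kernel) (by decide +kernel) (by decide +kernel))

/-- The inner automorphisms of the automorphism group of `Q₈ × C₂ × C₂`. -/
abbrev innerAuts : Subgroup (MulAut (MulAut G)) :=
  (MulAut.conj : MulAut G →* MulAut (MulAut G)).range

theorem mem_innerAuts_of_conj_mul {φ : MulAut (MulAut G)} (g : MulAut G)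
    (h : MulAut.conj g * φ ∈ innerAuts) : φ ∈ innerAuts :=
  (innerAuts.mul_mem_cancel_left ⟨g, rfl⟩).1 h

theorem conj_mul_apply {φ : MulAut (MulAut G)} {g x y w : MulAut G} (hx : φ x = y)
    (h : g * y = w * g) : (MulAut.conj g * φ) x = w := by
  rw [MulAut.mul_apply, hx, MulAut.conj_apply, h, mul_inv_cancel_right]

theorem mem_innerAuts_of_fixes_shear {φ : MulAut (MulAut G)} (hs : φ rotQ = rotQ)
    (ht : φ rotC = rotC) (hn : φ shear = shear) : φ ∈ innerAuts := by
  have hφ : ∀ k ∈ rotGroup, φ⁻¹ k ∈ rotGroup :=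
    map_mem_rotGroup (by rw [inv_apply_eq hs]; exact rotQ_mem)
      (by rw [inv_apply_eq ht]; exact rotC_mem)
  have h := isInvol_innQ.map φ hφ
  rw [ht] at h
  rcases h.eq_of_rotC with h | h | h | h
  · have h' := φ.injective (h.trans (map_one φ).symm)
    exact absurd (DFunLike.congr_fun h' qi) (by decide +kernel)
  · rw [eq_one_of_fixes hs ht hn h]
    exact innerAuts.one_mem
  · refine mem_innerAuts_of_conj_mul (rotQ ^ 2) ?_
    rw [eq_one_of_fixes (conj_mul_apply hs (aut_ext' (by decide +kernel)))
      (conj_mul_apply ht (aut_ext' (by decide +kernel)))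
      (conj_mul_apply hn (aut_ext' (by decide +kernel)))
      (conj_mul_apply h (aut_ext' (by decide +kernel)))]
    exact innerAuts.one_mem
  · refine mem_innerAuts_of_conj_mul rotQ ?_
    rw [eq_one_of_fixes (conj_mul_apply hs (aut_ext' (by decide +kernel)))
      (conj_mul_apply ht (aut_ext' (by decide +kernel)))
      (conj_mul_apply hn (aut_ext' (by decide +kernel)))
      (conj_mul_apply h (aut_ext' (by decide +kernel)))]
    exact innerAuts.one_mem

theorem mem_innerAuts_of_fixes_rot {φ : MulAut (MulAut G)} (hs : φ rotQ = rotQ)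
    (ht : φ rotC = rotC) : φ ∈ innerAuts := by
  have hφ : ∀ k ∈ rotGroup, φ⁻¹ k ∈ rotGroup :=
    map_mem_rotGroup (by rw [inv_apply_eq hs]; exact rotQ_mem)
      (by rw [inv_apply_eq ht]; exact rotC_mem)
  have h := isInvol_shear.map φ hφ
  rw [hs] at h
  rcases h.eq_of_rotQ with h | h | h | h
  · have h' := φ.injective (h.trans (map_one φ).symm)
    exact absurd (DFunLike.congr_fun h' c₁) (by decide +kernel)
  · exact mem_innerAuts_of_fixes_shear hs ht h
  · exact mem_innerAuts_of_conj_mul (rotC ^ 2) (mem_innerAuts_of_fixes_shear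
      (conj_mul_apply hs (aut_ext' (by decide +kernel)))
      (conj_mul_apply ht (aut_ext' (by decide +kernel)))
      (conj_mul_apply h (aut_ext' (by decide +kernel))))
  · exact mem_innerAuts_of_conj_mul rotC (mem_innerAuts_of_fixes_shear
      (conj_mul_apply hs (aut_ext' (by decide +kernel)))
      (conj_mul_apply ht (aut_ext' (by decide +kernel)))
      (conj_mul_apply h (aut_ext' (by decide +kernel))))

/-- No permutation of a four-group intertwines the rotation both with itself and with its
inverse. -/
theorem centAct_not_intertwines (x : MulAut G) (b : ℕ) (hb : b = 1 ∨ b = 2)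
    (h₁ : centAct (x * rotC ^ b) = centAct (rotC ^ b * x))
    (h₂ : centAct (x * rotC) = centAct (rotC ^ 2 * x)) : False := by
  have h : centAct (rotC ^ (2 * b)) = centAct (rotC ^ b) := by
    have h₃ : SemiconjBy (centAct x) (centAct rotC) (centAct rotC ^ 2) := by
      simpa only [SemiconjBy, map_mul, map_pow] using h₂
    have h₄ := h₃.pow_right b
    rw [SemiconjBy, ← pow_mul, ← map_pow, ← map_pow, ← map_mul, h₁, map_mul] at h₄
    have h₅ := congrArg (· * centAct x⁻¹) h₄
    simpa only [mul_assoc, ← map_mul, mul_inv_cancel, mul_one] using h₅.symm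
  rcases hb with rfl | rfl
  · exact absurd (congrFun h c₁.2) (by decide +kernel)
  · exact absurd (congrFun h c₁.2) (by decide +kernel)

set_option synthInstance.maxSize 1000 in
theorem mem_innerAuts_of_fixes_rotC {φ : MulAut (MulAut G)} (hs : φ rotQ ∈ rotGroup)
    (ht : φ rotC = rotC) : φ ∈ innerAuts := by
  obtain ⟨a, b, h⟩ := mem_rotGroup hs
  have e₁ := congrArg φ (show swapC * rotQ = rotQ * swapC from aut_ext' (by decide +kernel))
  have e₂ := congrArg φ (show swapC * rotC = rotC ^ 2 * swapC from aut_ext' (by decide +kernel))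
  simp only [map_mul, map_pow, h, ht] at e₁ e₂
  have hq : centAct rotQ = 1 := by
    have key : ∀ w : Multiplicative (ZMod 2) × Multiplicative (ZMod 2),
      (rotQ (1, w)).2 = w := by decide +kernel
    exact funext key
  have e₃ := congrArg centAct e₁
  have hb : (b : ℕ) = 0 := by
    by_contra hb
    refine centAct_not_intertwines (φ swapC) b (by omega) ?_ (congrArg centAct e₂)
    simpa only [map_mul, map_pow, hq, one_pow, one_mul] using e₃
  rw [hb, pow_zero, mul_one] at h
  fin_cases a
  · have h' := φ.injective (h.trans (map_one φ).symm)
    exact absurd (DFunLike.congr_fun h' qi) (by decide +kernel)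
  · exact mem_innerAuts_of_fixes_rot (h.trans (pow_one _)) ht
  · exact mem_innerAuts_of_conj_mul swapQ (mem_innerAuts_of_fixes_rot
      (conj_mul_apply h (aut_ext' (by decide +kernel)))
      (conj_mul_apply ht (aut_ext' (by decide +kernel))))

theorem commute_of_inner_sign {x y : MulAut G}
    (hx : ∀ g h : G, cl g = cl h → (x g = g ∧ x h = h) ∨ (x g = z * g ∧ x h = z * h))
    (hy : quotAct y = 1) : Commute x y := by
  refine MulEquiv.ext fun g => ?_
  rw [MulAut.mul_apply, MulAut.mul_apply]
  rcases hx g (y g) (cl_aut_of_quotAct hy g).symm with ⟨h₁, h₂⟩ | ⟨h₁, h₂⟩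
  · rw [h₁, h₂]
  · rw [h₁, h₂, map_mul, aut_z]

set_option synthInstance.maxSize 1000 in
theorem IsInvol.commute_of_rotC {x y h : MulAut G} (hx : IsInvol rotC x) (hy : IsInvol h y) :
    Commute x y := by
  refine commute_of_inner_sign ?_ hy.quotAct_eq_one
  rcases hx.eq_of_rotC with rfl | rfl | rfl | rfl <;> decide +kernel

theorem mem_innerAuts_of_map_rotGroup {φ : MulAut (MulAut G)}
    (hφ : ∀ k ∈ rotGroup, φ k ∈ rotGroup) : φ ∈ innerAuts := by
  have hinv : ∀ x y k : MulAut G, IsInvol (φ rotC) x → IsInvol k y → x * y = y * x := by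
    intro x y k hx hy
    have hx' := hx.map φ⁻¹ (by rwa [inv_inv])
    rw [MulAut.inv_apply_self] at hx'
    have h := (hx'.commute_of_rotC (hy.map φ⁻¹ (by rwa [inv_inv]))).map φ
    simpa only [MulAut.apply_inv_self] using h.eq
  obtain ⟨a, b, h⟩ := mem_rotGroup (hφ _ rotC_mem)
  rw [h] at hinv
  have hA : ¬ shear * mixA = mixA * shear := fun h =>
    absurd (DFunLike.congr_fun h qi) (by decide +kernel)
  have hB : ¬ shear * mixB = mixB * shear := fun h =>
    absurd (DFunLike.congr_fun h qi) (by decide +kernel)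
  have ha : (a : ℕ) = 0 := by
    by_contra ha
    fin_cases a
    · exact ha rfl
    · fin_cases b
      · exact hA (hinv _ _ _ (by simpa using isInvol_shear) isInvol_mixA)
      · exact hA (hinv _ _ _ (by simpa using isInvol_mixA) isInvol_shear).symm
      · exact hB (hinv _ _ _ (by simpa using isInvol_mixB) isInvol_shear).symm
    · fin_cases b
      · exact hA (hinv _ _ _ (by simpa using isInvol_shear.pow 2) isInvol_mixA)
      · refine hB (hinv _ _ _ ?_ isInvol_shear).symm
        convert isInvol_mixB.pow 2 using 1
        exact aut_ext' (by decide +kernel)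
      · refine hA (hinv _ _ _ ?_ isInvol_shear).symm
        convert isInvol_mixA.pow 2 using 1
        exact aut_ext' (by decide +kernel)
  rw [ha, pow_zero, one_mul] at h
  fin_cases b
  · have h' := φ.injective (h.trans (map_one φ).symm)
    exact absurd (DFunLike.congr_fun h' c₁) (by decide +kernel)
  · exact mem_innerAuts_of_fixes_rotC (hφ _ rotQ_mem) (h.trans (pow_one _))
  · refine mem_innerAuts_of_conj_mul swapC (mem_innerAuts_of_fixes_rotC ?_
      (conj_mul_apply h (aut_ext' (by decide +kernel))))
    obtain ⟨a', b', h'⟩ := mem_rotGroup (hφ _ rotQ_mem)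
    refine ⟨a', 2 * b', conj_mul_apply h' (aut_ext' ?_)⟩
    clear h'
    revert a' b'
    decide +kernel

theorem mem_innerAuts (φ : MulAut (MulAut G)) : φ ∈ innerAuts := by
  have : Fact (Nat.Prime 3) := ⟨by decide⟩
  let P : Sylow 3 (MulAut G) := Sylow.ofCard rotGroup <| by
    rw [card_rotGroup, card_aut, show 9216 = 3 ^ 2 * 1024 by norm_num,
      Nat.factorization_mul (by norm_num) (by norm_num), Nat.Prime.factorization_pow (by decide),
      Finsupp.add_apply, Nat.factorization_eq_zero_of_not_dvd (by decide : ¬ 3 ∣ 1024)]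
    simp
  obtain ⟨g, hg⟩ := MulAction.exists_smul_eq (MulAut G) (φ • P) P
  refine mem_innerAuts_of_conj_mul g (mem_innerAuts_of_map_rotGroup fun k hk => ?_)
  have h : MulAut.conj g • (φ k) ∈ g • φ • P := by
    rw [Sylow.smul_def]
    exact Subgroup.smul_mem_pointwise_smul _ _ _ (Subgroup.smul_mem_pointwise_smul _ _ _ hk)
  rw [hg] at h
  exact h

theorem center_eq_bot : Subgroup.center (MulAut G) = ⊥ := by
  refine (Subgroup.eq_bot_iff_forall _).2 fun w hw => ?_
  have h : ∀ x, Commute w x := fun x => (Subgroup.mem_center_iff.1 hw x).symm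
  exact eq_one_of_commute (h _) (h _) (h _)

end HamiltonianAut

/-- The automorphism group of `Q₈ × C₂ × C₂` is a complete group of order 9216:
it has order 9216, trivial center, and every automorphism of it is inner. -/
theorem aut_hamiltonianGroup32_complete_of_order_9216 :
    Nat.card (MulAut HamiltonianGroup32) = 9216 ∧
    Subgroup.center (MulAut HamiltonianGroup32) = ⊥ ∧
    Function.Surjective (MulAut.conj (G := MulAut HamiltonianGroup32)) :=
  ⟨HamiltonianAut.card_aut, HamiltonianAut.center_eq_bot, HamiltonianAut.mem_innerAuts⟩
end

section
/- The automorphism group of the generalized dihedral group D₄ × C₂ × C₂ of order 32 (where D₄ is the dihedral group of order 8) is isomorphic to the holomorph Hol(C₄ × C₂ × C₂). -/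
/-- The holomorph of a group `G`: the semidirect product `G ⋊ Aut G`, where
`Aut G` acts on `G` in the natural way. -/
abbrev Hol (G : Type*) [Group G] : Type _ := G ⋊[MonoidHom.id (MulAut G)] MulAut G

section GeneralizedDihedral

open SemidirectProduct

/-- The action of `ℤˣ = {1, -1}` on a commutative group by powers, so that `-1` inverts. -/
def unitsZPowAction (A : Type*) [CommGroup A] : ℤˣ →* MulAut A where
  toFun ε :=
    { toFun := fun a => a ^ (ε : ℤ)
      invFun := fun a => a ^ (ε : ℤ)
      left_inv := fun a => by simp [← zpow_mul]
      right_inv := fun a => by simp [← zpow_mul]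
      map_mul' := fun a b => mul_zpow a b ε }
  map_one' := MulEquiv.ext fun a => zpow_one a
  map_mul' ε δ := MulEquiv.ext fun a => zpow_mul' a ε δ

/-- The generalized dihedral group of a commutative group `A`. -/
abbrev GenDihedral (A : Type*) [CommGroup A] : Type _ := A ⋊[unitsZPowAction A] ℤˣ

namespace GenDihedral

variable {A : Type*} [CommGroup A]

lemma unitsZPowAction_apply (ε : ℤˣ) (a : A) : unitsZPowAction A ε a = a ^ (ε : ℤ) := rfl

lemma sq_eq_one_of_right {x : GenDihedral A} (hx : x.right ≠ 1) : x ^ 2 = 1 := by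
  have h := (Int.units_eq_one_or x.right).resolve_left hx
  ext <;> simp [sq, h, unitsZPowAction_apply]

lemma eq_inl_of_right {x : GenDihedral A} (hx : x.right = 1) : x = inl x.left := by
  ext <;> simp [hx]

/-- If `A` is generated by its elements of order greater than two, then every automorphism
of its generalized dihedral group preserves `A`. -/
lemma right_apply_inl (hA : Subgroup.closure {a : A | a ^ 2 ≠ 1} = ⊤)
    (φ : MulAut (GenDihedral A)) (a : A) : (φ (inl a)).right = 1 := by
  have h : (rightHom.comp φ.toMonoidHom).comp inl = (1 : A →* ℤˣ) := by
    refine MonoidHom.eq_of_eqOn_dense hA fun a ha => ?_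
    by_contra hne
    have hsq : φ (inl a) ^ 2 = 1 := sq_eq_one_of_right hne
    rw [← map_pow, ← map_pow, map_eq_one_iff φ φ.injective,
      map_eq_one_iff _ inl_injective] at hsq
    exact ha hsq
  exact DFunLike.congr_fun h a

lemma apply_inl (hA : Subgroup.closure {a : A | a ^ 2 ≠ 1} = ⊤)
    (φ : MulAut (GenDihedral A)) (a : A) : φ (inl a) = inl (φ (inl a)).left :=
  eq_inl_of_right (right_apply_inl hA φ a)

lemma right_apply (hA : Subgroup.closure {a : A | a ^ 2 ≠ 1} = ⊤)
    (φ : MulAut (GenDihedral A)) (x : GenDihedral A) :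
    (φ x).right = x.right := by
  have key (φ : MulAut (GenDihedral A)) (x : GenDihedral A) (hx : x.right = 1) :
      (φ x).right = 1 := by
    rw [eq_inl_of_right hx]
    exact right_apply_inl hA φ _
  rcases Int.units_eq_one_or x.right with hx | hx
  · rw [hx, key φ x hx]
  · refine ((Int.units_eq_one_or _).resolve_left fun h => ?_).trans hx.symm
    have := key φ.symm (φ x) h
    rw [φ.symm_apply_apply, hx] at this
    exact absurd this (by decide)

/-- The automorphism of the generalized dihedral group that extends `h.right` and sends the
reflection `inr (-1)` to its translate by `h.left`. -/
def ofHol (h : Hol A) : MulAut (GenDihedral A) where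
  toFun x := ⟨h.right x.left * (if x.right = 1 then 1 else h.left), x.right⟩
  invFun x := ⟨h.right.symm (x.left / (if x.right = 1 then 1 else h.left)), x.right⟩
  left_inv x := by ext <;> simp [-mul_ite, -map_div]
  right_inv x := by ext <;> simp [-mul_ite]
  map_mul' x y := by
    rcases Int.units_eq_one_or x.right with hx | hx <;>
    rcases Int.units_eq_one_or y.right with hy | hy <;>
    ext <;> simp [hx, hy, unitsZPowAction_apply, mul_assoc, mul_comm, mul_left_comm]

/-- The restriction to `A` of an automorphism of the generalized dihedral group. -/
def restrict (hA : Subgroup.closure {a : A | a ^ 2 ≠ 1} = ⊤)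
    (φ : MulAut (GenDihedral A)) : MulAut A where
  toFun a := (φ (inl a)).left
  invFun a := (φ.symm (inl a)).left
  left_inv a := by beta_reduce; rw [← apply_inl hA φ, φ.symm_apply_apply, left_inl]
  right_inv a := by beta_reduce; rw [← apply_inl hA φ.symm, φ.apply_symm_apply, left_inl]
  map_mul' a b := by simp [right_apply_inl hA]

lemma inl_restrict (hA : Subgroup.closure {a : A | a ^ 2 ≠ 1} = ⊤)
    (φ : MulAut (GenDihedral A)) (a : A) :
    inl (restrict hA φ a) = φ (inl a) :=
  (apply_inl hA φ a).symm

lemma apply_inr_neg_one (hA : Subgroup.closure {a : A | a ^ 2 ≠ 1} = ⊤)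
    (φ : MulAut (GenDihedral A)) :
    φ (inr (-1)) = inl (φ (inr (-1))).left * inr (-1) := by
  ext <;> simp [right_apply hA]

/-- If `A` is generated by its elements of order greater than two, then the automorphism group
of its generalized dihedral group is the holomorph of `A`. -/
def mulAutEquivHol (hA : Subgroup.closure {a : A | a ^ 2 ≠ 1} = ⊤) :
    MulAut (GenDihedral A) ≃* Hol A where
  toFun φ := ⟨(φ (inr (-1))).left, restrict hA φ⟩
  invFun := ofHol
  left_inv φ := by
    refine MulEquiv.ext fun x => ?_
    have hx : φ x = φ (inl x.left) * φ (inr x.right) := by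
      rw [← map_mul, inl_left_mul_inr_right]
    rw [hx, ← inl_restrict hA]
    rcases Int.units_eq_one_or x.right with h | h
    · ext <;> simp [ofHol, h]
    · rw [h, apply_inr_neg_one hA]
      ext <;> simp [ofHol, h]
  right_inv h := by
    ext <;> simp [ofHol, restrict]
  map_mul' φ ψ := by
    refine SemidirectProduct.ext ?_ (MulEquiv.ext fun a => ?_)
    · change (φ (ψ (inr (-1)))).left = _
      rw [apply_inr_neg_one hA ψ, map_mul, ← inl_restrict hA, apply_inr_neg_one hA φ]
      simp [mul_comm]
    · apply inl_injective (φ := unitsZPowAction A)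
      change _ = inl (restrict hA φ (restrict hA ψ a))
      simp only [inl_restrict, MulAut.mul_apply]

end GenDihedral

/-- The dihedral group times an elementary abelian group `B` is the generalized dihedral group
of `Cₙ × B`. -/
def dihedralProdEquiv (n : ℕ) (B : Type*) [CommGroup B] (hB : ∀ b : B, b⁻¹ = b) :
    DihedralGroup n × B ≃* GenDihedral (Multiplicative (ZMod n) × B) where
  toFun x := match x with
    | (.r i, b) => ⟨(.ofAdd i, b), 1⟩
    | (.sr i, b) => ⟨(.ofAdd (-i), b), -1⟩
  invFun x := (if x.right = 1 then .r x.left.1.toAdd else .sr (-x.left.1.toAdd), x.left.2)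
  left_inv := by rintro ⟨i | i, b⟩ <;> simp
  right_inv x := by
    rcases Int.units_eq_one_or x.right with h | h <;> ext <;> simp [h]
  map_mul' := by
    rintro ⟨i | i, b⟩ ⟨j | j, c⟩ <;> ext <;>
      simp [GenDihedral.unitsZPowAction_apply, hB, ← ofAdd_add, ← ofAdd_neg, add_comm,
        sub_eq_add_neg]

end GeneralizedDihedral

/-- `C₄ × B` is generated by its elements of order greater than two. -/
lemma closure_sq_ne_one_zmod_four_prod (B : Type*) [CommGroup B] :
    Subgroup.closure {a : Multiplicative (ZMod 4) × B | a ^ 2 ≠ 1} = ⊤ := by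
  have gen (b : B) : (Multiplicative.ofAdd (1 : ZMod 4), b) ∈
      Subgroup.closure {a : Multiplicative (ZMod 4) × B | a ^ 2 ≠ 1} :=
    Subgroup.subset_closure fun h => absurd (congrArg Prod.fst h)
      (by change ¬ Multiplicative.ofAdd (1 : ZMod 4) ^ 2 = 1; decide)
  refine eq_top_iff.2 fun ⟨i, b⟩ _ => ?_
  obtain ⟨k, hk⟩ : ∃ k : ℕ, Multiplicative.ofAdd (1 : ZMod 4) ^ k = i :=
    ⟨i.toAdd.val, by rw [← ofAdd_nsmul]; simp⟩
  have := mul_mem (mul_mem (pow_mem (gen 1) k) (gen b)) (inv_mem (gen 1))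
  simpa [hk] using this

/-- The automorphism group of the generalized dihedral group `D₄ × C₂ × C₂` of order 32
is isomorphic to the holomorph `Hol (C₄ × C₂ × C₂)`. -/
theorem aut_D4xC2xC2_iso_hol_C4xC2xC2 :
    Nonempty
      (MulAut (DihedralGroup 4 × Multiplicative (ZMod 2) × Multiplicative (ZMod 2)) ≃*
        Hol (Multiplicative (ZMod 4) × Multiplicative (ZMod 2) × Multiplicative (ZMod 2))) :=
  ⟨(MulAut.congr (dihedralProdEquiv 4 _ (by decide))).trans
    (GenDihedral.mulAutEquivHol (closure_sq_ne_one_zmod_four_prod _))⟩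
end

section
/- The automorphism group of Dic₄ × C₂ (where Dic₄ is the dicyclic/generalized quaternion group of order 16), a generalized dicyclic group of order 32, is isomorphic to the holomorph Hol(C₈ × C₂). -/
namespace Dic4xC2

open QuaternionGroup

/-- The abelian group `C₈ × C₂`. -/
abbrev A : Type := Multiplicative (ZMod 8) × Multiplicative (ZMod 2)

/-- The generalized dicyclic group `Dic₄ × C₂`. -/
abbrev G : Type := QuaternionGroup 4 × Multiplicative (ZMod 2)

/-- The embedding of `C₈ × C₂` into `Dic₄ × C₂` as a subgroup of index two. -/
def incl : A →* G where
  toFun u := (a (Multiplicative.toAdd u.1), u.2)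
  map_one' := rfl
  map_mul' _ _ := rfl

/-- The standard element of order four outside the image of `incl`. -/
def x : G := (xa 0, 1)

/-- The element of `C₈ × C₂` that is mapped to the square of `x`. -/
def y : A := (Multiplicative.ofAdd 4, 1)

theorem incl_injective : Function.Injective incl := by
  rintro ⟨i, e⟩ ⟨j, f⟩ h
  have h' := Prod.ext_iff.1 h
  exact Prod.ext (QuaternionGroup.a.inj h'.1) h'.2

theorem x_mul_incl (u : A) : x * incl u = (xa (Multiplicative.toAdd u.1), u.2) := by
  refine Prod.ext ?_ (one_mul _)
  exact congrArg xa (zero_add (Multiplicative.toAdd u.1 : ZMod (2 * 4)))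

theorem x_mul_incl_ne (u v : A) : x * incl u ≠ incl v := by
  intro h
  rw [x_mul_incl] at h
  exact QuaternionGroup.noConfusion rfl (heq_of_eq (Prod.ext_iff.1 h).1)

/-- Every element lies in one of the two cosets of the image of `incl`. -/
theorem eq_incl_or_eq_x_mul_incl (g : G) : (∃ u, g = incl u) ∨ ∃ u, g = x * incl u := by
  obtain ⟨i | i, e⟩ := g
  · exact Or.inl ⟨(Multiplicative.ofAdd i, e), rfl⟩
  · exact Or.inr ⟨(Multiplicative.ofAdd i, e), (x_mul_incl (Multiplicative.ofAdd i, e)).symm⟩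

theorem x_mul_x : x * x = incl y := by decide

theorem incl_mul_x (u : A) : incl u * x = x * incl u⁻¹ := by
  revert u; decide

theorem y_pow_two : y ^ 2 = 1 := by decide

theorem map_y (σ : MulAut A) : σ y = y := by
  have key : ∀ u : A, u ^ 4 = 1 ∨ u ^ 4 = y := by decide
  have hy : y = (Multiplicative.ofAdd 1, 1) ^ 4 := by decide
  have hne : y ≠ 1 := by decide
  have h := key (σ (Multiplicative.ofAdd 1, 1))
  rw [← map_pow, ← hy] at h
  exact h.resolve_left fun h1 => hne ((map_eq_one_iff σ σ.injective).1 h1)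

/-- Elements outside the image of `incl` square to `incl y`. -/
theorem x_mul_incl_sq (u : A) : (x * incl u) ^ 2 = incl y := by
  rw [pow_two, mul_assoc, ← mul_assoc (incl u), incl_mul_x, mul_assoc, ← map_mul,
    inv_mul_cancel, map_one, mul_one, x_mul_x]

/-- The self-map of `Dic₄ × C₂` given by `incl u ↦ incl (σ u)` and
`x * incl u ↦ x * incl (b * σ u)`, for an element `(b, σ)` of the holomorph. -/
def act (h : Hol A) : G → G
  | (a i, e) => incl (h.right (Multiplicative.ofAdd i, e))
  | (xa i, e) => x * incl (h.left * h.right (Multiplicative.ofAdd i, e))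

theorem act_incl (h : Hol A) (u : A) : act h (incl u) = incl (h.right u) := rfl

theorem act_x_mul_incl (h : Hol A) (u : A) :
    act h (x * incl u) = x * incl (h.left * h.right u) := by
  rw [x_mul_incl]; rfl

theorem act_mul (h : Hol A) (g k : G) : act h (g * k) = act h g * act h k := by
  have swap (u v : A) : incl u * (x * incl v) = x * incl (u⁻¹ * v) := by
    rw [← mul_assoc, incl_mul_x, mul_assoc, map_mul]
  have square (u v : A) : x * incl u * (x * incl v) = incl (y * (u⁻¹ * v)) := by
    rw [mul_assoc, swap, ← mul_assoc, x_mul_x, map_mul incl y]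
  obtain ⟨u, rfl⟩ | ⟨u, rfl⟩ := eq_incl_or_eq_x_mul_incl g <;>
    obtain ⟨v, rfl⟩ | ⟨v, rfl⟩ := eq_incl_or_eq_x_mul_incl k
  · simp only [← map_mul, act_incl]
  · simp only [swap, act_incl, act_x_mul_incl, map_mul h.right, map_inv, mul_left_comm]
  · simp only [mul_assoc, ← map_mul, act_incl, act_x_mul_incl]
  · simp only [square, act_incl, act_x_mul_incl, map_mul h.right, map_inv, map_y]
    congr 2
    rw [mul_inv_rev, mul_assoc, inv_mul_cancel_left]

theorem act_comp (h k : Hol A) (g : G) : act (h * k) g = act h (act k g) := by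
  obtain ⟨u, rfl⟩ | ⟨u, rfl⟩ := eq_incl_or_eq_x_mul_incl g
  · simp [act_incl]
  · simp only [act_x_mul_incl, SemidirectProduct.mul_left, SemidirectProduct.mul_right,
      MonoidHom.id_apply, MulAut.mul_apply, map_mul h.right, mul_assoc]

theorem act_one (g : G) : act 1 g = g := by
  obtain ⟨u, rfl⟩ | ⟨u, rfl⟩ := eq_incl_or_eq_x_mul_incl g
  · simp [act_incl]
  · simp [act_x_mul_incl]

/-- The action of the holomorph of `C₈ × C₂` on `Dic₄ × C₂` by automorphisms. -/
def actHom : Hol A →* MulAut G where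
  toFun h :=
    { toFun := act h
      invFun := act h⁻¹
      left_inv := fun g => by rw [← act_comp, inv_mul_cancel, act_one]
      right_inv := fun g => by rw [← act_comp, mul_inv_cancel, act_one]
      map_mul' := act_mul h }
  map_one' := MulEquiv.ext act_one
  map_mul' h k := MulEquiv.ext (act_comp h k)

theorem actHom_apply (h : Hol A) (g : G) : actHom h g = act h g := rfl

theorem actHom_injective : Function.Injective actHom := by
  intro h k hk
  have happ (g : G) : act h g = act k g := DFunLike.congr_fun hk g
  refine SemidirectProduct.ext ?_ (MulEquiv.ext fun u => incl_injective (happ (incl u)))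
  have h1 := happ (x * incl 1)
  rw [act_x_mul_incl, act_x_mul_incl, mul_right_inj, incl_injective.eq_iff] at h1
  simpa only [map_one, mul_one] using h1

/-- The image of `incl` is preserved by every automorphism. -/
theorem exists_map_incl_eq (α : MulAut G) (u : A) : ∃ v, α (incl u) = incl v := by
  have big (w : A) (hw : w ^ 4 ≠ 1) : ∃ v, α (incl w) = incl v := by
    refine (eq_incl_or_eq_x_mul_incl _).resolve_right ?_
    rintro ⟨v, hv⟩
    apply hw
    apply incl_injective
    apply α.injective
    rw [map_pow, map_pow, hv, pow_mul (x * incl v) 2 2, x_mul_incl_sq, ← map_pow, y_pow_two,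
      map_one, map_one]
  have gen : ∀ w : A, w ^ 4 ≠ 1 ∨ (w * (Multiplicative.ofAdd 1, 1)) ^ 4 ≠ 1 := by decide
  obtain hu | hu := gen u
  · exact big u hu
  · obtain ⟨v, hv⟩ := big _ hu
    obtain ⟨w, hw⟩ := big (Multiplicative.ofAdd 1, 1) (by decide)
    rw [map_mul, map_mul, hw] at hv
    exact ⟨v * w⁻¹, by rw [map_mul, map_inv, ← hv, mul_inv_cancel_right]⟩

theorem actHom_surjective : Function.Surjective actHom := by
  intro α
  choose f hf using exists_map_incl_eq α
  choose f' hf' using exists_map_incl_eq α⁻¹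
  let σ : MulAut A :=
    { toFun := f
      invFun := f'
      left_inv := fun u => incl_injective (by rw [← hf', ← hf, MulAut.inv_apply_self])
      right_inv := fun u => incl_injective (by rw [← hf, ← hf', MulAut.apply_inv_self])
      map_mul' := fun u v => incl_injective (by simp only [← hf, map_mul]) }
  obtain ⟨w, hw⟩ | ⟨b, hb⟩ := eq_incl_or_eq_x_mul_incl (α x)
  · refine absurd ?_ (x_mul_incl_ne 1 (f' w))
    rw [← hf', ← hw, MulAut.inv_apply_self, map_one, mul_one]
  · refine ⟨⟨b, σ⟩, MulEquiv.ext fun g => ?_⟩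
    rw [actHom_apply]
    obtain ⟨u, rfl⟩ | ⟨u, rfl⟩ := eq_incl_or_eq_x_mul_incl g
    · rw [hf]; rfl
    · rw [act_x_mul_incl, map_mul α, hb, hf, mul_assoc, ← map_mul]; rfl

end Dic4xC2

/-- The automorphism group of the generalized dicyclic group `Dic₄ × C₂` of order 32
is isomorphic to the holomorph `Hol (C₈ × C₂)`. -/
theorem aut_Dic4xC2_iso_hol_C8xC2 :
    Nonempty
      (MulAut (QuaternionGroup 4 × Multiplicative (ZMod 2)) ≃*
        Hol (Multiplicative (ZMod 8) × Multiplicative (ZMod 2))) :=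
  ⟨(MulEquiv.ofBijective Dic4xC2.actHom
    ⟨Dic4xC2.actHom_injective, Dic4xC2.actHom_surjective⟩).symm⟩
end

section
/- The automorphism group of the wreath product C₄ ≀ C₂ (a group of order 32, realized as the semidirect product (C₄ × C₄) ⋊ C₂ where the nontrivial element of C₂ acts by swapping the two C₄ factors) is isomorphic to D₄ × C₂ × C₂, where D₄ is the dihedral group of order 8. -/
/-- The automorphism of `G × G` swapping the two coordinates. -/
def swapAut (G : Type*) [Group G] : MulAut (G × G) := MulEquiv.prodComm

lemma swapAut_sq (G : Type*) [Group G] : swapAut G ^ 2 = 1 := by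
  rw [sq]; ext x <;> rfl

/-- The homomorphism `C₂ →* Aut (G × G)` sending the generator of `C₂` to the
automorphism interchanging the two coordinates. -/
def swapHom (G : Type*) [Group G] : Multiplicative (ZMod 2) →* MulAut (G × G) where
  toFun x := swapAut G ^ (Multiplicative.toAdd x).val
  map_one' := by
    show swapAut G ^ (0 : ZMod 2).val = 1
    simp
  map_mul' x y := by
    show swapAut G ^ (Multiplicative.toAdd x + Multiplicative.toAdd y).val = _
    rw [ZMod.val_add, ← pow_eq_pow_mod _ (swapAut_sq G), pow_add]

/-- The wreath product `C₄ ≀ C₂`, realized as `(C₄ × C₄) ⋊ C₂` with the swap action. -/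
abbrev C4WrC2 : Type :=
  (Multiplicative (ZMod 4) × Multiplicative (ZMod 4)) ⋊[swapHom (Multiplicative (ZMod 4))]
    Multiplicative (ZMod 2)

namespace C4WrC2

/-- The generator of the first factor `C₄` of the base group. -/
def baseGen : C4WrC2 := SemidirectProduct.inl (Multiplicative.ofAdd 1, 1)

/-- The generator of the top group `C₂`. -/
def topGen : C4WrC2 := SemidirectProduct.inr (Multiplicative.ofAdd 1)

instance : Fintype C4WrC2 := Fintype.ofEquiv _ SemidirectProduct.equivProd.symm

/-- Every element is a word in the two generators. -/
lemma eq_gen_mul (g : C4WrC2) :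
    ∃ (i j : Fin 4) (k : Fin 2), g = baseGen ^ (i : ℕ) * (topGen * baseGen * topGen) ^ (j : ℕ) *
      topGen ^ (k : ℕ) := by
  revert g
  decide +kernel

lemma mulAut_ext {φ ψ : MulAut C4WrC2} (hb : φ baseGen = ψ baseGen)
    (ht : φ topGen = ψ topGen) : φ = ψ := by
  ext1 g
  obtain ⟨i, j, k, rfl⟩ := eq_gen_mul g
  simp only [map_mul, map_pow, hb, ht]

/-- The automorphism of `C₄ × C₄` given by `(x, y) ↦ (x²y, xy²)`. -/
def baseTwist : MulAut (Multiplicative (ZMod 4) × Multiplicative (ZMod 4)) where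
  toFun p := (p.1 ^ 2 * p.2, p.1 * p.2 ^ 2)
  invFun p := (p.1 ^ 2 * p.2, p.1 * p.2 ^ 2)
  left_inv := by decide
  right_inv := by decide
  map_mul' := by decide +kernel

/-- The automorphism of `C₄ ≀ C₂` extending `baseTwist` and fixing the top group. -/
def twist : MulAut C4WrC2 :=
  SemidirectProduct.congr baseTwist (MulEquiv.refl _) (by decide +kernel)

/-- The automorphism of `C₄ ≀ C₂` extending `(x, y) ↦ (y⁻¹, x⁻¹)` and fixing the top group. -/
def invSwap : MulAut C4WrC2 :=
  SemidirectProduct.congr ((swapAut _).trans (MulEquiv.inv _)) (MulEquiv.refl _)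
    (by decide +kernel)

/-- A lift to `C₄ ≀ C₂` of the isomorphism of `D₄` with the inner automorphism group. -/
def dihedralLift : DihedralGroup 4 → C4WrC2
  | .r i => baseGen ^ i.val
  | .sr i => topGen * baseGen ^ i.val

/-- The automorphism attached to an element of `D₄ × C₂ × C₂`: the first factor acts by inner
automorphisms, the other two through `twist` and `invSwap`. -/
def toAut (p : DihedralGroup 4 × Multiplicative (ZMod 2) × Multiplicative (ZMod 2)) :
    MulAut C4WrC2 :=
  MulAut.conj (dihedralLift p.1) * twist ^ (Multiplicative.toAdd p.2.1).val *
    invSwap ^ (Multiplicative.toAdd p.2.2).val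

lemma toAut_mul (p q : DihedralGroup 4 × Multiplicative (ZMod 2) × Multiplicative (ZMod 2)) :
    toAut (p * q) = toAut p * toAut q := by
  have h : ∀ p q, toAut (p * q) baseGen = toAut p (toAut q baseGen) ∧
      toAut (p * q) topGen = toAut p (toAut q topGen) := by decide +kernel
  exact mulAut_ext (h p q).1 (h p q).2

lemma toAut_injective : Function.Injective toAut := by
  have h : ∀ p q, toAut p baseGen = toAut q baseGen ∧ toAut p topGen = toAut q topGen →
      p = q := by decide +kernel
  intro p q hpq
  exact h p q (by rw [hpq]; exact ⟨rfl, rfl⟩)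

/-- A pair `(g, h)` with `h² = 1` and `h` not commuting with `g²` is the image of the pair of
generators under some automorphism in the range of `toAut`. -/
lemma exists_toAut_apply_eq (g h : C4WrC2) (hh : h * h = 1) (hg : h * (g * g) ≠ g * g * h) :
    ∃ p, toAut p baseGen = g ∧ toAut p topGen = h := by
  revert g h
  decide +kernel

lemma toAut_surjective : Function.Surjective toAut := by
  intro φ
  have ht : topGen * topGen = 1 := by decide
  have hb : topGen * (baseGen * baseGen) ≠ baseGen * baseGen * topGen := by decide
  obtain ⟨p, hpb, hpt⟩ := exists_toAut_apply_eq (φ baseGen) (φ topGen)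
    (by rw [← map_mul, ht, map_one])
    (by simpa only [← map_mul] using φ.injective.ne hb)
  exact ⟨p, mulAut_ext hpb hpt⟩

end C4WrC2

/-- The automorphism group of the wreath product `C₄ ≀ C₂` is isomorphic to
`D₄ × C₂ × C₂`. -/
theorem aut_C4WrC2_iso_D4xC2xC2 :
    Nonempty
      (MulAut C4WrC2 ≃*
        DihedralGroup 4 × Multiplicative (ZMod 2) × Multiplicative (ZMod 2)) := by
  exact ⟨(MulEquiv.ofBijective (MonoidHom.mk' C4WrC2.toAut C4WrC2.toAut_mul)
    ⟨C4WrC2.toAut_injective, C4WrC2.toAut_surjective⟩).symm⟩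
end

section
/- The automorphism group of the holomorph Hol(C₈) (a group of order 32) is isomorphic to D₄ × D₄, the direct product of two copies of the dihedral group of order 8. -/
/-- The homomorphism from the dihedral group of order `2 * n` determined by elements `x` and `y`
with `x ^ n = 1`, `y ^ 2 = 1` and `y * x = x⁻¹ * y`. -/
def DihedralGroup.liftHom {n : ℕ} [NeZero n] {H : Type*} [Group H] (x y : H) (hx : x ^ n = 1)
    (hy : y * y = 1) (hxy : y * x = x⁻¹ * y) : DihedralGroup n →* H where
  toFun
    | .r i => x ^ i.val
    | .sr i => y * x ^ i.val
  map_one' := by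
    change x ^ (0 : ZMod n).val = 1
    simp
  map_mul' := by
    have add (i j : ZMod n) : x ^ (i + j).val = x ^ i.val * x ^ j.val := by
      rw [ZMod.val_add, ← pow_add, ← pow_eq_pow_mod _ hx]
    have sub (i j : ZMod n) : x ^ (j - i).val = (x ^ i.val)⁻¹ * x ^ j.val := by
      rw [eq_inv_mul_iff_mul_eq, ← add, add_sub_cancel]
    have conj (k : ℕ) : x ^ k * y = y * (x ^ k)⁻¹ := by
      have : SemiconjBy y x x⁻¹ := hxy
      have := (this.pow_right k).inv_right
      simpa using this.eq.symm
    rintro (i | i) (j | j)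
    · exact add i j
    · change y * x ^ (j - i).val = x ^ i.val * (y * x ^ j.val)
      rw [sub, ← mul_assoc, ← mul_assoc, conj]
    · change y * x ^ (i + j).val = y * x ^ i.val * x ^ j.val
      rw [add, mul_assoc]
    · change x ^ (j - i).val = y * x ^ i.val * (y * x ^ j.val)
      rw [sub, mul_assoc, ← mul_assoc (x ^ i.val), conj, ← mul_assoc, ← mul_assoc, hy, one_mul]

/-- The action of the units of `ZMod 8` on the cyclic group of order 8. -/
def unitsAction : (ZMod 8)ˣ →* MulAut (Multiplicative (ZMod 8)) where
  toFun u :=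
    { toFun := fun a => .ofAdd (u * a.toAdd)
      invFun := fun a => .ofAdd (↑u⁻¹ * a.toAdd)
      left_inv := fun a => by simp
      right_inv := fun a => by simp
      map_mul' := fun a b => by simp [mul_add] }
  map_one' := by ext; simp
  map_mul' u v := by ext; simp [mul_assoc]

@[simp]
lemma unitsAction_apply (u : (ZMod 8)ˣ) (a : Multiplicative (ZMod 8)) :
    unitsAction u a = .ofAdd (u * a.toAdd) := rfl

lemma mulAut_apply_eq (σ : MulAut (Multiplicative (ZMod 8))) (a : ZMod 8) :
    σ (.ofAdd a) = .ofAdd ((σ (.ofAdd 1)).toAdd * a) := by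
  have h : Multiplicative.ofAdd a = .ofAdd 1 ^ a.val := by
    rw [← ofAdd_nsmul]; simp
  rw [h, map_pow, mul_comm]
  apply Multiplicative.toAdd.injective
  simp

lemma unitsAction_bijective : Function.Bijective unitsAction := by
  refine ⟨fun u v h => ?_, fun σ => ?_⟩
  · have := DFunLike.congr_fun h (.ofAdd 1)
    ext
    simpa using this
  · have inv_mul (τ : MulAut (Multiplicative (ZMod 8))) :
        (τ (.ofAdd 1)).toAdd * (τ⁻¹ (.ofAdd 1)).toAdd = 1 := by
      apply Multiplicative.ofAdd.injective
      rw [← mulAut_apply_eq, ofAdd_toAdd, MulAut.apply_inv_self]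
    refine ⟨⟨_, _, inv_mul σ, by simpa using inv_mul σ⁻¹⟩, ?_⟩
    ext a
    exact (mulAut_apply_eq σ a.toAdd).symm

/-- The group of affine permutations `x ↦ u * x + b` of `ZMod 8`. -/
abbrev Affine8 : Type := Multiplicative (ZMod 8) ⋊[unitsAction] (ZMod 8)ˣ

/-- The holomorph of the cyclic group of order 8 is the affine group of `ZMod 8`. -/
noncomputable def affineEquivHol : Affine8 ≃* Hol (Multiplicative (ZMod 8)) :=
  SemidirectProduct.congr (MulEquiv.refl _) (MulEquiv.ofBijective _ unitsAction_bijective)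
    (fun _ => rfl)

namespace Affine8

instance : Fintype Affine8 := Fintype.ofEquiv _ SemidirectProduct.equivProd.symm

/-- The permutation `x ↦ u * x + b`. -/
def mk (b : ZMod 8) (u : (ZMod 8)ˣ) : Affine8 := ⟨.ofAdd b, u⟩

/-- The unit `5` of `ZMod 8`. -/
def five : (ZMod 8)ˣ := ⟨5, 5, by decide, by decide⟩

/-- The translation `x ↦ x + 1`. -/
def t : Affine8 := mk 1 1

/-- The reflection `x ↦ -x`. -/
def r : Affine8 := mk 0 (-1)

/-- The homothety `x ↦ 5 * x`. -/
def s : Affine8 := mk 0 five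

/-- The automorphism fixing `t` and `s` and sending `r` to `t ^ 2 * r`. -/
def rotation : MulAut Affine8 :=
  let c (u : (ZMod 8)ˣ) : ZMod 8 := if u = 1 ∨ u = five then 0 else 2
  { toFun := fun g => mk (g.left.toAdd + c g.right) g.right
    invFun := fun g => mk (g.left.toAdd - c g.right) g.right
    left_inv := by decide +kernel
    right_inv := by decide +kernel
    map_mul' := by decide +kernel }

/-- The automorphism sending `t` to `t ^ 3`, `r` to `r` and `s` to `t ^ 4 * s`. -/
def reflection : MulAut Affine8 :=
  let f (g : Affine8) : Affine8 :=
    mk (3 * g.left.toAdd + if g.right = 1 ∨ g.right = -1 then 0 else 4) g.right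
  { toFun := f
    invFun := f
    left_inv := by decide +kernel
    right_inv := by decide +kernel
    map_mul' := by decide +kernel }

/-- The automorphism sending `t` to `t ^ 3 * s`, `r` to `t ^ 2 * r * s` and `s` to `s`. -/
def rotation' : MulAut Affine8 :=
  let p (b : ZMod 8) : ℕ := b.val % 2
  let q (u : (ZMod 8)ˣ) : ℕ := if u = 1 ∨ u = five then 0 else 1
  let f (g : Affine8) : Affine8 :=
    mk (g.left.toAdd + 2 * (p g.left.toAdd + q g.right : ℕ))
      (g.right * five ^ (p g.left.toAdd + q g.right))
  { toFun := f
    invFun := fun g => f (f (f g))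
    left_inv := by decide +kernel
    right_inv := by decide +kernel
    map_mul' := by decide +kernel }

/-- The automorphism fixing `t` and `r` and sending `s` to `t ^ 4 * s`. -/
def reflection' : MulAut Affine8 :=
  let f (g : Affine8) : Affine8 :=
    mk (g.left.toAdd + if g.right = 1 ∨ g.right = -1 then 0 else 4) g.right
  { toFun := f
    invFun := f
    left_inv := by decide +kernel
    right_inv := by decide +kernel
    map_mul' := by decide +kernel }

/-- The dihedral group of automorphisms generated by `rotation` and `reflection`. -/
def dihedralHom : DihedralGroup 4 →* MulAut Affine8 :=
  DihedralGroup.liftHom rotation reflection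
    (MulEquiv.ext (by decide +kernel)) (MulEquiv.ext (by decide +kernel))
    (MulEquiv.ext (by decide +kernel))

/-- The dihedral group of automorphisms generated by `rotation'` and `reflection'`. -/
def dihedralHom' : DihedralGroup 4 →* MulAut Affine8 :=
  DihedralGroup.liftHom rotation' reflection'
    (MulEquiv.ext (by decide +kernel)) (MulEquiv.ext (by decide +kernel))
    (MulEquiv.ext (by decide +kernel))

lemma commute_dihedralHom (d d' : DihedralGroup 4) :
    Commute (dihedralHom d) (dihedralHom' d') := by
  have h : ∀ (d d' : DihedralGroup 4) (g : Affine8),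
      dihedralHom d (dihedralHom' d' g) = dihedralHom' d' (dihedralHom d g) := by
    decide +kernel
  exact MulEquiv.ext (h d d')

/-- The action of `D₄ × D₄` on the affine group of `ZMod 8` by automorphisms. -/
def prodHom : DihedralGroup 4 × DihedralGroup 4 →* MulAut Affine8 :=
  dihedralHom.noncommCoprod dihedralHom' commute_dihedralHom

lemma mulAut_ext {f g : MulAut Affine8} (ht : f t = g t) (hr : f r = g r) (hs : f s = g s) :
    f = g := by
  have h : ∀ x : Affine8, ∃ (i : Fin 8) (j k : Fin 2),
      x = t ^ (i : ℕ) * r ^ (j : ℕ) * s ^ (k : ℕ) := by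
    decide +kernel
  ext1 x
  obtain ⟨i, j, k, rfl⟩ := h x
  simp [ht, hr, hs]

lemma prodHom_injective : Function.Injective prodHom := by
  have h : ∀ d, prodHom d t = t → prodHom d r = r → prodHom d s = s → d = 1 := by
    decide +kernel
  refine (injective_iff_map_eq_one _).2 fun d hd => h d ?_ ?_ ?_ <;> simp [hd]

set_option synthInstance.maxSize 1000 in
/-- Elements satisfying the defining relations of `t`, `r` and `s` are the images of these under
some automorphism in the range of `prodHom`. -/
lemma exists_prodHom_apply_eq : ∀ T : Affine8, T ^ 4 ≠ 1 →
    ∀ R, R * T = T⁻¹ * R → R * R = 1 →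
    ∀ S, S * T = T ^ 5 * S → S * S = 1 → S * R = R * S →
    ∃ d, prodHom d t = T ∧ prodHom d r = R ∧ prodHom d s = S := by
  decide +kernel

lemma prodHom_surjective : Function.Surjective prodHom := by
  intro f
  obtain ⟨d, ht, hr, hs⟩ := exists_prodHom_apply_eq (f t)
    (by rw [← map_pow, ne_eq, EmbeddingLike.map_eq_one_iff]; decide +kernel)
    (f r) (by rw [← map_inv, ← map_mul, ← map_mul]; congr 1)
    (by rw [← map_mul, EmbeddingLike.map_eq_one_iff]; decide +kernel)
    (f s) (by rw [← map_pow, ← map_mul, ← map_mul]; congr 1)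
    (by rw [← map_mul, EmbeddingLike.map_eq_one_iff]; decide +kernel)
    (by rw [← map_mul, ← map_mul]; congr 1)
  exact ⟨d, mulAut_ext ht hr hs⟩

end Affine8

/-- The automorphism group of the holomorph `Hol (C₈)` (a group of order 32) is
isomorphic to `D₄ × D₄`. -/
theorem aut_holC8_iso_D4xD4 :
    Nonempty (MulAut (Hol (Multiplicative (ZMod 8))) ≃* DihedralGroup 4 × DihedralGroup 4) := by
  exact ⟨(MulAut.congr affineEquivHol.symm).trans
    (MulEquiv.ofBijective Affine8.prodHom
      ⟨Affine8.prodHom_injective, Affine8.prodHom_surjective⟩).symm⟩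
end

section
/- The automorphism group of the generalized quaternion (dicyclic) group of order 32 is isomorphic to the holomorph Hol(C₁₆). -/
namespace QuaternionGroup

variable {n : ℕ}

theorem zmod_natCast_add_self (n : ℕ) : (n : ZMod (2 * n)) + n = 0 := by
  rw [← Nat.cast_add, ← two_mul, ZMod.natCast_self]

/-- An automorphism of `ZMod (2 * n)` fixes `n`, the unique element of order two. -/
theorem addEquiv_zmod_natCast [NeZero n] (f : ZMod (2 * n) ≃+ ZMod (2 * n)) :
    f n = n := by
  have hn : (n : ZMod (2 * n)) ≠ 0 := by
    rw [Ne, ZMod.natCast_eq_zero_iff]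
    intro h
    have := Nat.le_of_dvd (NeZero.pos n) h
    have := NeZero.pos n
    omega
  have hf : f n + f n = 0 := by rw [← map_add, zmod_natCast_add_self, map_zero]
  rcases (ZMod.neg_eq_self_iff (f n)).1 (neg_eq_of_add_eq_zero_left hf) with h | h
  · exact absurd ((map_eq_zero_iff f f.injective).1 h) hn
  · rw [← ZMod.natCast_zmod_val (f n), Nat.eq_of_mul_eq_mul_left two_pos h]

/-- The automorphism `a i ↦ a (f i)`, `xa i ↦ xa (t + f i)` of `QuaternionGroup n`. -/
def affineAut [NeZero n] (t : ZMod (2 * n)) (f : ZMod (2 * n) ≃+ ZMod (2 * n)) :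
    MulAut (QuaternionGroup n) where
  toFun
    | a i => a (f i)
    | xa i => xa (t + f i)
  invFun
    | a i => a (f.symm i)
    | xa i => xa (f.symm (i - t))
  left_inv := by rintro (i | i) <;> simp
  right_inv := by rintro (i | i) <;> simp
  map_mul' := by
    rintro (i | i) (j | j) <;> simp [addEquiv_zmod_natCast] <;> abel

/-- For `n ≥ 3` the cyclic subgroup `⟨a⟩` of `QuaternionGroup n` is characteristic. -/
theorem exists_mulAut_apply_a (hn : 3 ≤ n) (φ : MulAut (QuaternionGroup n))
    (i : ZMod (2 * n)) : ∃ j, φ (a i) = a j := by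
  have : NeZero n := ⟨by omega⟩
  obtain ⟨k, hk⟩ : ∃ k, φ (a 1) = a k := by
    rcases h : φ (a 1) with k | k
    · exact ⟨k, rfl⟩
    · have h' := orderOf_xa k
      rw [← h, MulEquiv.orderOf_eq, orderOf_a_one] at h'
      omega
  refine ⟨(i.val : ZMod (2 * n)) * k, ?_⟩
  have hpow (m : ℕ) : (a k : QuaternionGroup n) ^ m = a ((m : ZMod (2 * n)) * k) := by
    induction m with
    | zero => simp
    | succ m ih => rw [pow_succ, ih, a_mul_a, Nat.cast_succ, add_one_mul]
  rw [← hpow, ← hk, ← map_pow, a_one_pow, ZMod.natCast_zmod_val]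

theorem exists_eq_affineAut [NeZero n] (hn : 3 ≤ n) (φ : MulAut (QuaternionGroup n)) :
    ∃ t f, affineAut t f = φ := by
  choose g hg using exists_mulAut_apply_a hn φ
  choose g' hg' using exists_mulAut_apply_a hn φ⁻¹
  obtain ⟨t, ht⟩ : ∃ t, φ (xa 0) = xa t := by
    rcases h : φ (xa 0) with k | k
    · have h' := hg' k
      rw [← h, MulAut.inv_apply_self] at h'
      cases h'
    · exact ⟨k, rfl⟩
  let f : ZMod (2 * n) ≃+ ZMod (2 * n) :=
    { toFun := g
      invFun := g'
      left_inv := fun i => a.inj (by rw [← hg', ← hg, MulAut.inv_apply_self])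
      right_inv := fun i => a.inj (by rw [← hg, ← hg', MulAut.apply_inv_self])
      map_add' := fun i j => a.inj (by rw [← hg, ← a_mul_a, map_mul, hg, hg, a_mul_a]) }
  refine ⟨t, f, MulEquiv.ext ?_⟩
  rintro (i | i)
  · exact (hg i).symm
  · have hi : (xa i : QuaternionGroup n) = xa 0 * a i := by simp
    rw [hi, map_mul φ, ht, hg, ← hi]
    rfl

/-- The homomorphism from the holomorph of the cyclic group of order `2 * n` to the
automorphism group of `QuaternionGroup n` given by the affine automorphisms. -/
def holToMulAut (n : ℕ) [NeZero n] :
    Hol (Multiplicative (ZMod (2 * n))) →* MulAut (QuaternionGroup n) where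
  toFun x := affineAut x.left.toAdd (AddEquiv.toMultiplicative.symm x.right)
  map_one' := by
    ext (i | i)
    · rfl
    · exact congrArg xa (zero_add i)
  map_mul' x y := by
    ext (i | i)
    · rfl
    · refine congrArg xa (Eq.trans (add_assoc _ _ _) (congrArg _ ?_))
      exact (map_add (AddEquiv.toMultiplicative.symm x.right) _ _).symm

theorem holToMulAut_bijective [NeZero n] (hn : 3 ≤ n) :
    Function.Bijective (holToMulAut n) := by
  refine ⟨(injective_iff_map_eq_one _).2 fun x hx => ?_, fun φ => ?_⟩
  · have hr (i : ZMod (2 * n)) : AddEquiv.toMultiplicative.symm x.right i = i :=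
      a.inj (DFunLike.congr_fun hx (a i))
    have hl : x.left.toAdd + AddEquiv.toMultiplicative.symm x.right 0 = 0 :=
      xa.inj (DFunLike.congr_fun hx (xa 0))
    rw [map_zero, add_zero] at hl
    exact SemidirectProduct.ext hl (MulEquiv.ext hr)
  · obtain ⟨t, f, rfl⟩ := exists_eq_affineAut hn φ
    exact ⟨⟨Multiplicative.ofAdd t, AddEquiv.toMultiplicative f⟩, rfl⟩

/-- For `n ≥ 3`, the automorphism group of `QuaternionGroup n` is the holomorph of the cyclic
group of order `2 * n`. -/
noncomputable def mulAutEquivHol [NeZero n] (hn : 3 ≤ n) :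
    MulAut (QuaternionGroup n) ≃* Hol (Multiplicative (ZMod (2 * n))) :=
  (MulEquiv.ofBijective (holToMulAut n) (holToMulAut_bijective hn)).symm

end QuaternionGroup

/-- The automorphism group of the generalized quaternion (dicyclic) group of order 32
is isomorphic to the holomorph `Hol (C₁₆)`. -/
theorem aut_Q32_iso_hol_C16 :
    Nonempty (MulAut (QuaternionGroup 8) ≃* Hol (Multiplicative (ZMod 16))) :=
  ⟨QuaternionGroup.mulAutEquivHol (n := 8) (by norm_num)⟩
end

section
/- The automorphism group of the automorphism group of the abelian group C₄ × C₂ × C₂ × C₂ also has order 21504, and it has trivial center. -/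
/-- The abelian group `C₄ × C₂ × C₂ × C₂` of order 32. -/
abbrev C4xC2xC2xC2 : Type :=
  Multiplicative (ZMod 4) × Multiplicative (ZMod 2) × Multiplicative (ZMod 2) ×
    Multiplicative (ZMod 2)

open Matrix
open scoped commutatorElement

/-- The group of block matrices `!![1, row, corner; 0, block, col; 0, 0, 1]` over `ZMod 2`, with
diagonal blocks of sizes 1, 3 and 1. -/
@[ext]
structure BlockGroup where
  corner : ZMod 2
  col : Fin 3 → ZMod 2
  row : Fin 3 → ZMod 2
  block : GL (Fin 3) (ZMod 2)

namespace BlockGroup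

instance : Mul BlockGroup where
  mul x y :=
    ⟨x.corner + y.corner + x.row ⬝ᵥ y.col, x.col + x.block.1 *ᵥ y.col,
      y.row + x.row ᵥ* y.block.1, x.block * y.block⟩

instance : One BlockGroup := ⟨⟨0, 0, 0, 1⟩⟩

instance : Inv BlockGroup where
  inv x :=
    ⟨-x.corner + x.row ⬝ᵥ ((x.block⁻¹).1 *ᵥ x.col), -((x.block⁻¹).1 *ᵥ x.col),
      -(x.row ᵥ* (x.block⁻¹).1), x.block⁻¹⟩

@[simp] lemma mul_corner (x y : BlockGroup) :
    (x * y).corner = x.corner + y.corner + x.row ⬝ᵥ y.col := rfl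

@[simp] lemma mul_col (x y : BlockGroup) :
    (x * y).col = x.col + x.block.1 *ᵥ y.col := rfl

@[simp] lemma mul_row (x y : BlockGroup) :
    (x * y).row = y.row + x.row ᵥ* y.block.1 := rfl

@[simp] lemma mul_block (x y : BlockGroup) : (x * y).block = x.block * y.block := rfl

@[simp] lemma one_corner : (1 : BlockGroup).corner = 0 := rfl

@[simp] lemma one_col : (1 : BlockGroup).col = 0 := rfl

@[simp] lemma one_row : (1 : BlockGroup).row = 0 := rfl

@[simp] lemma one_block : (1 : BlockGroup).block = 1 := rfl

instance : Group BlockGroup :=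
  Group.ofLeftAxioms
    (fun x y z => by
      ext1
      · simp [dotProduct_add, add_dotProduct, dotProduct_mulVec]; ring
      · simp [mulVec_add, add_assoc]
      · simp [add_vecMul, add_assoc]
      · simp [mul_assoc])
    (fun x => by ext1 <;> simp)
    (fun x => by
      ext1
      · change -x.corner + _ + x.corner + -(x.row ᵥ* (x.block⁻¹).1) ⬝ᵥ x.col = 0
        rw [neg_dotProduct, dotProduct_mulVec]; ring
      · exact neg_add_cancel _
      · change x.row + -(x.row ᵥ* (x.block⁻¹).1) ᵥ* x.block.1 = 0
        rw [neg_vecMul, vecMul_vecMul, ← Units.val_mul]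
        simp
      · exact inv_mul_cancel _)

lemma card_eq : Nat.card BlockGroup = 21504 := by
  let e : BlockGroup ≃ ZMod 2 × (Fin 3 → ZMod 2) × (Fin 3 → ZMod 2) × GL (Fin 3) (ZMod 2) :=
    ⟨fun x => (x.1, x.2, x.3, x.4), fun p => ⟨p.1, p.2.1, p.2.2.1, p.2.2.2⟩, fun _ => rfl,
      fun _ => rfl⟩
  rw [Nat.card_congr e, Nat.card_prod, Nat.card_prod, Nat.card_prod, card_GL_field]
  simp [Fin.prod_univ_three]

/-- Reflection of a matrix in its antidiagonal, an involutive antiautomorphism. -/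
def reflect (x : BlockGroup) : BlockGroup :=
  ⟨x.corner, x.row, x.col, ⟨x.block.1ᵀ, (x.block⁻¹).1ᵀ, by
    rw [← transpose_mul, ← Units.val_mul, inv_mul_cancel, Units.val_one, transpose_one], by
    rw [← transpose_mul, ← Units.val_mul, mul_inv_cancel, Units.val_one, transpose_one]⟩⟩

lemma reflect_reflect (x : BlockGroup) : reflect (reflect x) = x := rfl

lemma reflect_mul (x y : BlockGroup) : reflect (x * y) = reflect y * reflect x := by
  ext1
  · simp [reflect, dotProduct_comm, add_comm]
  · simp [reflect, mulVec_transpose]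
  · simp [reflect, vecMul_transpose]
  · exact Units.ext (transpose_mul _ _)

lemma reflect_one : reflect 1 = 1 := by
  simpa [reflect_mul] using reflect_mul 1 1

lemma reflect_inv (x : BlockGroup) : reflect x⁻¹ = (reflect x)⁻¹ := by
  rw [eq_inv_iff_mul_eq_one, ← reflect_mul, mul_inv_cancel, reflect_one]

/-- The inverse transpose automorphism, with transposes taken along the antidiagonal. -/
def dual : MulAut BlockGroup where
  toFun x := (reflect x)⁻¹
  invFun x := (reflect x)⁻¹
  left_inv x := by simp [reflect_inv, reflect_reflect]
  right_inv x := by simp [reflect_inv, reflect_reflect]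
  map_mul' x y := by simp [reflect_mul]

lemma dual_apply (x : BlockGroup) : dual x = (reflect x)⁻¹ := rfl

/-- The subgroup of matrices that differ from `1` only in the last column. -/
def colGroup : Subgroup BlockGroup where
  carrier := {x | x.row = 0 ∧ x.block = 1}
  one_mem' := by simp
  mul_mem' := by rintro x y ⟨h₁, h₂⟩ ⟨h₃, h₄⟩; simp [h₁, h₂, h₃, h₄]
  inv_mem' := by
    rintro x ⟨h₁, h₂⟩
    exact ⟨by change -(x.row ᵥ* _) = 0; simp [h₁], by change x.block⁻¹ = 1; simp [h₂]⟩

/-- The subgroup of matrices that differ from `1` only in the first row. -/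
def rowGroup : Subgroup BlockGroup where
  carrier := {x | x.col = 0 ∧ x.block = 1}
  one_mem' := by simp
  mul_mem' := by rintro x y ⟨h₁, h₂⟩ ⟨h₃, h₄⟩; simp [h₁, h₂, h₃, h₄]
  inv_mem' := by
    rintro x ⟨h₁, h₂⟩
    exact ⟨by change -(_ *ᵥ x.col) = 0; simp [h₁], by change x.block⁻¹ = 1; simp [h₂]⟩

lemma mem_colGroup {x : BlockGroup} : x ∈ colGroup ↔ x.row = 0 ∧ x.block = 1 := Iff.rfl

lemma mem_rowGroup {x : BlockGroup} : x ∈ rowGroup ↔ x.col = 0 ∧ x.block = 1 := Iff.rfl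

/-- The element of `colGroup` with the given last column. -/
def ofCol (t : ZMod 2) (v : Fin 3 → ZMod 2) : BlockGroup := ⟨t, v, 0, 1⟩

/-- The element of `rowGroup` with the given first row. -/
def ofRow (t : ZMod 2) (f : Fin 3 → ZMod 2) : BlockGroup := ⟨t, 0, f, 1⟩

/-- The block diagonal matrices. -/
def ofBlock : GL (Fin 3) (ZMod 2) →* BlockGroup where
  toFun h := ⟨0, 0, 0, h⟩
  map_one' := rfl
  map_mul' g h := by ext1 <;> simp

@[simp] lemma ofCol_corner (t v) : (ofCol t v).corner = t := rfl
@[simp] lemma ofCol_col (t v) : (ofCol t v).col = v := rfl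
@[simp] lemma ofCol_row (t v) : (ofCol t v).row = 0 := rfl
@[simp] lemma ofCol_block (t v) : (ofCol t v).block = 1 := rfl
@[simp] lemma ofRow_corner (t f) : (ofRow t f).corner = t := rfl
@[simp] lemma ofRow_col (t f) : (ofRow t f).col = 0 := rfl
@[simp] lemma ofRow_row (t f) : (ofRow t f).row = f := rfl
@[simp] lemma ofRow_block (t f) : (ofRow t f).block = 1 := rfl
@[simp] lemma ofBlock_corner (h) : (ofBlock h).corner = 0 := rfl
@[simp] lemma ofBlock_col (h) : (ofBlock h).col = 0 := rfl
@[simp] lemma ofBlock_row (h) : (ofBlock h).row = 0 := rfl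
@[simp] lemma ofBlock_block (h) : (ofBlock h).block = h := rfl

lemma ofCol_mem (t v) : ofCol t v ∈ colGroup := ⟨rfl, rfl⟩

lemma ofRow_mem (t f) : ofRow t f ∈ rowGroup := ⟨rfl, rfl⟩

lemma eq_ofCol {x : BlockGroup} (hx : x ∈ colGroup) : x = ofCol x.corner x.col := by
  ext1 <;> simp [hx.1, hx.2]

lemma eq_ofRow {x : BlockGroup} (hx : x ∈ rowGroup) : x = ofRow x.corner x.row := by
  ext1 <;> simp [hx.1, hx.2]

lemma ofCol_mul_ofCol (s t v w) : ofCol s v * ofCol t w = ofCol (s + t) (v + w) := by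
  ext1 <;> simp

lemma ofRow_mul_ofRow (s t f g) : ofRow s f * ofRow t g = ofRow (s + t) (f + g) := by
  ext1 <;> simp [add_comm]

lemma ofCol_zero_zero : ofCol 0 0 = 1 := rfl

lemma inv_ofCol (t v) : (ofCol t v)⁻¹ = ofCol t v := by
  rw [inv_eq_iff_mul_eq_one, ofCol_mul_ofCol, ZModModule.add_self, ZModModule.add_self,
    ofCol_zero_zero]

lemma mul_ofCol (x : BlockGroup) (t v) :
    x * ofCol t v = ofCol (t + x.row ⬝ᵥ v) (x.block.1 *ᵥ v) * x := by
  ext1 <;> simp [add_comm, add_left_comm, add_assoc]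

lemma conj_ofCol (x : BlockGroup) (t v) :
    x * ofCol t v * x⁻¹ = ofCol (t + x.row ⬝ᵥ v) (x.block.1 *ᵥ v) := by
  rw [mul_ofCol, mul_inv_cancel_right]

lemma ofRow_mul (x : BlockGroup) (t f) :
    ofRow t f * x = x * ofRow (t + f ⬝ᵥ x.col) (f ᵥ* x.block.1) := by
  ext1 <;> simp [add_comm, add_left_comm, add_assoc]

lemma conj_ofRow (x : BlockGroup) (t f) :
    x⁻¹ * ofRow t f * x = ofRow (t + f ⬝ᵥ x.col) (f ᵥ* x.block.1) := by
  rw [mul_assoc, ofRow_mul, inv_mul_cancel_left]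

instance : colGroup.Normal where
  conj_mem n hn x := by
    rw [eq_ofCol hn, conj_ofCol]
    exact ofCol_mem _ _

instance : rowGroup.Normal where
  conj_mem n hn x := by
    have h := conj_ofRow x⁻¹ n.corner n.row
    rw [inv_inv, ← eq_ofRow hn] at h
    exact h ▸ ofRow_mem _ _

lemma dual_mem_colGroup {x : BlockGroup} (hx : x ∈ rowGroup) : dual x ∈ colGroup := by
  rw [dual_apply]
  refine inv_mem ⟨hx.1, Units.ext ?_⟩
  simp [reflect, hx.2]

lemma ofRow_not_mem_colGroup {t f} (hf : f ≠ 0) : ofRow t f ∉ colGroup := fun h => hf h.1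

/-- The transvection `u ↦ u + (f ⬝ᵥ u) • v`. -/
def transv (v f : Fin 3 → ZMod 2) (h : f ⬝ᵥ v = 0) : GL (Fin 3) (ZMod 2) :=
  have : (1 + vecMulVec v f) * (1 + vecMulVec v f) = 1 := by
    rw [mul_add, add_mul, add_mul, vecMulVec_mul_vecMulVec, h]
    simp [add_assoc, ZModModule.add_self]
  ⟨1 + vecMulVec v f, 1 + vecMulVec v f, this, this⟩

lemma transv_val (v f h) : (transv v f h).1 = 1 + vecMulVec v f := rfl

@[simp] lemma inv_transv (v f h) : (transv v f h)⁻¹ = transv v f h := rfl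

lemma transv_mulVec (v f h u) : (transv v f h).1 *ᵥ u = u + (f ⬝ᵥ u) • v := by
  simp [transv_val, add_mulVec, vecMulVec_mulVec]

lemma vecMul_transv (v f h u) : u ᵥ* (transv v f h).1 = u + (u ⬝ᵥ v) • f := by
  simp [transv_val, vecMul_add, vecMul_vecMulVec]

lemma exists_dotProduct_eq_one : ∀ u w : Fin 3 → ZMod 2, u ≠ 0 → w ≠ 0 →
    ∃ f : Fin 3 → ZMod 2, f ⬝ᵥ u = 1 ∧ f ⬝ᵥ w = 1 := by
  decide

lemma exists_ne_zero_orthogonal : ∀ a b : Fin 3 → ZMod 2, a ≠ 0 →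
    ∃ v f : Fin 3 → ZMod 2, v ≠ 0 ∧ b ⬝ᵥ v = 0 ∧ f ⬝ᵥ v = 0 ∧ f ⬝ᵥ a = 1 := by
  decide

lemma exists_dotProduct_eq_one_of_orthogonal : ∀ b v : Fin 3 → ZMod 2,
    b ≠ 0 → v ≠ 0 → b ⬝ᵥ v = 0 → ∃ w g : Fin 3 → ZMod 2, b ⬝ᵥ w = 1 ∧ g ⬝ᵥ v = 1 ∧ g ⬝ᵥ w = 0 := by
  decide

lemma conj_ofBlock (h : GL (Fin 3) (ZMod 2)) (x : BlockGroup) :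
    ofBlock h * x * (ofBlock h)⁻¹ =
      ⟨x.corner, h.1 *ᵥ x.col, x.row ᵥ* (h⁻¹).1, h * x.block * h⁻¹⟩ := by
  rw [← map_inv]
  ext1 <;> simp [-map_inv]

lemma eq_one_of_mulVec {g : GL (Fin 3) (ZMod 2)} (h : ∀ v, g.1 *ᵥ v = v) : g = 1 :=
  Units.ext <| ext_of_mulVec_single fun i => by rw [h, Units.val_one, one_mulVec]

/-- A matrix commuting with all its conjugates has trivial middle block. -/
lemma block_eq_one_of_commute {x : BlockGroup} (hx : ∀ y, Commute x (y * x * y⁻¹)) :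
    x.block = 1 := by
  have sq (v) : x.block.1 *ᵥ (x.block.1 *ᵥ v) = v := by
    have h := congrArg col (hx (ofCol 0 v)).eq
    simp only [inv_ofCol, mul_col, mul_block, ofCol_col, ofCol_block, one_mul, mulVec_add,
      Units.val_one, one_mulVec] at h
    rw [mul_one] at h
    linear_combination h
  by_contra hne
  obtain ⟨w, hw⟩ : ∃ w, x.block.1 *ᵥ w ≠ w := by
    by_contra! hall
    exact hne (eq_one_of_mulVec hall)
  set M := x.block.1 with hM
  obtain ⟨u, hu⟩ : ∃ u, M *ᵥ w = u + w := ⟨M *ᵥ w - w, by simp⟩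
  have hu0 : u ≠ 0 := by rintro rfl; simp_all
  have hw0 : w ≠ 0 := by rintro rfl; simp_all
  have huw : M *ᵥ (u + w) = w := by rw [← hu, sq]
  have hMu : M *ᵥ u = u := by
    rw [mulVec_add, hu] at huw
    rw [eq_sub_of_add_eq huw, sub_add_cancel_right, ZModModule.neg_eq_self]
  obtain ⟨f, hfu, hfw⟩ := exists_dotProduct_eq_one u w hu0 hw0
  have hf : f ⬝ᵥ (u + w) = 0 := by
    rw [dotProduct_add, hfu, hfw]; rfl
  set h := transv (u + w) f hf with hh
  have hhu : h.1 *ᵥ u = w := by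
    rw [hh, transv_mulVec, hfu, one_smul, ← add_assoc, ZModModule.add_self, zero_add]
  have hhw : h.1 *ᵥ w = u := by
    rw [hh, transv_mulVec, hfw, one_smul, add_left_comm, ZModModule.add_self, add_zero]
  have hhuw : h.1 *ᵥ (u + w) = u + w := by
    rw [mulVec_add, hhu, hhw, add_comm]
  have key := congrArg (fun y : BlockGroup => y.block.1 *ᵥ w) (hx (ofBlock h)).eq
  simp only [conj_ofBlock, mul_block, Units.val_mul, ← mulVec_mulVec, hh, inv_transv] at key
  simp only [← hh, ← hM, hu, hhu, hhw, hMu, huw, hhuw] at key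
  exact hw0 (by simpa using key.symm)

/-- The elements commuting with all their conjugates are those of `colGroup` and `rowGroup`. -/
lemma forall_commute_conj_iff (x : BlockGroup) :
    (∀ y, Commute x (y * x * y⁻¹)) ↔ x ∈ colGroup ∨ x ∈ rowGroup := by
  refine ⟨fun hx => ?_, ?_⟩
  · have h1 := block_eq_one_of_commute hx
    by_contra! hne
    have ha : x.col ≠ 0 := fun h => hne.2 ⟨h, h1⟩
    have hb : x.row ≠ 0 := fun h => hne.1 ⟨h, h1⟩
    obtain ⟨v, f, hv, hbv, hfv, hfa⟩ := exists_ne_zero_orthogonal x.col x.row ha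
    obtain ⟨w, g, hbw, hgv, hgw⟩ := exists_dotProduct_eq_one_of_orthogonal x.row v hb hv hbv
    have key := congrArg corner (hx (ofBlock (transv v f hfv * transv w g hgw))).eq
    simp only [conj_ofBlock, mul_corner, _root_.mul_inv_rev, inv_transv, Units.val_mul,
      ← mulVec_mulVec, ← vecMul_vecMul, transv_mulVec, vecMul_transv, dotProduct_add,
      add_dotProduct, smul_dotProduct, dotProduct_smul, smul_eq_mul, hbv, hfa, hbw, hgv] at key
    simp at key
  · rintro (hx | hx) y
    · rw [eq_ofCol hx, conj_ofCol, Commute, SemiconjBy, ofCol_mul_ofCol, ofCol_mul_ofCol,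
        add_comm, add_comm x.col]
    · have hy := (inferInstance : rowGroup.Normal).conj_mem x hx y
      rw [eq_ofRow hy, eq_ofRow hx, Commute, SemiconjBy, ofRow_mul_ofRow, ofRow_mul_ofRow,
        add_comm, add_comm x.row]

lemma map_mem_union_iff (φ : MulAut BlockGroup) (x : BlockGroup) :
    φ x ∈ colGroup ∨ φ x ∈ rowGroup ↔ x ∈ colGroup ∨ x ∈ rowGroup := by
  rw [← forall_commute_conj_iff, ← forall_commute_conj_iff, φ.surjective.forall]
  refine forall_congr' fun y => ?_
  rw [← map_inv, ← map_mul, ← map_mul]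
  exact commute_map_iff φ.injective

lemma map_colGroup_mem_or (φ : MulAut BlockGroup) :
    (∀ x ∈ colGroup, φ x ∈ colGroup) ∨ ∀ x ∈ colGroup, φ x ∈ rowGroup :=
  SubgroupClass.subset_union (K := colGroup.comap φ.toMonoidHom)
    (L := rowGroup.comap φ.toMonoidHom) |>.1 fun x hx => (map_mem_union_iff φ x).2 (.inl hx)

lemma map_mem_rowGroup {φ : MulAut BlockGroup} (hφ : ∀ x ∈ colGroup, φ x ∈ colGroup) :
    ∀ x ∈ rowGroup, φ x ∈ rowGroup := by
  have hr : rowGroup ≤ colGroup.comap φ.toMonoidHom ∨ rowGroup ≤ rowGroup.comap φ.toMonoidHom :=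
    SubgroupClass.subset_union.1 fun x hx => (map_mem_union_iff φ x).2 (.inr hx)
  refine hr.resolve_left fun hr => ?_
  obtain ⟨x, hx⟩ := φ.surjective (ofRow 0 1)
  refine ofRow_not_mem_colGroup (t := 0) (one_ne_zero (α := Fin 3 → ZMod 2)) ?_
  rw [← hx]
  rcases (map_mem_union_iff φ x).1 (.inr (hx ▸ ofRow_mem _ _)) with h | h
  exacts [hφ x h, hr h]

/-- The centralizer of `colGroup` and `rowGroup`. -/
lemma eq_ofCol_of_commute {x : BlockGroup} (hc : ∀ v, Commute x (ofCol 0 v))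
    (hr : ∀ f, Commute x (ofRow 0 f)) : x = ofCol x.corner 0 := by
  have hblock : x.block = 1 := by
    refine eq_one_of_mulVec fun v => ?_
    simpa [add_comm x.col] using congrArg col (hc v).eq
  have hrow : x.row = 0 := dotProduct_eq_zero _ fun v => by
    simpa using congrArg corner (hc v).eq
  have hcol : x.col = 0 := dotProduct_eq_zero _ fun f => by
    simpa [dotProduct_comm] using congrArg corner (hr f).eq.symm
  ext1 <;> simp [*]

lemma ofCol_zero_mem_center (t) : ofCol t 0 ∈ Subgroup.center BlockGroup := by
  rw [Subgroup.mem_center_iff]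
  intro x
  simp [mul_ofCol]

lemma mem_center_iff {x : BlockGroup} :
    x ∈ Subgroup.center BlockGroup ↔ x = ofCol x.corner 0 := by
  refine ⟨fun h => ?_, fun h => h ▸ ofCol_zero_mem_center _⟩
  rw [Subgroup.mem_center_iff] at h
  exact eq_ofCol_of_commute (fun _ => (h _).symm) (fun _ => (h _).symm)

lemma card_center : Nat.card (Subgroup.center BlockGroup) = 2 := by
  let e : Subgroup.center BlockGroup ≃ ZMod 2 :=
    ⟨fun x => x.1.corner, fun t => ⟨ofCol t 0, ofCol_zero_mem_center t⟩,
      fun x => Subtype.ext (mem_center_iff.1 x.2).symm, fun _ => rfl⟩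
  rw [Nat.card_congr e, Nat.card_zmod]

lemma exists_orthogonal_dotProduct_eq_one : ∀ w : Fin 3 → ZMod 2,
    ∃ f v : Fin 3 → ZMod 2, f ⬝ᵥ w = 0 ∧ f ⬝ᵥ v = 1 := by
  decide

lemma exists_dotProduct_eq_one_of_orthogonal_left_right : ∀ v g : Fin 3 → ZMod 2,
    ∃ f w : Fin 3 → ZMod 2, f ⬝ᵥ v = 0 ∧ f ⬝ᵥ w = 1 ∧ g ⬝ᵥ w = 0 := by
  decide

lemma transv_mem_commutator (v g hg) :
    transv v g hg ∈ commutator (GL (Fin 3) (ZMod 2)) := by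
  obtain ⟨f, w, hfv, hfw, hgw⟩ := exists_dotProduct_eq_one_of_orthogonal_left_right v g
  have : transv v g hg = ⁅transv v f hfv, transv w g hgw⁆ := by
    refine Units.ext (ext_of_mulVec_single fun i => ?_)
    rw [commutatorElement_def, inv_transv, inv_transv]
    simp only [Units.val_mul, ← mulVec_mulVec, transv_mulVec, dotProduct_add, dotProduct_smul,
      smul_eq_mul, hfv, hfw, hgw, hg]
    ext j
    simp only [Pi.add_apply, Pi.smul_apply, smul_eq_mul]
    generalize f ⬝ᵥ Pi.single i 1 = p
    generalize g ⬝ᵥ Pi.single i 1 = q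
    generalize (Pi.single i 1 : Fin 3 → ZMod 2) j = r
    generalize v j = a
    generalize w j = b
    revert p q r a b
    decide
  rw [this]
  exact Subgroup.commutator_mem_commutator (Subgroup.mem_top _) (Subgroup.mem_top _)

lemma commutator_GL : commutator (GL (Fin 3) (ZMod 2)) = ⊤ := by
  refine eq_top_iff.2 fun g _ => ?_
  have hdet (h : GL (Fin 3) (ZMod 2)) : h.1.det ≠ 0 := h.det.ne_zero
  refine diagonal_transvection_induction_of_det_ne_zero
    (fun A => ∀ h : GL (Fin 3) (ZMod 2), h.1 = A → h ∈ commutator (GL (Fin 3) (ZMod 2)))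
    g.1 (hdet g) (fun D hD h hh => ?_) (fun t h hh => ?_) (fun A B hA hB PA PB h hh => ?_) g rfl
  · have hD1 : D = 1 := by
      ext1 i
      rw [det_diagonal, Finset.prod_ne_zero_iff] at hD
      exact Fin.eq_one_of_ne_zero (D i) (hD i (Finset.mem_univ i))
    have : h = 1 := Units.ext (by simp [hh, hD1])
    exact this ▸ one_mem _
  · have ht : (t.c • Pi.single t.j 1 : Fin 3 → ZMod 2) ⬝ᵥ Pi.single t.i 1 = 0 := by
      simp [t.hij]
    have : h = transv (Pi.single t.i 1) (t.c • Pi.single t.j 1) ht := by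
      refine Units.ext ?_
      rw [hh, transv_val, TransvectionStruct.toMatrix, transvection, vecMulVec_smul,
        ← single_eq_single_vecMulVec_single, smul_single, smul_eq_mul, mul_one]
    exact this ▸ transv_mem_commutator _ _ _
  · have : h = GeneralLinearGroup.mkOfDetNeZero A hA * GeneralLinearGroup.mkOfDetNeZero B hB :=
      Units.ext hh
    exact this ▸ mul_mem (PA _ rfl) (PB _ rfl)

lemma colGroup_le_commutator : colGroup ≤ commutator BlockGroup := by
  intro x hx
  rw [eq_ofCol hx, ← zero_add x.col, ← add_zero x.corner, ← ofCol_mul_ofCol]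
  refine mul_mem ?_ ?_
  · have : ofCol x.corner 0 = ⁅ofRow 0 (fun _ => x.corner), ofCol 0 (Pi.single 0 1)⁆ := by
      rw [commutatorElement_def, conj_ofCol, inv_ofCol, ofCol_mul_ofCol, ofRow_block,
        Units.val_one, one_mulVec, ZModModule.add_self]
      simp
    exact this ▸ Subgroup.commutator_mem_commutator (Subgroup.mem_top _) (Subgroup.mem_top _)
  · obtain ⟨f, v, hfw, hfv⟩ := exists_orthogonal_dotProduct_eq_one x.col
    have : ofCol 0 x.col = ⁅ofBlock (transv x.col f hfw), ofCol 0 v⁆ := by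
      rw [commutatorElement_def, conj_ofCol, inv_ofCol, ofCol_mul_ofCol, ofBlock_block,
        transv_mulVec, hfv, one_smul, add_right_comm v, ZModModule.add_self]
      simp
    exact this ▸ Subgroup.commutator_mem_commutator (Subgroup.mem_top _) (Subgroup.mem_top _)

lemma rowGroup_le_commutator : rowGroup ≤ commutator BlockGroup := by
  intro x hx
  have h := colGroup_le_commutator (dual_mem_colGroup hx)
  have hchar : (commutator BlockGroup).Characteristic := inferInstance
  exact hchar.fixed dual ▸ (Subgroup.mem_comap (f := dual.toMonoidHom)).2 h

lemma commutator_eq_top : commutator BlockGroup = ⊤ := by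
  refine eq_top_iff.2 fun x _ => ?_
  have hblock : ofBlock x.block ∈ commutator BlockGroup := by
    have h : x.block ∈ commutator (GL (Fin 3) (ZMod 2)) := commutator_GL ▸ Subgroup.mem_top _
    have hle := Subgroup.map_commutator ⊤ ⊤ ofBlock
    exact Subgroup.commutator_mono le_top le_top (hle ▸ Subgroup.mem_map_of_mem _ h)
  have : x = ofCol x.corner x.col * ofBlock x.block * ofRow 0 x.row := by
    ext1 <;> simp
  rw [this]
  exact mul_mem (mul_mem (colGroup_le_commutator (ofCol_mem _ _)) hblock)
    (rowGroup_le_commutator (ofRow_mem _ _))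

/-- An automorphism of a perfect group that is trivial modulo the center is trivial. -/
lemma _root_.MulAut.eq_one_of_forall_mem_center {G : Type*} [Group G] (hG : commutator G = ⊤)
    (φ : MulAut G) (h : ∀ x, x⁻¹ * φ x ∈ Subgroup.center G) : φ = 1 := by
  have hle : commutator G ≤ φ.toMonoidHom.eqLocus (MonoidHom.id G) := by
    refine Subgroup.commutator_le.2 fun x _ y _ => ?_
    change φ ⁅x, y⁆ = ⁅x, y⁆
    obtain ⟨c, hc, hx⟩ : ∃ c ∈ Subgroup.center G, φ x = x * c := ⟨_, h x, by simp⟩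
    obtain ⟨d, hd, hy⟩ : ∃ d ∈ Subgroup.center G, φ y = y * d := ⟨_, h y, by simp⟩
    rw [map_commutatorElement, hx, hy, commutatorElement_def, commutatorElement_def]
    rw [Subgroup.mem_center_iff] at hc hd
    calc x * c * (y * d) * (x * c)⁻¹ * (y * d)⁻¹
        = x * (c * (y * d * c⁻¹)) * x⁻¹ * d⁻¹ * y⁻¹ := by group
      _ = x * y * (d * x⁻¹) * d⁻¹ * y⁻¹ := by rw [← hc]; group
      _ = x * y * x⁻¹ * y⁻¹ := by rw [← hd]; group
  ext x
  exact hle (hG ▸ Subgroup.mem_top x)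

lemma exists_eq_dotProduct (β : (Fin 3 → ZMod 2) →+ ZMod 2) : ∃ r, ∀ v, β v = r ⬝ᵥ v := by
  refine ⟨fun i => β fun j => if i = j then 1 else 0, fun v => ?_⟩
  simpa [dotProduct, mul_comm] using LinearMap.pi_apply_eq_sum_univ (β.toZModLinearMap 2) v

lemma exists_eq_mulVec (L : (Fin 3 → ZMod 2) →+ (Fin 3 → ZMod 2))
    (hL : ∀ v, L v = 0 → v = 0) : ∃ g : GL (Fin 3) (ZMod 2), ∀ v, L v = g.1 *ᵥ v := by
  have hmul (v) : LinearMap.toMatrix' (L.toZModLinearMap 2) *ᵥ v = L v :=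
    LinearMap.toMatrix'_mulVec _ _
  have hunit : IsUnit (LinearMap.toMatrix' (L.toZModLinearMap 2)) := by
    rw [← mulVec_injective_iff_isUnit]
    intro v w hvw
    simp only [hmul] at hvw
    exact sub_eq_zero.1 (hL _ (by rw [map_sub, hvw, sub_self]))
  exact ⟨hunit.unit, fun v => (hmul v).symm⟩

lemma map_ofCol_zero {φ : MulAut BlockGroup} (hc : ∀ x ∈ colGroup, φ x ∈ colGroup)
    (hr : ∀ x ∈ rowGroup, φ x ∈ rowGroup) (t : ZMod 2) : φ (ofCol t 0) = ofCol t 0 := by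
  have h : φ (ofCol t 0) = ofCol (φ (ofCol t 0)).corner 0 := by
    have h0 : (φ (ofCol t 0)).col = 0 := (hr _ (ofRow_mem t 0)).1
    conv_lhs => rw [eq_ofCol (hc _ (ofCol_mem t 0)), h0]
  have ht : φ (ofCol t 0) = 1 ↔ ofCol t 0 = 1 := map_eq_one_iff φ φ.injective
  have h1 (s : ZMod 2) : ofCol s 0 = 1 ↔ s = 0 :=
    ⟨congrArg corner, by rintro rfl; rfl⟩
  rw [h, h1, h1] at ht
  rw [h]
  congr 1
  generalize (φ (ofCol t 0)).corner = s at ht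
  clear h
  revert s t
  decide

/-- An automorphism preserving `colGroup` agrees on it with an inner automorphism. -/
lemma exists_conj_eq_on_colGroup {φ : MulAut BlockGroup} (hc : ∀ x ∈ colGroup, φ x ∈ colGroup)
    (hr : ∀ x ∈ rowGroup, φ x ∈ rowGroup) :
    ∃ x, ∀ t v, φ (ofCol t v) = x * ofCol t v * x⁻¹ := by
  have hφ (v) := eq_ofCol (hc _ (ofCol_mem 0 v))
  have hadd (v w) : φ (ofCol 0 (v + w)) = φ (ofCol 0 v) * φ (ofCol 0 w) := by
    rw [← map_mul, ofCol_mul_ofCol, add_zero]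
  obtain ⟨r, hrv⟩ := exists_eq_dotProduct <| .mk' (fun v => (φ (ofCol 0 v)).corner) fun v w => by
    simp [hadd, (hc _ (ofCol_mem 0 v)).1]
  obtain ⟨g, hg⟩ := exists_eq_mulVec (.mk' (fun v => (φ (ofCol 0 v)).col) fun v w => by
      simp [hadd, (hc _ (ofCol_mem 0 v)).2]) fun v hv => by
    have h := hφ v
    rw [show (φ (ofCol 0 v)).col = 0 from hv, ← map_ofCol_zero hc hr] at h
    exact congrArg col (φ.injective h)
  refine ⟨⟨0, 0, r, g⟩, fun t v => ?_⟩
  rw [conj_ofCol, ← add_zero t, ← zero_add v, ← ofCol_mul_ofCol, map_mul, map_ofCol_zero hc hr,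
    hφ, ofCol_mul_ofCol]
  simpa using congrArg₂ (fun s w => ofCol (t + s) w) (hrv v) (hg v)

/-- An automorphism fixing `colGroup` pointwise agrees on `rowGroup` with conjugation by an
element of `colGroup`. -/
lemma exists_conj_eq_on_rowGroup {φ : MulAut BlockGroup} (hc : ∀ t v, φ (ofCol t v) = ofCol t v)
    (hr : ∀ x ∈ rowGroup, φ x ∈ rowGroup) :
    ∃ w, ∀ f, φ (ofRow 0 f) = ofCol 0 w * ofRow 0 f * (ofCol 0 w)⁻¹ := by
  have hrow (f) : (φ (ofRow 0 f)).row = f := by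
    refine dotProduct_eq _ _ fun v => ?_
    have h := congrArg (fun x => (φ x).corner) (mul_ofCol (ofRow 0 f) 0 v)
    simpa [hc, add_comm _ (φ (ofRow 0 f)).corner] using h
  have hadd (f g) : φ (ofRow 0 (f + g)) = φ (ofRow 0 f) * φ (ofRow 0 g) := by
    rw [← map_mul, ofRow_mul_ofRow, add_zero]
  obtain ⟨w, hw⟩ := exists_eq_dotProduct <| .mk' (fun f => (φ (ofRow 0 f)).corner) fun f g => by
    simp [hadd, (hr _ (ofRow_mem 0 g)).1]
  refine ⟨w, fun f => ?_⟩
  have h := conj_ofRow (ofCol 0 w) 0 f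
  rw [inv_ofCol] at h ⊢
  rw [h, eq_ofRow (hr _ (ofRow_mem 0 f)), hrow]
  simpa [dotProduct_comm] using congrArg (fun s => ofRow s f) (hw f)

/-- An automorphism fixing `colGroup` and `rowGroup` pointwise is trivial. -/
lemma eq_one_of_fixes {φ : MulAut BlockGroup} (hc : ∀ x ∈ colGroup, φ x = x)
    (hr : ∀ x ∈ rowGroup, φ x = x) : φ = 1 := by
  have key {N : Subgroup BlockGroup} [hN : N.Normal] (h : ∀ x ∈ N, φ x = x) (x n)
      (hn : n ∈ N) : Commute (x⁻¹ * φ x) n := by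
    have h' := h _ (hN.conj_mem n hn x)
    rw [map_mul, map_mul, map_inv, h n hn, mul_inv_eq_iff_eq_mul] at h'
    rw [Commute, SemiconjBy, mul_assoc, h']
    group
  refine MulAut.eq_one_of_forall_mem_center commutator_eq_top φ fun x => mem_center_iff.2 ?_
  exact eq_ofCol_of_commute (fun v => key hc x _ (ofCol_mem 0 v))
    (fun f => key hr x _ (ofRow_mem 0 f))

lemma mem_range_conj {φ : MulAut BlockGroup} (hc : ∀ x ∈ colGroup, φ x ∈ colGroup) :
    φ ∈ (MulAut.conj : BlockGroup →* _).range := by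
  have hr := map_mem_rowGroup hc
  obtain ⟨x, hx⟩ := exists_conj_eq_on_colGroup hc hr
  obtain ⟨ψ, rfl⟩ : ∃ ψ, φ = MulAut.conj x * ψ := ⟨(MulAut.conj x)⁻¹ * φ, by simp⟩
  have hψ (t v) : ψ (ofCol t v) = ofCol t v := by simpa using hx t v
  obtain ⟨w, hw⟩ := exists_conj_eq_on_rowGroup hψ fun y hy => by
    simpa [mul_assoc] using (inferInstance : rowGroup.Normal).conj_mem _ (hr y hy) x⁻¹
  obtain ⟨χ, rfl⟩ : ∃ χ, ψ = MulAut.conj (ofCol 0 w) * χ :=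
    ⟨(MulAut.conj (ofCol 0 w))⁻¹ * ψ, by simp⟩
  have hχ : χ = 1 := by
    have hcol (t v) : χ (ofCol t v) = ofCol t v := by
      apply (MulAut.conj (ofCol 0 w)).injective
      refine (hψ t v).trans ?_
      simp [conj_ofCol]
    refine eq_one_of_fixes (fun y hy => ?_) (fun y hy => ?_)
    · rw [eq_ofCol hy, hcol]
    · have : y = ofCol y.corner 0 * ofRow 0 y.row := by
        ext1 <;> simp [hy.1, hy.2]
      have hrow : χ (ofRow 0 y.row) = ofRow 0 y.row := by simpa using hw y.row
      rw [this, map_mul, hcol, hrow]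
  rw [hχ, mul_one, ← map_mul]
  exact ⟨_, rfl⟩

lemma dual_not_mem_range_conj : dual ∉ (MulAut.conj : BlockGroup →* _).range := by
  rintro ⟨x, hx⟩
  have h := dual_mem_colGroup (ofRow_mem 0 1)
  rw [← hx, MulAut.conj_apply] at h
  refine ofRow_not_mem_colGroup (t := 0) (one_ne_zero (α := Fin 3 → ZMod 2)) ?_
  simpa [mul_assoc] using (inferInstance : colGroup.Normal).conj_mem _ h x⁻¹

lemma index_range_conj : (MulAut.conj : BlockGroup →* _).range.index = 2 := by
  refine Subgroup.index_eq_two_iff_exists_notMem_and'.2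
    ⟨dual, dual_not_mem_range_conj, fun φ => ?_⟩
  rcases map_colGroup_mem_or φ with h | h
  · exact .inr (mem_range_conj h)
  · exact .inl (mem_range_conj fun x hx => dual_mem_colGroup (h x hx))

lemma _root_.MulAut.ker_conj (G : Type*) [Group G] :
    (MulAut.conj : G →* MulAut G).ker = Subgroup.center G := by
  ext x
  simp only [MonoidHom.mem_ker, Subgroup.mem_center_iff, MulEquiv.ext_iff, MulAut.conj_apply,
    MulAut.one_apply, mul_inv_eq_iff_eq_mul]
  exact forall_congr' fun y => eq_comm

lemma card_mulAut : Nat.card (MulAut BlockGroup) = 21504 := by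
  have h := (Subgroup.center BlockGroup).card_mul_index
  rw [card_center, card_eq, ← MulAut.ker_conj, Subgroup.index_ker] at h
  rw [← Subgroup.card_mul_index (MulAut.conj : BlockGroup →* _).range, index_range_conj]
  omega

lemma _root_.MulAut.center_eq_bot {G : Type*} [Group G] (hG : commutator G = ⊤) :
    Subgroup.center (MulAut G) = ⊥ := by
  refine (Subgroup.eq_bot_iff_forall _).2 fun φ hφ => ?_
  refine φ.eq_one_of_forall_mem_center hG fun x => ?_
  rw [← MulAut.ker_conj, MonoidHom.mem_ker, map_mul, map_inv, inv_mul_eq_one]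
  ext y
  have h := DFunLike.congr_fun (Subgroup.mem_center_iff.1 hφ (MulAut.conj x)) (φ⁻¹ y)
  simpa using h

/-- The embedding of `ZMod 2` into `ZMod 4`. -/
def double : ZMod 2 →+ ZMod 4 where
  toFun t := 2 * t.val
  map_zero' := rfl
  map_add' := by decide

/-- Reduction modulo 2. -/
abbrev reduce : ZMod 4 →+* ZMod 2 := ZMod.castHom (by decide) (ZMod 2)

lemma double_injective : Function.Injective double := by decide

lemma reduce_double : ∀ t, reduce (double t) = 0 := by decide

/-- The endomorphism `(s, v) ↦ ((1 + 2 * corner) * s + 2 * row ⬝ᵥ v, s • col + block *ᵥ v)`. -/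
def toEnd (x : BlockGroup) : ZMod 4 × (Fin 3 → ZMod 2) →+ ZMod 4 × (Fin 3 → ZMod 2) :=
  .mk' (fun p => (p.1 + double (x.corner * reduce p.1 + x.row ⬝ᵥ p.2),
      reduce p.1 • x.col + x.block.1 *ᵥ p.2)) fun p q => by
    ext1
    · simp only [Prod.fst_add, Prod.snd_add, map_add, mul_add, dotProduct_add]
      abel
    · simp only [Prod.fst_add, Prod.snd_add, map_add, add_smul, mulVec_add]
      abel

lemma toEnd_apply (x : BlockGroup) (p) :
    x.toEnd p = (p.1 + double (x.corner * reduce p.1 + x.row ⬝ᵥ p.2),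
      reduce p.1 • x.col + x.block.1 *ᵥ p.2) := rfl

lemma toEnd_one (p) : toEnd 1 p = p := by
  simp [toEnd_apply]

lemma toEnd_mul (x y : BlockGroup) (p) : (x * y).toEnd p = x.toEnd (y.toEnd p) := by
  ext1
  · simp only [toEnd_apply, mul_corner, mul_row, map_add, reduce_double, add_mul,
      add_dotProduct, dotProduct_add, dotProduct_smul, smul_eq_mul, dotProduct_mulVec,
      add_zero, mul_comm (x.row ⬝ᵥ y.col)]
    abel
  · simp only [toEnd_apply, mul_col, mul_block, map_add, reduce_double, add_zero, smul_add,
      mulVec_add, mulVec_smul, mulVec_mulVec, Units.val_mul]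
    abel

/-- The action of `BlockGroup` by automorphisms on `ZMod 4 × (Fin 3 → ZMod 2)`. -/
def toMulAut : BlockGroup →* MulAut (Multiplicative (ZMod 4 × (Fin 3 → ZMod 2))) where
  toFun x := AddEquiv.toMultiplicative
    { toFun := x.toEnd
      invFun := x⁻¹.toEnd
      left_inv p := by rw [← toEnd_mul, inv_mul_cancel, toEnd_one]
      right_inv p := by rw [← toEnd_mul, mul_inv_cancel, toEnd_one]
      map_add' := map_add _ }
  map_one' := by
    ext1 p
    exact toEnd_one p
  map_mul' x y := by
    ext1 p
    exact toEnd_mul x y p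

lemma toMulAut_injective : Function.Injective toMulAut := by
  refine (injective_iff_map_eq_one _).2 fun x hx => ?_
  have h (p) : x.toEnd p = p := DFunLike.congr_fun hx p
  have h1 := h (1, 0)
  have h2 (v) := h (0, v)
  simp only [toEnd_apply, Prod.mk.injEq, map_one, map_zero, mul_one, mul_zero, zero_smul,
    one_smul, mulVec_zero, dotProduct_zero, add_zero, zero_add, add_eq_left,
    map_eq_zero_iff _ double_injective] at h1 h2
  ext1
  · exact h1.1
  · exact h1.2
  · exact dotProduct_eq_zero _ fun v => (h2 v).1
  · exact eq_one_of_mulVec fun v => (h2 v).2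

lemma exists_double_eq : ∀ s : ZMod 4, 2 • s = 0 → ∃ t, double t = s := by decide

lemma exists_one_add_double_eq : ∀ s : ZMod 4, 2 • s ≠ 0 → ∃ t, 1 + double t = s := by decide

lemma add_double_mul_reduce : ∀ (s : ZMod 4) (t : ZMod 2),
    s + double (t * reduce s) = s.val • (1 + double t) := by decide

lemma nsmul_two_nsmul_one_add_double : ∀ s t : ZMod 2,
    s.val • 2 • (1 + double t) = double s := by decide

lemma exists_toEnd_eq (ψ : ZMod 4 × (Fin 3 → ZMod 2) ≃+ ZMod 4 × (Fin 3 → ZMod 2)) :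
    ∃ x : BlockGroup, ∀ p, x.toEnd p = ψ p := by
  obtain ⟨t, ht⟩ := exists_one_add_double_eq (ψ (1, 0)).1 fun h => by
    have h2 : ψ (2 • (1, 0)) = 0 := by
      rw [map_nsmul]
      ext1
      · exact h
      · exact ZModModule.char_nsmul_eq_zero 2 _
    rw [map_eq_zero_iff ψ ψ.injective] at h2
    exact absurd (congrArg Prod.fst h2) (by decide)
  have hβ (v) : ∃ s, double s = (ψ (0, v)).1 := by
    refine exists_double_eq _ ?_
    rw [← Prod.smul_fst, ← map_nsmul, Prod.smul_mk, ZModModule.char_nsmul_eq_zero 2 v,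
      smul_zero, ← Prod.zero_eq_mk, map_zero, Prod.fst_zero]
  choose β hβ using hβ
  have hadd (v w) : ψ (0, v + w) = ψ (0, v) + ψ (0, w) := by
    rw [← map_add, Prod.mk_add_mk, add_zero]
  obtain ⟨r, hr⟩ := exists_eq_dotProduct <| .mk' β fun v w => double_injective <| by
    simp [hβ, hadd]
  obtain ⟨g, hg⟩ := exists_eq_mulVec (.mk' (fun v => (ψ (0, v)).2) fun v w => by
      simp [hadd]) fun v hv => by
    have h2 (s) : ψ (double s, 0) = (double s, 0) := by
      have hs : (double s, (0 : Fin 3 → ZMod 2)) = s.val • 2 • (1, 0) := by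
        simp [double, mul_comm]
      rw [hs, map_nsmul, map_nsmul, ← hs]
      ext1
      · rw [Prod.smul_fst, Prod.smul_fst, ← ht]
        exact nsmul_two_nsmul_one_add_double s t
      · rw [Prod.smul_snd, Prod.smul_snd, ZModModule.char_nsmul_eq_zero 2, smul_zero]
    have h3 : ψ (0, v) = ψ (double (β v), 0) := by
      rw [h2]
      exact Prod.ext (hβ v).symm hv
    exact congrArg Prod.snd (ψ.injective h3)
  refine ⟨⟨t, (ψ (1, 0)).2, r, g⟩, fun p => ?_⟩
  have hp : p = p.1.val • (1, 0) + (0, p.2) := by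
    ext1 <;> simp
  have hr' : r ⬝ᵥ p.2 = β p.2 := (hr p.2).symm
  have hg' : g.1 *ᵥ p.2 = (ψ (0, p.2)).2 := (hg p.2).symm
  conv_rhs => rw [hp, map_add, map_nsmul]
  ext1
  · simp only [toEnd_apply, hr', map_add, hβ, Prod.fst_add, Prod.smul_fst, ← ht, ← add_assoc]
    congr 1
    exact add_double_mul_reduce p.1 t
  · simp only [toEnd_apply, hg', Prod.snd_add, Prod.smul_snd]
    congr 1
    rw [← Nat.cast_smul_eq_nsmul (ZMod 2), ZMod.natCast_val]
    rfl

end BlockGroup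

/-- Grouping the factors of order two into a vector. -/
def C4xC2xC2xC2.equivProd :
    C4xC2xC2xC2 ≃* Multiplicative (ZMod 4 × (Fin 3 → ZMod 2)) where
  toFun p := .ofAdd (p.1.toAdd, ![p.2.1.toAdd, p.2.2.1.toAdd, p.2.2.2.toAdd])
  invFun q := (.ofAdd q.toAdd.1, .ofAdd (q.toAdd.2 0), .ofAdd (q.toAdd.2 1), .ofAdd (q.toAdd.2 2))
  left_inv _ := rfl
  right_inv q := by
    refine Multiplicative.toAdd.injective (Prod.ext rfl (funext fun i => ?_))
    fin_cases i <;> rfl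
  map_mul' p q := by
    refine Multiplicative.toAdd.injective (Prod.ext rfl (funext fun i => ?_))
    fin_cases i <;> rfl

/-- The automorphism group of `C₄ × C₂ × C₂ × C₂` as a group of matrices over `ZMod 2`. -/
noncomputable def BlockGroup.equivMulAut : BlockGroup ≃* MulAut C4xC2xC2xC2 :=
  (MulEquiv.ofBijective BlockGroup.toMulAut ⟨BlockGroup.toMulAut_injective, fun φ =>
    let ⟨x, hx⟩ := BlockGroup.exists_toEnd_eq (AddEquiv.toMultiplicative.symm φ)
    ⟨x, MulEquiv.ext hx⟩⟩).trans (MulAut.congr C4xC2xC2xC2.equivProd.symm)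

/-- The automorphism group of the automorphism group of `C₄ × C₂ × C₂ × C₂` also has
order 21504, and it has trivial center. -/
theorem aut_aut_C4xC2xC2xC2_card_and_trivial_center :
    Nat.card (MulAut (MulAut C4xC2xC2xC2)) = 21504 ∧
    Subgroup.center (MulAut (MulAut C4xC2xC2xC2)) = ⊥ := by
  have e := MulAut.congr BlockGroup.equivMulAut
  refine ⟨(Nat.card_congr e.toEquiv).symm.trans BlockGroup.card_mulAut, ?_⟩
  refine MulAut.center_eq_bot ?_
  have h : BlockGroup.equivMulAut.toMonoidHom.range = ⊤ :=
    MonoidHom.range_eq_top.2 BlockGroup.equivMulAut.surjective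
  rw [commutator_def, ← h, MonoidHom.range_eq_map, ← Subgroup.map_commutator, ← commutator_def,
    BlockGroup.commutator_eq_top]
end

section
/- The automorphism group of the abelian group C₈ × C₂ × C₂ is isomorphic to the direct product Aut(C₄ × C₂ × C₂) × C₂. -/
/-- The block matrices `!![1, row, corner; 0, mid, col; 0, 0, 1]` acting on `R × V × R`, with
`mid` invertible. -/
@[ext]
structure BlockUnitriangular (R V : Type*) [CommRing R] [AddCommGroup V] [Module R V] where
  corner : R
  row : V →ₗ[R] R
  col : V
  mid : V ≃ₗ[R] V

namespace BlockUnitriangular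

variable {R V : Type*} [CommRing R] [AddCommGroup V] [Module R V]

instance : Mul (BlockUnitriangular R V) where
  mul g h :=
    ⟨g.corner + h.corner + g.row h.col, h.row + g.row ∘ₗ h.mid, g.col + g.mid h.col,
      g.mid * h.mid⟩

instance : One (BlockUnitriangular R V) where
  one := ⟨0, 0, 0, 1⟩

instance : Inv (BlockUnitriangular R V) where
  inv g := ⟨-g.corner + g.row (g.mid⁻¹ g.col), -(g.row ∘ₗ (g.mid⁻¹ : V ≃ₗ[R] V)),
    -g.mid⁻¹ g.col, g.mid⁻¹⟩

section

variable (g h : BlockUnitriangular R V)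

@[simp] lemma corner_mul : (g * h).corner = g.corner + h.corner + g.row h.col := rfl
@[simp] lemma row_mul : (g * h).row = h.row + g.row ∘ₗ h.mid := rfl
@[simp] lemma col_mul : (g * h).col = g.col + g.mid h.col := rfl
@[simp] lemma mid_mul : (g * h).mid = g.mid * h.mid := rfl
@[simp] lemma corner_one : (1 : BlockUnitriangular R V).corner = 0 := rfl
@[simp] lemma row_one : (1 : BlockUnitriangular R V).row = 0 := rfl
@[simp] lemma col_one : (1 : BlockUnitriangular R V).col = 0 := rfl
@[simp] lemma mid_one : (1 : BlockUnitriangular R V).mid = 1 := rfl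
@[simp] lemma corner_inv : g⁻¹.corner = -g.corner + g.row (g.mid⁻¹ g.col) := rfl
@[simp] lemma row_inv : g⁻¹.row = -(g.row ∘ₗ (g.mid⁻¹ : V ≃ₗ[R] V)) := rfl
@[simp] lemma col_inv : g⁻¹.col = -g.mid⁻¹ g.col := rfl
@[simp] lemma mid_inv : g⁻¹.mid = g.mid⁻¹ := rfl

end

instance : Group (BlockUnitriangular R V) :=
  Group.ofLeftAxioms
    (fun f g h ↦ by
      ext x
      · simp; ring
      · simp; ring
      · simp [add_assoc]
      · simp)
    (fun g ↦ by ext <;> simp)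
    (fun g ↦ by ext <;> simp)

end BlockUnitriangular

/-- Data exhibiting the units of `ZMod n`, for `n` a multiple of `4`, as the product of a
group `S` and `{1, 1 + n / 2}`. Here `red` is reduction modulo `2` and `half` sends `1` to
`n / 2`. -/
structure UnitsSplitting (n : ℕ) (S : Type*) [Group S] where
  red : ZMod n →+* ZMod 2
  half : ZMod 2 →+ ZMod n
  unit : S →* ZMod n
  mul_half : ∀ a t, a * half t = half (red a * t)
  red_half : ∀ t, red (half t) = 0
  half_injective : Function.Injective half
  exists_half_eq : ∀ a, a + a = 0 → ∃ t, half t = a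
  unit_mul_injective : ∀ s s' t t', unit s * (1 + half t) = unit s' * (1 + half t') →
    s = s' ∧ t = t'
  exists_unit_mul_eq : ∀ a, red a = 1 → ∃ s t, unit s * (1 + half t) = a

namespace UnitsSplitting

variable {n : ℕ} {S V : Type*} [Group S] [AddCommGroup V] [Module (ZMod 2) V]
  (D : UnitsSplitting n S)

lemma eq_one_of_mul_eq_one : ∀ a b : ZMod 2, a * b = 1 → a = 1 := by decide

lemma red_unit (s : S) : D.red (D.unit s) = 1 :=
  eq_one_of_mul_eq_one _ (D.red (D.unit s⁻¹)) (by simp [← map_mul])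

lemma half_mul_half (t t' : ZMod 2) : D.half t * D.half t' = 0 := by
  simp [D.mul_half, D.red_half]

lemma unit_mul_half (s : S) (t : ZMod 2) : D.unit s * D.half t = D.half t := by
  simp [D.mul_half, D.red_unit]

/-- The additive endomorphism of `ZMod n × V` attached to a block matrix and an element of `S`. -/
def act (p : BlockUnitriangular (ZMod 2) V × S) : ZMod n × V →+ ZMod n × V :=
  AddMonoidHom.mk' (fun x ↦ (D.unit p.2 * (1 + D.half p.1.corner) * x.1 + D.half (p.1.row x.2),
      D.red x.1 • p.1.col + p.1.mid x.2)) fun x y ↦ by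
    ext
    · simp; ring
    · simp [add_smul]; abel

@[simp] lemma act_apply (p : BlockUnitriangular (ZMod 2) V × S) (x : ZMod n × V) :
    D.act p x = (D.unit p.2 * (1 + D.half p.1.corner) * x.1 + D.half (p.1.row x.2),
      D.red x.1 • p.1.col + p.1.mid x.2) := rfl

lemma act_mul_apply (p q : BlockUnitriangular (ZMod 2) V × S) (x : ZMod n × V) :
    D.act (p * q) x = D.act p (D.act q x) := by
  ext
  · have h := D.mul_half x.1 (p.1.row q.1.col)
    have h₁ := D.unit_mul_half p.2 (q.1.row x.2)
    have h₂ := D.half_mul_half p.1.corner (q.1.row x.2)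
    have h₃ := D.half_mul_half p.1.corner q.1.corner
    have h₄ := D.unit_mul_half p.2 (p.1.row q.1.col)
    have h₅ := D.unit_mul_half q.2 (p.1.row q.1.col)
    simp only [act_apply, Prod.fst_mul, Prod.snd_mul, BlockUnitriangular.corner_mul,
      BlockUnitriangular.row_mul, LinearMap.add_apply, LinearMap.comp_apply,
      LinearEquiv.coe_coe, map_mul, map_add, map_smul, smul_eq_mul]
    rw [← h]
    linear_combination (-1 : ZMod n) * h₁ - D.unit p.2 * h₂
      - D.unit p.2 * D.unit q.2 * x.1 * h₃ + D.unit q.2 * x.1 * h₄ + x.1 * h₅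
  · simp [D.red_half, D.red_unit, add_assoc]

/-- The action of `BlockUnitriangular (ZMod 2) V × S` on `ZMod n × V` by additive
endomorphisms. -/
def toEnd : BlockUnitriangular (ZMod 2) V × S →* AddMonoid.End (ZMod n × V) where
  toFun := D.act
  map_one' := AddMonoidHom.ext fun x ↦ by
    change D.act 1 x = x
    simp
  map_mul' p q := AddMonoidHom.ext (D.act_mul_apply p q)

@[simp] lemma toEnd_apply (p : BlockUnitriangular (ZMod 2) V × S) (x : ZMod n × V) :
    D.toEnd p x = (D.unit p.2 * (1 + D.half p.1.corner) * x.1 + D.half (p.1.row x.2),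
      D.red x.1 • p.1.col + p.1.mid x.2) := rfl

lemma toEnd_injective :
    Function.Injective (D.toEnd : BlockUnitriangular (ZMod 2) V × S → _) := by
  intro p q h
  have h₁ := DFunLike.congr_fun h (1, 0)
  have h₂ (w : V) := DFunLike.congr_fun h (0, w)
  simp only [toEnd_apply, Prod.mk.injEq, mul_one, mul_zero, map_zero, map_one, add_zero,
    zero_add, one_smul, zero_smul] at h₁ h₂
  obtain ⟨hs, hc⟩ := D.unit_mul_injective _ _ _ _ h₁.1
  refine Prod.ext (BlockUnitriangular.ext hc ?_ h₁.2 ?_) hs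
  · exact LinearMap.ext fun w ↦ D.half_injective (h₂ w).1
  · exact LinearEquiv.ext fun w ↦ (h₂ w).2

lemma end_apply_left (f : ZMod n × V →+ ZMod n × V) (x : ZMod n) :
    f (x, 0) = (x * (f (1, 0)).1, D.red x • (f (1, 0)).2) := by
  obtain ⟨k, rfl⟩ := ZMod.intCast_surjective x
  have h : ((k : ZMod n), (0 : V)) = k • ((1 : ZMod n), (0 : V)) := by ext <;> simp
  rw [h, map_zsmul]
  ext <;> simp [Int.cast_smul_eq_zsmul]

lemma end_apply (f : ZMod n × V →+ ZMod n × V) (x : ZMod n) (w : V) :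
    f (x, w) = (x * (f (1, 0)).1 + (f (0, w)).1, D.red x • (f (1, 0)).2 + (f (0, w)).2) := by
  have h : (x, w) = (x, 0) + (0, w) := by simp
  rw [h, map_add, D.end_apply_left]
  rfl

lemma exists_half_eq_end_apply (f : ZMod n × V →+ ZMod n × V) (w : V) :
    ∃ t, D.half t = (f (0, w)).1 := by
  refine D.exists_half_eq _ ?_
  rw [← Prod.fst_add, ← map_add, Prod.mk_add_mk, ← two_smul (ZMod 2) w,
    show (2 : ZMod 2) = 0 from rfl, zero_smul, add_zero, Prod.mk_zero_zero, map_zero,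
    Prod.fst_zero]

/-- The `V`-component of an additive endomorphism of `ZMod n × V`. -/
def mid (f : ZMod n × V →+ ZMod n × V) : V →ₗ[ZMod 2] V :=
  ((AddMonoidHom.snd _ _).comp (f.comp (AddMonoidHom.inr _ _))).toZModLinearMap 2

@[simp] lemma mid_apply (f : ZMod n × V →+ ZMod n × V) (w : V) :
    mid f w = (f (0, w)).2 := rfl

lemma mid_mid_of_leftInverse (D : UnitsSplitting n S) {f g : ZMod n × V →+ ZMod n × V}
    (h : Function.LeftInverse g f) (w : V) : mid g (mid f w) = w := by
  obtain ⟨t, ht⟩ := D.exists_half_eq_end_apply f w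
  have := h (0, w)
  rw [← Prod.mk.eta (p := f (0, w)), ← ht, D.end_apply, D.red_half] at this
  simpa using congrArg Prod.snd this

lemma exists_toEnd_eq (e : ZMod n × V ≃+ ZMod n × V) :
    ∃ p : BlockUnitriangular (ZMod 2) V × S, ∀ x, D.toEnd p x = e x := by
  choose u hu using D.exists_half_eq_end_apply e.toAddMonoidHom
  have hu_add (v w : V) : u (v + w) = u v + u w := by
    apply D.half_injective
    rw [map_add, hu, hu, hu, ← Prod.fst_add, ← map_add, Prod.mk_add_mk, add_zero]
  have hred : D.red (e (1, 0)).1 = 1 := by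
    obtain ⟨⟨a, v⟩, hav⟩ := e.surjective (1, 0)
    have h := congrArg (D.red ∘ Prod.fst) ((D.end_apply e.toAddMonoidHom a v).symm.trans hav)
    rw [← hu] at h
    refine eq_one_of_mul_eq_one _ (D.red a) ?_
    simpa [D.red_half, mul_comm] using h
  obtain ⟨s, t, hst⟩ := D.exists_unit_mul_eq _ hred
  refine ⟨(⟨t, (AddMonoidHom.mk' u hu_add).toZModLinearMap 2, (e (1, 0)).2,
    LinearEquiv.ofLinearMap (mid e.toAddMonoidHom) (mid e.symm.toAddMonoidHom)
      (LinearMap.ext (D.mid_mid_of_leftInverse e.right_inv))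
      (LinearMap.ext (D.mid_mid_of_leftInverse e.left_inv))⟩, s), fun ⟨x, w⟩ ↦ ?_⟩
  refine Eq.trans ?_ (D.end_apply e.toAddMonoidHom x w).symm
  simp [hst, hu, mul_comm]

/-- A splitting of the units of `ZMod n` describes the automorphisms of `ZMod n × V`. -/
theorem nonempty_mulEquiv_mulAut (D : UnitsSplitting n S) :
    Nonempty (BlockUnitriangular (ZMod 2) V × S ≃* MulAut (Multiplicative (ZMod n × V))) := by
  let _ := DistribMulAction.compHom (ZMod n × V) (D.toEnd (V := V))
  refine ⟨(MulEquiv.ofBijective (DistribMulAction.toAddAut (BlockUnitriangular (ZMod 2) V × S)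
    (ZMod n × V)) ⟨fun p q h ↦ D.toEnd_injective ?_, fun e ↦ ?_⟩).trans
      (MulAutMultiplicative (ZMod n × V)).symm⟩
  · exact AddMonoidHom.ext fun x ↦ DFunLike.congr_fun (congrArg Multiplicative.toAdd h) x
  · obtain ⟨p, hp⟩ := D.exists_toEnd_eq e.toAdd
    exact ⟨p, Multiplicative.toAdd.injective (AddEquiv.ext hp)⟩

/-- The units of `ZMod 4` are `{1, 1 + 2}`. -/
def four : UnitsSplitting 4 Unit where
  red := ZMod.castHom (by decide) _
  half := AddMonoidHom.mk' (fun t ↦ if t = 0 then 0 else 2) (by decide)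
  unit := 1
  mul_half := by decide
  red_half := by decide
  half_injective := by decide
  exists_half_eq := by decide
  unit_mul_injective := by decide
  exists_unit_mul_eq := by decide

/-- The units of `ZMod 8` are `{1, -1} × {1, 1 + 4}`. -/
def eight : UnitsSplitting 8 (Multiplicative (ZMod 2)) where
  red := ZMod.castHom (by decide) _
  half := AddMonoidHom.mk' (fun t ↦ if t = 0 then 0 else 4) (by decide)
  unit := ⟨⟨fun s ↦ if s = 1 then 1 else -1, by decide⟩, by decide⟩
  mul_half := by decide
  red_half := by decide
  half_injective := by decide
  exists_half_eq := by decide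
  unit_mul_injective := by decide
  exists_unit_mul_eq := by decide

end UnitsSplitting

/-- `Multiplicative` distributes over a triple product. -/
def multiplicativeTripleEquiv (A B C : Type*) [AddMonoid A] [AddMonoid B]
    [AddMonoid C] :
    Multiplicative (A × B × C) ≃* Multiplicative A × Multiplicative B × Multiplicative C :=
  (MulEquiv.prodMultiplicative _ _).trans
    ((MulEquiv.refl _).prodCongr (MulEquiv.prodMultiplicative _ _))

/-- The automorphism group of the abelian group `C₈ × C₂ × C₂` is isomorphic to
`Aut (C₄ × C₂ × C₂) × C₂`. -/
theorem aut_C8xC2xC2_iso_aut_C4xC2xC2_xC2 :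
    Nonempty
      (MulAut (Multiplicative (ZMod 8) × Multiplicative (ZMod 2) × Multiplicative (ZMod 2)) ≃*
        MulAut (Multiplicative (ZMod 4) × Multiplicative (ZMod 2) × Multiplicative (ZMod 2)) ×
          Multiplicative (ZMod 2)) := by
  obtain ⟨e₈⟩ := UnitsSplitting.eight.nonempty_mulEquiv_mulAut (V := ZMod 2 × ZMod 2)
  obtain ⟨e₄⟩ := UnitsSplitting.four.nonempty_mulEquiv_mulAut (V := ZMod 2 × ZMod 2)
  have f₈ := e₈.trans (MulAut.congr (multiplicativeTripleEquiv (ZMod 8) (ZMod 2) (ZMod 2)))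
  have f₄ := (MulEquiv.prodUnique.symm.trans e₄).trans
    (MulAut.congr (multiplicativeTripleEquiv (ZMod 4) (ZMod 2) (ZMod 2)))
  exact ⟨f₈.symm.trans (f₄.prodCongr (MulEquiv.refl _))⟩
end

section
/- The automorphism group of A₄ × C₈ (a group of order 96, where A₄ is the alternating group on 4 letters) is isomorphic to S₄ × C₂ × C₂. -/
/-- The product of an automorphism of `G` and an automorphism of `H`, as an automorphism of
`G × H`. -/
def mulAutProdHom (G H : Type*) [Group G] [Group H] :
    MulAut G × MulAut H →* MulAut (G × H) where
  toFun p := p.1.prodCongr p.2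
  map_one' := rfl
  map_mul' _ _ := rfl

theorem mulAutProdHom_injective (G H : Type*) [Group G] [Group H] :
    Function.Injective (mulAutProdHom G H) := by
  intro p q h
  refine Prod.ext (MulEquiv.ext fun g => ?_) (MulEquiv.ext fun k => ?_)
  · exact congrArg Prod.fst (DFunLike.congr_fun h (g, 1))
  · exact congrArg Prod.snd (DFunLike.congr_fun h (1, k))

theorem mulEquiv_prod_fst_eq_one {G H : Type*} [Group G] [CommGroup H]
    (hG : Subgroup.center G = ⊥) (φ : MulAut (G × H)) (k : H) : (φ (1, k)).1 = 1 := by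
  rw [← Subgroup.mem_bot, ← hG, Subgroup.mem_center_iff]
  intro g
  have h : φ.symm (g, 1) * (1, k) = (1, k) * φ.symm (g, 1) := by
    ext <;> simp [mul_comm]
  simpa using congrArg (fun x => (φ x).1) h

theorem mulEquiv_prod_snd_eq_one {G H : Type*} [Group G] [CommGroup H]
    (hGH : ∀ f : G →* H, f = 1) (φ : MulAut (G × H)) (g : G) : (φ (g, 1)).2 = 1 :=
  DFunLike.congr_fun
    (hGH ((MonoidHom.snd G H).comp (φ.toMonoidHom.comp (MonoidHom.inl G H)))) g

theorem mulAutProdHom_surjective {G H : Type*} [Group G] [CommGroup H]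
    (hG : Subgroup.center G = ⊥) (hGH : ∀ f : G →* H, f = 1) :
    Function.Surjective (mulAutProdHom G H) := by
  intro φ
  have hl (ψ : MulAut (G × H)) (g : G) : ((ψ (g, 1)).1, 1) = ψ (g, 1) :=
    Prod.ext rfl (mulEquiv_prod_snd_eq_one hGH ψ g).symm
  have hr (ψ : MulAut (G × H)) (k : H) : (1, (ψ (1, k)).2) = ψ (1, k) :=
    Prod.ext (mulEquiv_prod_fst_eq_one hG ψ k).symm rfl
  let l (ψ : MulAut (G × H)) : G →* G :=
    (MonoidHom.fst G H).comp (ψ.toMonoidHom.comp (MonoidHom.inl G H))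
  let r (ψ : MulAut (G × H)) : H →* H :=
    (MonoidHom.snd G H).comp (ψ.toMonoidHom.comp (MonoidHom.inr G H))
  have hll (ψ : MulAut (G × H)) : (l ψ⁻¹).comp (l ψ) = MonoidHom.id G := by
    ext g
    change (ψ⁻¹ ((ψ (g, 1)).1, 1)).1 = g
    rw [hl, MulAut.inv_apply_self]
  have hrr (ψ : MulAut (G × H)) : (r ψ⁻¹).comp (r ψ) = MonoidHom.id H := by
    ext k
    change (ψ⁻¹ (1, (ψ (1, k)).2)).2 = k
    rw [hr, MulAut.inv_apply_self]
  refine ⟨((l φ).toMulEquiv (l φ⁻¹) (hll φ) (by simpa using hll φ⁻¹),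
    (r φ).toMulEquiv (r φ⁻¹) (hrr φ) (by simpa using hrr φ⁻¹)), MulEquiv.ext fun ⟨g, k⟩ => ?_⟩
  change ((φ (g, 1)).1, (φ (1, k)).2) = φ (g, k)
  rw [show ((g, k) : G × H) = (g, 1) * (1, k) by simp, map_mul, ← hl φ g, ← hr φ k]
  simp

theorem center_alternatingGroup_four : Subgroup.center (alternatingGroup (Fin 4)) = ⊥ := by
  rw [Subgroup.eq_bot_iff_forall]
  have h : ∀ z : alternatingGroup (Fin 4), (∀ g, g * z = z * g) → z = 1 := by decide
  exact fun z hz => h z (Subgroup.mem_center_iff.mp hz)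

theorem alternatingGroup_four_exists_mul_of_pow_three_eq_one :
    ∀ g : alternatingGroup (Fin 4), ∃ a b : alternatingGroup (Fin 4),
      a ^ 3 = 1 ∧ b ^ 3 = 1 ∧ a * b = g := by
  decide

theorem alternatingGroup_four_hom_eq_one
    (f : alternatingGroup (Fin 4) →* Multiplicative (ZMod 8)) : f = 1 := by
  have cube : ∀ x : Multiplicative (ZMod 8), x ^ 3 = 1 → x = 1 := by decide
  ext1 g
  obtain ⟨a, b, ha, hb, rfl⟩ := alternatingGroup_four_exists_mul_of_pow_three_eq_one g
  have ha' : f a = 1 := cube _ (by rw [← map_pow, ha, map_one])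
  have hb' : f b = 1 := cube _ (by rw [← map_pow, hb, map_one])
  simp [ha', hb']

/-- The 3-cycle `0 ↦ 1 ↦ 2 ↦ 0` in `A₄`. -/
def alternatingThreeCycle : alternatingGroup (Fin 4) :=
  ⟨Equiv.swap 0 1 * Equiv.swap 1 2, Equiv.Perm.mem_alternatingGroup.mpr (by decide)⟩

/-- The double transposition `(0 1)(2 3)` in `A₄`. -/
def alternatingDoubleSwap : alternatingGroup (Fin 4) :=
  ⟨Equiv.swap 0 1 * Equiv.swap 2 3, Equiv.Perm.mem_alternatingGroup.mpr (by decide)⟩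

theorem alternatingGroup_four_eq_word :
    ∀ g : alternatingGroup (Fin 4), ∃ (i : Fin 3) (j k : Fin 2),
      g = alternatingThreeCycle ^ (i : ℕ) * alternatingDoubleSwap ^ (j : ℕ) *
        (alternatingThreeCycle * alternatingDoubleSwap * alternatingThreeCycle⁻¹) ^ (k : ℕ) := by
  decide

set_option maxRecDepth 10000 in
theorem alternatingGroup_four_exists_conj :
    ∀ a b : alternatingGroup (Fin 4), a ≠ 1 → b ≠ 1 → a ^ 3 = 1 → b ^ 2 = 1 →
      ∃ σ : Equiv.Perm (Fin 4), σ * alternatingThreeCycle * σ⁻¹ = a ∧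
        σ * alternatingDoubleSwap * σ⁻¹ = b := by
  decide

theorem alternatingGroup_four_conjNormal_bijective :
    Function.Bijective
      (MulAut.conjNormal : Equiv.Perm (Fin 4) →* MulAut (alternatingGroup (Fin 4))) := by
  constructor
  · rw [injective_iff_map_eq_one]
    intro σ hσ
    have h : ∀ σ : Equiv.Perm (Fin 4),
        (∀ g : alternatingGroup (Fin 4), σ * g * σ⁻¹ = g) → σ = 1 := by
      decide
    refine h σ fun g => ?_
    rw [← MulAut.conjNormal_apply, hσ, MulAut.one_apply]
  · intro φ
    have hne {x : alternatingGroup (Fin 4)} (hx : x ≠ 1) : φ x ≠ 1 := by simpa using hx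
    obtain ⟨σ, ha, hb⟩ := alternatingGroup_four_exists_conj (φ alternatingThreeCycle)
      (φ alternatingDoubleSwap) (hne (by decide)) (hne (by decide))
      (by rw [← map_pow, show alternatingThreeCycle ^ 3 = 1 by decide, map_one])
      (by rw [← map_pow, show alternatingDoubleSwap ^ 2 = 1 by decide, map_one])
    rw [← MulAut.conjNormal_apply, Subtype.coe_inj] at ha hb
    refine ⟨σ, MulEquiv.ext fun g => ?_⟩
    obtain ⟨i, j, k, rfl⟩ := alternatingGroup_four_eq_word g
    simp only [map_mul, map_pow, map_inv, ha, hb]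

theorem isKleinFour_units_zmod_eight : IsKleinFour (ZMod 8)ˣ where
  card_four := by rw [Nat.card_eq_fintype_card]; decide
  exponent_two := by
    refine (Nat.prime_two.eq_one_or_self_of_dvd _
      (Monoid.exponent_dvd_of_forall_pow_eq_one (by decide))).resolve_left fun h => ?_
    have := Monoid.exp_eq_one_iff.mp h
    exact absurd (Subsingleton.elim (1 : (ZMod 8)ˣ) (-1)) (by decide)

theorem isKleinFour_zmod_two_prod :
    IsKleinFour (Multiplicative (ZMod 2) × Multiplicative (ZMod 2)) where
  card_four := by simp
  exponent_two := by simp [Monoid.exponent_prod]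

/-- The automorphism group of `A₄ × C₈` (a group of order 96) is isomorphic to
`S₄ × C₂ × C₂`. -/
theorem aut_A4xC8_iso_S4xC2xC2 :
    Nonempty
      (MulAut (↥(alternatingGroup (Fin 4)) × Multiplicative (ZMod 8)) ≃*
        Equiv.Perm (Fin 4) × Multiplicative (ZMod 2) × Multiplicative (ZMod 2)) := by
  have := isKleinFour_units_zmod_eight
  have := isKleinFour_zmod_two_prod
  obtain ⟨e⟩ := IsKleinFour.nonempty_mulEquiv (G₁ := (ZMod 8)ˣ)
    (G₂ := Multiplicative (ZMod 2) × Multiplicative (ZMod 2))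
  let c : MulAut (Multiplicative (ZMod 8)) ≃* (ZMod 8)ˣ :=
    (MulAutMultiplicative (ZMod 8)).trans (ZMod.AddAutEquivUnits 8).toMultiplicative
  exact ⟨(MulEquiv.ofBijective (mulAutProdHom _ _) ⟨mulAutProdHom_injective _ _,
    mulAutProdHom_surjective center_alternatingGroup_four
      alternatingGroup_four_hom_eq_one⟩).symm.trans
    ((MulEquiv.ofBijective _ alternatingGroup_four_conjNormal_bijective).symm.prodCongr
      (c.trans e))⟩
end

section
/- The automorphism group of A₄ × D₄ (a group of order 96, where A₄ is the alternating group on 4 letters and D₄ is the dihedral group of order 8) is isomorphic to S₄ × D₄. -/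
section Prod

variable {G H : Type*} [Group G] [Group H]

/-- Pairs of automorphisms act on a direct product componentwise. -/
def MulAut.prodCongrHom (G H : Type*) [Group G] [Group H] :
    MulAut G × MulAut H →* MulAut (G × H) where
  toFun p := MulEquiv.prodCongr p.1 p.2
  map_one' := rfl
  map_mul' _ _ := rfl

theorem MulAut.prodCongrHom_injective : Function.Injective (MulAut.prodCongrHom G H) := by
  rintro ⟨a, b⟩ ⟨a', b'⟩ h
  refine Prod.ext (MulEquiv.ext fun g => ?_) (MulEquiv.ext fun k => ?_)
  · exact congrArg Prod.fst (DFunLike.congr_fun h (g, 1))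
  · exact congrArg Prod.snd (DFunLike.congr_fun h (1, k))

/-- If there is no nontrivial homomorphism `G →* H`, an automorphism of `G × H` preserves the
first factor. -/
theorem MulAut.snd_apply_left_eq_one (hGH : ∀ c : G →* H, c = 1) (f : MulAut (G × H)) (g : G) :
    (f (g, 1)).2 = 1 :=
  DFunLike.congr_fun
    (hGH ((MonoidHom.snd G H).comp (f.toMonoidHom.comp (MonoidHom.inl G H)))) g

theorem MulAut.apply_left (hGH : ∀ c : G →* H, c = 1) (f : MulAut (G × H)) (g : G) :
    f (g, 1) = ((f (g, 1)).1, 1) :=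
  Prod.ext rfl (MulAut.snd_apply_left_eq_one hGH f g)

/-- If there is no nontrivial homomorphism `G →* H` and `G` is centerless, an automorphism of
`G × H` preserves the second factor. -/
theorem MulAut.fst_apply_right_eq_one (hGH : ∀ c : G →* H, c = 1)
    (hG : Subgroup.center G = ⊥) (f : MulAut (G × H)) (k : H) : (f (1, k)).1 = 1 := by
  rw [← Subgroup.mem_bot, ← hG, Subgroup.mem_center_iff]
  intro g
  have hg : (f ((f⁻¹ (g, 1)).1, 1)).1 = g := by
    rw [← MulAut.apply_left hGH f⁻¹ g, MulAut.apply_inv_self]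
  have hcomm : f ((f⁻¹ (g, 1)).1, 1) * f (1, k) = f (1, k) * f ((f⁻¹ (g, 1)).1, 1) := by
    simp only [← map_mul, Prod.mk_mul_mk, one_mul, mul_one]
  simpa only [Prod.fst_mul, hg] using congrArg Prod.fst hcomm

theorem MulAut.apply_right (hGH : ∀ c : G →* H, c = 1)
    (hG : Subgroup.center G = ⊥) (f : MulAut (G × H)) (k : H) :
    f (1, k) = (1, (f (1, k)).2) :=
  Prod.ext (MulAut.fst_apply_right_eq_one hGH hG f k) rfl

theorem MulAut.prodCongrHom_surjective (hGH : ∀ c : G →* H, c = 1)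
    (hG : Subgroup.center G = ⊥) : Function.Surjective (MulAut.prodCongrHom G H) := by
  intro f
  let a (e : MulAut (G × H)) : G →* G :=
    (MonoidHom.fst G H).comp (e.toMonoidHom.comp (MonoidHom.inl G H))
  let d (e : MulAut (G × H)) : H →* H :=
    (MonoidHom.snd G H).comp (e.toMonoidHom.comp (MonoidHom.inr G H))
  have ha (e : MulAut (G × H)) (g : G) : a e⁻¹ (a e g) = g := by
    change (e⁻¹ ((e (g, 1)).1, 1)).1 = g
    rw [← MulAut.apply_left hGH e g, MulAut.inv_apply_self]
  have hd (e : MulAut (G × H)) (k : H) : d e⁻¹ (d e k) = k := by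
    change (e⁻¹ (1, (e (1, k)).2)).2 = k
    rw [← MulAut.apply_right hGH hG e k, MulAut.inv_apply_self]
  refine ⟨((a f).toMulEquiv (a f⁻¹) (MonoidHom.ext (ha f))
      (MonoidHom.ext (fun x => by have h := ha f⁻¹ x; rwa [inv_inv] at h)),
    (d f).toMulEquiv (d f⁻¹) (MonoidHom.ext (hd f))
      (MonoidHom.ext (fun x => by have h := hd f⁻¹ x; rwa [inv_inv] at h))), MulEquiv.ext ?_⟩
  rintro ⟨g, k⟩
  have hgk : f (g, k) = f (g, 1) * f (1, k) := by
    rw [← map_mul, Prod.mk_mul_mk, one_mul, mul_one]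
  rw [hgk, MulAut.apply_left hGH f g, MulAut.apply_right hGH hG f k, Prod.mk_mul_mk,
    one_mul, mul_one]
  rfl

end Prod

namespace DihedralGroup

/-- The automorphism of `DihedralGroup n` fixing the rotations and shifting the reflections. -/
def shiftAut {n : ℕ} (i : ZMod n) : MulAut (DihedralGroup n) where
  toFun
    | r j => r j
    | sr j => sr (j + i)
  invFun
    | r j => r j
    | sr j => sr (j - i)
  left_inv := by rintro (j | j) <;> simp
  right_inv := by rintro (j | j) <;> simp
  map_mul' := by rintro (j | j) (k | k) <;> simp <;> ring

/-- The automorphism of `DihedralGroup n` inverting the rotations and reversing the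
reflections. -/
def flipAut {n : ℕ} (i : ZMod n) : MulAut (DihedralGroup n) where
  toFun
    | r j => r (-j)
    | sr j => sr (-j - i)
  invFun
    | r j => r (-j)
    | sr j => sr (-j - i)
  left_inv := by rintro (j | j) <;> simp
  right_inv := by rintro (j | j) <;> simp
  map_mul' := by rintro (j | j) (k | k) <;> simp <;> ring

/-- The action of `DihedralGroup n` on itself in which a rotation shifts the reflections and a
reflection inverts the rotations. -/
def toAut (n : ℕ) : DihedralGroup n →* MulAut (DihedralGroup n) where
  toFun
    | r i => shiftAut i
    | sr i => flipAut i
  map_one' := by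
    refine MulEquiv.ext ?_
    rintro (j | j)
    · rfl
    · exact congrArg sr (add_zero j)
  map_mul' := by
    rintro (i | i) (j | j) <;> refine MulEquiv.ext ?_ <;> rintro (k | k) <;>
      simp [shiftAut, flipAut] <;> ring

/-- Two automorphisms agreeing on `r 1` and `sr 0` are equal. -/
theorem mulAut_ext {n : ℕ} {f g : MulAut (DihedralGroup n)} (hr : f (r 1) = g (r 1))
    (hs : f (sr 0) = g (sr 0)) : f = g := by
  have hrot (i : ZMod n) : f (r i) = g (r i) := by
    obtain ⟨m, rfl⟩ := ZMod.intCast_surjective i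
    rw [← r_one_zpow, map_zpow, map_zpow, hr]
  refine MulEquiv.ext ?_
  rintro (i | i)
  · exact hrot i
  · have h : (sr i : DihedralGroup n) = sr 0 * r i := by simp
    rw [h, map_mul, map_mul, hs, hrot]

theorem toAut_four_bijective : Function.Bijective (toAut 4) := by
  constructor
  · rw [injective_iff_map_eq_one]
    intro x hx
    have h₁ := DFunLike.congr_fun hx (r 1)
    have h₂ := DFunLike.congr_fun hx (sr 0)
    revert h₁ h₂
    clear hx
    revert x
    decide
  · intro f
    have key : ∀ x y : DihedralGroup 4, x ^ 2 ≠ 1 → y ≠ 1 → y ^ 2 = 1 → y ≠ x ^ 2 →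
        ∃ z, toAut 4 z (r 1) = x ∧ toAut 4 z (sr 0) = y := by decide
    obtain ⟨z, hz₁, hz₂⟩ := key (f (r 1)) (f (sr 0))
      (by rw [← map_pow, Ne, map_eq_one_iff f f.injective]; decide)
      (by rw [Ne, map_eq_one_iff f f.injective]; decide)
      (by rw [← map_pow, map_eq_one_iff f f.injective]; decide)
      (by rw [← map_pow, Ne, f.injective.eq_iff]; decide)
    exact ⟨z, mulAut_ext hz₁ hz₂⟩

end DihedralGroup

namespace AlternatingFour

open Equiv

/-- The `3`-cycle `(0 1 2)` in `A₄`. -/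
def threeCycle : alternatingGroup (Fin 4) := ⟨swap 0 1 * swap 1 2, Perm.mem_alternatingGroup.2 (by decide)⟩

/-- The double transposition `(0 1)(2 3)` in `A₄`. -/
def doubleSwap : alternatingGroup (Fin 4) := ⟨swap 0 1 * swap 2 3, Perm.mem_alternatingGroup.2 (by decide)⟩

set_option maxRecDepth 100000 in
theorem exists_eq_mul (g : alternatingGroup (Fin 4)) : ∃ i j : Fin 2, ∃ k : Fin 3,
    g = doubleSwap ^ (i : ℕ) * (threeCycle * doubleSwap * threeCycle⁻¹) ^ (j : ℕ) *
      threeCycle ^ (k : ℕ) := by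
  revert g
  decide

theorem hom_ext {M : Type*} [Group M] {f g : alternatingGroup (Fin 4) →* M}
    (hx : f threeCycle = g threeCycle) (hy : f doubleSwap = g doubleSwap) : f = g := by
  ext a
  obtain ⟨i, j, k, rfl⟩ := exists_eq_mul a
  simp only [map_mul, map_pow, map_inv, hx, hy]

set_option maxRecDepth 100000 in
theorem center_eq_bot : Subgroup.center (alternatingGroup (Fin 4)) = ⊥ := by
  rw [eq_bot_iff]
  intro z hz
  have hx := Subgroup.mem_center_iff.1 hz threeCycle
  have hy := Subgroup.mem_center_iff.1 hz doubleSwap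
  rw [Subgroup.mem_bot]
  clear hz
  revert z
  decide

/-- `A₄` is generated by elements of order `3`, so it maps trivially to a group without such
elements. -/
theorem hom_eq_one {M : Type*} [Group M] (hM : ∀ m : M, m ^ 3 = 1 → m = 1)
    (c : alternatingGroup (Fin 4) →* M) : c = 1 := by
  have hc (g : alternatingGroup (Fin 4)) (hg : g ^ 3 = 1) : c g = 1 :=
    hM _ (by rw [← map_pow, hg, map_one])
  have hx : c threeCycle = 1 := hc _ (by decide)
  have hxy : c (threeCycle * doubleSwap) = 1 := hc _ (by decide)
  refine hom_ext hx ?_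
  rwa [map_mul, hx, one_mul] at hxy

set_option maxRecDepth 100000 in
set_option synthInstance.maxSize 1000 in
theorem exists_conj_eq : ∀ x y : alternatingGroup (Fin 4), x ^ 3 = 1 → x ≠ 1 → y ^ 2 = 1 →
    y ≠ 1 → ∃ s : Perm (Fin 4), s * threeCycle * s⁻¹ = x ∧ s * doubleSwap * s⁻¹ = y := by
  decide

set_option maxRecDepth 100000 in
theorem eq_one_of_commute : ∀ s : Perm (Fin 4), s * threeCycle * s⁻¹ = threeCycle →
    s * doubleSwap * s⁻¹ = doubleSwap → s = 1 := by
  decide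

theorem conjNormal_bijective :
    Function.Bijective (MulAut.conjNormal : Perm (Fin 4) →* MulAut (alternatingGroup (Fin 4))) := by
  constructor
  · rw [injective_iff_map_eq_one]
    intro s hs
    refine eq_one_of_commute s ?_ ?_ <;>
      rw [← MulAut.conjNormal_apply, hs, MulAut.one_apply]
  · intro f
    obtain ⟨s, hx, hy⟩ := exists_conj_eq (f threeCycle) (f doubleSwap)
      (by rw [← map_pow, map_eq_one_iff f f.injective]; decide)
      (by rw [Ne, map_eq_one_iff f f.injective]; decide)
      (by rw [← map_pow, map_eq_one_iff f f.injective]; decide)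
      (by rw [Ne, map_eq_one_iff f f.injective]; decide)
    refine ⟨s, MulEquiv.toMonoidHom_injective (hom_ext (Subtype.ext ?_) (Subtype.ext ?_))⟩
    · exact (MulAut.conjNormal_apply s threeCycle).trans hx
    · exact (MulAut.conjNormal_apply s doubleSwap).trans hy

end AlternatingFour

/-- The automorphism group of `A₄ × D₄` (a group of order 96, where `D₄` is the
dihedral group of order 8) is isomorphic to `S₄ × D₄`. -/
theorem aut_A4xD4_iso_S4xD4 :
    Nonempty
      (MulAut (↥(alternatingGroup (Fin 4)) × DihedralGroup 4) ≃*
        Equiv.Perm (Fin 4) × DihedralGroup 4) := by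
  have hD : ∀ m : DihedralGroup 4, m ^ 3 = 1 → m = 1 := by decide
  let e := MulEquiv.ofBijective (MulAut.prodCongrHom (alternatingGroup (Fin 4)) (DihedralGroup 4))
    ⟨MulAut.prodCongrHom_injective, MulAut.prodCongrHom_surjective
      (AlternatingFour.hom_eq_one hD) AlternatingFour.center_eq_bot⟩
  exact ⟨e.symm.trans (MulEquiv.prodCongr
    (MulEquiv.ofBijective _ AlternatingFour.conjNormal_bijective).symm
    (MulEquiv.ofBijective _ DihedralGroup.toAut_four_bijective).symm)⟩
end
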